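/- arXiv:2005.13824 — 2 statements merged into one kernel-verified Lean document; each statement's English description precedes it below -/
import Mathlib

section
/- Fix k ≥ 0 and let ℓ = ℓ(n) be a sequence of nonnegative integers with ℓ = O(√n). Define the random vector V^{(n)} = (R^{(n+1)}, …, R^{(n+ℓ)}, λ^{(n+ℓ)}) ∈ 𝒩^ℓ × 𝕐 from a Plancherel growth process, and let V̄^{(n)} = (R̄^{(n+1)}, …, R̄^{(n+ℓ)}, λ̄^{(n+ℓ)}) be a vector of independent random variables where each R̄^{(n+i)} takes value r with probability 1/√n for r ∈ {0,…,k} and value ∞ with probability 1 − (k+1)/√n, and λ̄^{(n+ℓ)} is Plancherel-distributed on 𝕐_{n+ℓ}. Then the total variation distance satisfies δ(V^{(n)}, V̄^{(n)}) = o(ℓ/√n) as n → ∞. -/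
open MeasureTheory Filter

/-- The number of standard Young tableaux of shape `μ`: bijective fillings of the cells of `μ`
by `0, 1, …, μ.card - 1` that are strictly increasing along rows and columns. -/
noncomputable def sytCount (μ : YoungDiagram) : ℕ :=
  Nat.card {T : μ.cells → Fin μ.card //
    Function.Bijective T ∧
      ∀ a b : μ.cells, (a : ℕ × ℕ).1 ≤ (b : ℕ × ℕ).1 → (a : ℕ × ℕ).2 ≤ (b : ℕ × ℕ).2 →
        a ≠ b → T a < T b}

/-- `lam 0 ↗ lam 1 ↗ ⋯` is a Plancherel growth process: the probability of any prescribed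
initial path `∅ = μ⁽⁰⁾ ↗ μ⁽¹⁾ ↗ ⋯ ↗ μ⁽ⁿ⁾` in the Young graph equals `d_{μ⁽ⁿ⁾} / n!`,
which characterizes the distribution of the sequence of RSK shapes of an i.i.d. uniform
sequence. -/
def IsPlancherelGrowthProcess {Ω : Type*} [MeasurableSpace Ω] (P : Measure Ω)
    (lam : ℕ → Ω → YoungDiagram) : Prop :=
  IsProbabilityMeasure P ∧
  (∀ (n : ℕ) (y : YoungDiagram), MeasurableSet {ω | lam n ω = y}) ∧
  ∀ (n : ℕ) (path : ℕ → YoungDiagram), path 0 = ⊥ →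
    (∀ i, i < n → path i ≤ path (i + 1) ∧ (path (i + 1)).card = (path i).card + 1) →
    P {ω | ∀ i ≤ n, lam i ω = path i} =
      (sytCount (path n) : ENNReal) / (Nat.factorial n : ENNReal)

/-- The event `E_r⁽ⁿ⁺¹⁾` that the box added in step `n+1` of the growth process
(i.e. the unique box of `λ⁽ⁿ⁺¹⁾ ∖ λ⁽ⁿ⁾`) lies in the row with index `r`. -/
def growthEvent {Ω : Type*} (lam : ℕ → Ω → YoungDiagram) (n r : ℕ) : Set Ω :=
  {ω | (lam (n + 1) ω).rowLen r = (lam n ω).rowLen r + 1}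

/-- The Plancherel measure `Pl_n` on Young diagrams with `n` boxes: the probability of a
diagram `μ` with `μ.card = n` is `d_μ² / n!` (and `0` for diagrams with `μ.card ≠ n`). -/
noncomputable def plancherelProb (n : ℕ) (μ : YoungDiagram) : ℝ :=
  if μ.card = n then (sytCount μ : ℝ) ^ 2 / (Nat.factorial n : ℝ) else 0

/-- The element of `𝒩 = {0,1,…,k,∞}` (encoded as `Option (Fin (k+1))`, with `none = ∞`)
recording in which of the bottom `k+1` rows the growth from `μ` to `ν` occurred, or `∞`
(i.e. `none`) if it occurred in a higher row. -/
noncomputable def rowIdx (k : ℕ) (μ ν : YoungDiagram) : Option (Fin (k + 1)) :=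
  if h : ∃ r : Fin (k + 1), ν.rowLen r = μ.rowLen r + 1 then some h.choose else none

/-- The distribution of `R̄⁽ⁿ⁺ⁱ⁾` on `𝒩 = {0,…,k,∞}`: each `r ∈ {0,…,k}` has probability
`1/√n` and `∞` has probability `1 - (k+1)/√n`. -/
noncomputable def barRowProb (n k : ℕ) : Option (Fin (k + 1)) → ℝ
  | some _ => 1 / Real.sqrt n
  | none => 1 - (k + 1) / Real.sqrt n

namespace PG
open Finset

/-- Covering relation of the Young graph. -/
def Cov (l L : YoungDiagram) : Prop := l ≤ L ∧ L.card = l.card + 1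

noncomputable instance instDecEqYD : DecidableEq YoungDiagram := Classical.decEq _
noncomputable instance instDecCov (l L : YoungDiagram) : Decidable (Cov l L) := Classical.dec _

theorem yd_ext {l L : YoungDiagram} (h : l.cells = L.cells) : l = L := by
  cases l; cases L; simp at h; subst h; rfl

theorem cov_cell {l L : YoungDiagram} (h : Cov l L) :
    ∃ c, c ∉ l.cells ∧ L.cells = insert c l.cells := by
  obtain ⟨h1, h2⟩ := h
  have h1' := YoungDiagram.cells_subset_iff.2 h1
  have : (L.cells \ l.cells).card = 1 := by
    rw [card_sdiff_of_subset h1']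
    have : L.cells.card = l.cells.card + 1 := h2
    omega
  obtain ⟨c, hc⟩ := card_eq_one.1 this
  refine ⟨c, ?_, ?_⟩
  · have : c ∈ L.cells \ l.cells := by rw [hc]; simp
    exact (mem_sdiff.1 this).2
  · rw [insert_eq, ← hc]
    exact (sdiff_union_of_subset h1').symm

theorem cov_of_cell {l L : YoungDiagram} {c : ℕ × ℕ} (hc : c ∉ l.cells)
    (h : L.cells = insert c l.cells) : Cov l L := by
  refine ⟨YoungDiagram.cells_subset_iff.1 (h ▸ subset_insert _ _), ?_⟩
  change L.cells.card = l.cells.card + 1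
  rw [h, card_insert_of_notMem hc]

theorem mem_lt_card (l : YoungDiagram) (c : ℕ × ℕ) (hc : c ∈ l.cells) :
    c.1 < l.card ∧ c.2 < l.card := by
  constructor
  · have : (range (c.1 + 1)).image (fun i => (i, c.2)) ⊆ l.cells := by
      intro x hx
      simp only [mem_image, mem_range] at hx
      obtain ⟨i, hi, rfl⟩ := hx
      exact l.up_left_mem (by omega) le_rfl hc
    have h2 := card_le_card this
    rw [card_image_of_injective _ (fun a b h => (Prod.ext_iff.1 h).1)] at h2
    simp at h2; exact h2
  · have : (range (c.2 + 1)).image (fun i => (c.1, i)) ⊆ l.cells := by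
      intro x hx
      simp only [mem_image, mem_range] at hx
      obtain ⟨i, hi, rfl⟩ := hx
      exact l.up_left_mem le_rfl (by omega) hc
    have h2 := card_le_card this
    rw [card_image_of_injective _ (fun a b h => (Prod.ext_iff.1 h).2)] at h2
    simp at h2; exact h2

theorem finite_card (n : ℕ) : {l : YoungDiagram | l.card = n}.Finite := by
  apply Set.Finite.of_finite_image (f := fun l => l.cells)
  · apply Set.Finite.subset ((range n ×ˢ range n).powerset).finite_toSet
    rintro _ ⟨l, hl, rfl⟩
    simp only [Set.mem_ofPred_eq] at hl
    simp only [coe_powerset, Set.mem_preimage, Set.mem_powerset_iff, coe_subset]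
    intro c hc
    have := mem_lt_card l c hc
    simp only [mem_product, mem_range]; omega
  · intro a _ b _ h
    exact yd_ext h

/-- Diagrams with `n` boxes. -/
noncomputable def Y (n : ℕ) : Finset YoungDiagram := (finite_card n).toFinset

@[simp] theorem mem_Y {n : ℕ} {l : YoungDiagram} : l ∈ Y n ↔ l.card = n := by simp [Y]

noncomputable def up (l : YoungDiagram) : Finset YoungDiagram := (Y (l.card + 1)).filter (Cov l)
noncomputable def dn (L : YoungDiagram) : Finset YoungDiagram :=
  (Y (L.card - 1)).filter (fun l => Cov l L)

@[simp] theorem mem_up {l L : YoungDiagram} : L ∈ up l ↔ Cov l L := by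
  simp only [up, mem_filter, mem_Y, and_iff_right_iff_imp]
  exact fun h => h.2
@[simp] theorem mem_dn {l L : YoungDiagram} : l ∈ dn L ↔ Cov l L := by
  simp only [dn, mem_filter, mem_Y, and_iff_right_iff_imp]
  intro h; have := h.2; omega

/-- Power sums of contents. -/
noncomputable def ps (j : ℕ) (l : YoungDiagram) : ℝ := ∑ c ∈ l.cells, ((c.2 : ℝ) - c.1) ^ j

/-- Content of the added box. -/
noncomputable def cc (l L : YoungDiagram) : ℝ := ps 1 L - ps 1 l

theorem cc_eq {l L : YoungDiagram} {c : ℕ × ℕ} (hc : c ∉ l.cells)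
    (h : L.cells = insert c l.cells) : cc l L = (c.2 : ℝ) - c.1 := by
  simp [cc, ps, h, sum_insert hc]

theorem ps_cov {l L : YoungDiagram} (h : Cov l L) (j : ℕ) : ps j L = ps j l + cc l L ^ j := by
  obtain ⟨c, hc, hL⟩ := cov_cell h
  rw [cc_eq hc hL]
  simp only [ps, hL, sum_insert hc]; ring

theorem rowLen_cov {l L : YoungDiagram} {c : ℕ × ℕ} (hc : c ∉ l.cells)
    (h : L.cells = insert c l.cells) (r : ℕ) :
    L.rowLen r = l.rowLen r + if r = c.1 then 1 else 0 := by
  rw [YoungDiagram.rowLen_eq_card, YoungDiagram.rowLen_eq_card, YoungDiagram.row,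
    YoungDiagram.row, h, filter_insert]
  by_cases hr : c.1 = r
  · rw [if_pos hr, if_pos hr.symm, card_insert_of_notMem]
    simp only [mem_filter, not_and]; intro h'; exact absurd h' hc
  · rw [if_neg hr, if_neg (Ne.symm hr)]; rfl

theorem cell_col {l L : YoungDiagram} {c : ℕ × ℕ} (hc : c ∉ l.cells)
    (h : L.cells = insert c l.cells) : c.2 = l.rowLen c.1 := by
  have h1 : (c.1, c.2) ∈ L := by
    rw [← YoungDiagram.mem_cells, h]; simp
  have h2 : (c.1, c.2) ∉ l := by
    rw [← YoungDiagram.mem_cells]; exact hc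
  rw [YoungDiagram.mem_iff_lt_rowLen] at h1 h2
  rw [rowLen_cov hc h, if_pos rfl] at h1
  omega

/-- Row condition. -/
def inRow (r : ℕ) (l L : YoungDiagram) : Prop := L.rowLen r = l.rowLen r + 1
noncomputable instance (r : ℕ) (l L : YoungDiagram) : Decidable (inRow r l L) := Classical.dec _

theorem inRow_iff {l L : YoungDiagram} {c : ℕ × ℕ} (hc : c ∉ l.cells)
    (h : L.cells = insert c l.cells) (r : ℕ) : inRow r l L ↔ r = c.1 := by
  unfold inRow
  rw [rowLen_cov hc h]
  split_ifs <;> simp_all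

theorem inRow_unique {l L : YoungDiagram} (h : Cov l L) : ∃! r, inRow r l L := by
  obtain ⟨c, hc, hL⟩ := cov_cell h
  refine ⟨c.1, (inRow_iff hc hL _).2 rfl, fun y hy => (inRow_iff hc hL _).1 hy⟩

theorem up_row_unique {l L L' : YoungDiagram} (h : Cov l L) (h' : Cov l L') {r : ℕ}
    (hr : inRow r l L) (hr' : inRow r l L') : L = L' := by
  obtain ⟨c, hc, hL⟩ := cov_cell h
  obtain ⟨c', hc', hL'⟩ := cov_cell h'
  have e1 := (inRow_iff hc hL _).1 hr
  have e2 := (inRow_iff hc' hL' _).1 hr'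
  have e3 := cell_col hc hL
  have e4 := cell_col hc' hL'
  have : c = c' := by
    apply Prod.ext
    · omega
    · rw [e3, e4, ← e1, ← e2]
  apply yd_ext
  rw [hL, hL', this]

theorem dn_row_unique {l l' L : YoungDiagram} (h : Cov l L) (h' : Cov l' L) {r : ℕ}
    (hr : inRow r l L) (hr' : inRow r l' L) : l = l' := by
  obtain ⟨c, hc, hL⟩ := cov_cell h
  obtain ⟨c', hc', hL'⟩ := cov_cell h'
  have e1 := (inRow_iff hc hL _).1 hr
  have e2 := (inRow_iff hc' hL' _).1 hr'
  have e3 := cell_col hc hL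
  have e4 := cell_col hc' hL'
  unfold inRow at hr hr'
  have : c = c' := by
    apply Prod.ext
    · omega
    · rw [e3, e4, ← e1, ← e2]; omega
  subst this
  apply yd_ext
  have := congrArg (fun s => s.erase c) (hL.symm.trans hL')
  simpa [erase_insert hc, erase_insert hc'] using this

/-- Splitting lemma for the lattice. -/
theorem sup_cov {l v : YoungDiagram} (hcard : l.card = v.card) :
    Cov l (l ⊔ v) ↔ Cov (l ⊓ v) l := by
  have h : (l.cells ∪ v.cells).card + (l.cells ∩ v.cells).card = l.cells.card + v.cells.card :=
    card_union_add_card_inter _ _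
  simp only [Cov, le_sup_left, inf_le_left, true_and]
  change (l.cells ∪ v.cells).card = l.cells.card + 1 ↔ l.cells.card = (l.cells ∩ v.cells).card + 1
  have : l.cells.card = v.cells.card := hcard
  omega

theorem cc_sup (l v : YoungDiagram) : cc l (l ⊔ v) = cc (l ⊓ v) v := by
  have : ps 1 (l ⊔ v) + ps 1 (l ⊓ v) = ps 1 l + ps 1 v := by
    simp only [ps, YoungDiagram.cells_sup, YoungDiagram.cells_inf]
    exact sum_union_inter
  unfold cc; linarith

theorem eq_sup {l v L : YoungDiagram} (h : Cov l L) (h' : Cov v L) (hne : v ≠ l) : L = l ⊔ v := by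
  have hcard : l.card = v.card := by have := h.2; have := h'.2; omega
  have hle : l ⊔ v ≤ L := sup_le h.1 h'.1
  have hlt : l < l ⊔ v := by
    refine lt_of_le_of_ne le_sup_left ?_
    intro e
    have hvl : v ≤ l := by rw [e]; exact le_sup_right
    apply hne
    apply yd_ext
    exact eq_of_subset_of_card_le (YoungDiagram.cells_subset_iff.2 hvl) (le_of_eq hcard)
  have h1 : l.cells.card < (l ⊔ v).cells.card := card_lt_card (YoungDiagram.cells_ssubset_iff.2 hlt)
  symm
  apply yd_ext
  apply eq_of_subset_of_card_le (YoungDiagram.cells_subset_iff.2 hle)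
  have : L.cells.card = l.cells.card + 1 := h.2
  omega

theorem eq_inf {l v L : YoungDiagram} (h : Cov v l) (h' : Cov v L) (hne : L ≠ l) : v = l ⊓ L := by
  have hcard : l.card = L.card := by have := h.2; have := h'.2; omega
  have hle : v ≤ l ⊓ L := le_inf h.1 h'.1
  have hlt : l ⊓ L < l := by
    refine lt_of_le_of_ne inf_le_left ?_
    intro e
    have hvl : l ≤ L := by rw [← e]; exact inf_le_right
    apply hne
    symm
    apply yd_ext
    exact eq_of_subset_of_card_le (YoungDiagram.cells_subset_iff.2 hvl) (le_of_eq hcard.symm)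
  have h1 : (l ⊓ L).cells.card < l.cells.card := card_lt_card (YoungDiagram.cells_ssubset_iff.2 hlt)
  apply yd_ext
  apply eq_of_subset_of_card_le (YoungDiagram.cells_subset_iff.2 hle)
  have : l.cells.card = v.cells.card + 1 := h.2
  omega

theorem offdiag (l : YoungDiagram) (F : YoungDiagram → ℝ) (g : ℝ → ℝ) :
    ∑ L ∈ up l, ∑ v ∈ (dn L).erase l, g (cc l L) * F v =
    ∑ v ∈ dn l, ∑ L ∈ (up v).erase l, g (cc v L) * F L := by
  rw [sum_sigma', sum_sigma']
  refine sum_bij' (fun x _ => ⟨l ⊓ x.2, x.2⟩) (fun x _ => ⟨l ⊔ x.2, x.2⟩) ?_ ?_ ?_ ?_ ?_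
  · rintro ⟨L, v⟩ hx
    simp only [mem_sigma, mem_up, mem_erase, mem_dn] at hx ⊢
    obtain ⟨h1, h2, h3⟩ := hx
    have hcard : l.card = v.card := by have := h1.2; have := h3.2; omega
    have hL := eq_sup h1 h3 h2
    rw [hL] at h1 h3
    refine ⟨(sup_cov hcard).1 h1, h2, ?_⟩
    rw [inf_comm]; rw [sup_comm] at h3
    exact (sup_cov hcard.symm).1 h3
  · rintro ⟨v, L⟩ hx
    simp only [mem_sigma, mem_up, mem_erase, mem_dn] at hx ⊢
    obtain ⟨h1, h2, h3⟩ := hx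
    have hcard : l.card = L.card := by have := h1.2; have := h3.2; omega
    have hL := eq_inf h1 h3 h2
    rw [hL] at h1 h3
    refine ⟨(sup_cov hcard).2 h1, h2, ?_⟩
    rw [sup_comm]; rw [inf_comm] at h3
    exact (sup_cov hcard.symm).2 h3
  · rintro ⟨L, v⟩ hx
    simp only [mem_sigma, mem_up, mem_erase, mem_dn] at hx ⊢
    obtain ⟨h1, h2, h3⟩ := hx
    rw [← eq_sup h1 h3 h2]
  · rintro ⟨v, L⟩ hx
    simp only [mem_sigma, mem_up, mem_erase, mem_dn] at hx ⊢
    obtain ⟨h1, h2, h3⟩ := hx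
    rw [← eq_inf h1 h3 h2]
  · rintro ⟨L, v⟩ hx
    simp only [mem_sigma, mem_up, mem_erase, mem_dn] at hx ⊢
    obtain ⟨h1, h2, h3⟩ := hx
    rw [← cc_sup, ← eq_sup h1 h3 h2]

end PG

namespace PG
open Finset

theorem rowLen_addable {l L : YoungDiagram} {c : ℕ × ℕ} (hc : c ∉ l.cells)
    (h : L.cells = insert c l.cells) : c.1 = 0 ∨ l.rowLen c.1 < l.rowLen (c.1 - 1) := by
  by_cases h0 : c.1 = 0
  · exact Or.inl h0
  · right
    have h1 := L.rowLen_anti (c.1 - 1) c.1 (by omega)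
    rw [rowLen_cov hc h, rowLen_cov hc h, if_pos rfl, if_neg (by omega)] at h1
    omega

theorem rowLen_removable {l L : YoungDiagram} {c : ℕ × ℕ} (hc : c ∉ l.cells)
    (h : L.cells = insert c l.cells) : L.rowLen (c.1 + 1) < L.rowLen c.1 := by
  have h1 := l.rowLen_anti c.1 (c.1 + 1) (by omega)
  rw [rowLen_cov hc h, rowLen_cov hc h, if_pos rfl, if_neg (by omega)]
  omega

noncomputable def addBox (l : YoungDiagram) (r : ℕ) (h : r = 0 ∨ l.rowLen r < l.rowLen (r - 1)) :
    YoungDiagram where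
  cells := insert (r, l.rowLen r) l.cells
  isLowerSet := by
    rintro ⟨a1, a2⟩ ⟨b1, b2⟩ hab ha
    have h1 : b1 ≤ a1 := hab.1
    have h2 : b2 ≤ a2 := hab.2
    simp only [coe_insert, Set.mem_insert_iff, Prod.mk.injEq, mem_coe,
      YoungDiagram.mem_cells, YoungDiagram.mem_iff_lt_rowLen] at ha ⊢
    rcases ha with ⟨rfl, rfl⟩ | ha
    · rcases Nat.lt_or_ge b1 a1 with h3 | h3
      · right
        have := l.rowLen_anti b1 (a1 - 1) (by omega)
        omega
      · have : b1 = a1 := by omega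
        subst this
        omega
    · right
      have := l.rowLen_anti b1 a1 h1
      omega

noncomputable def remBox (l : YoungDiagram) (r : ℕ) (h : l.rowLen (r + 1) < l.rowLen r) :
    YoungDiagram where
  cells := l.cells.erase (r, l.rowLen r - 1)
  isLowerSet := by
    rintro ⟨a1, a2⟩ ⟨b1, b2⟩ hab ha
    have h1 : b1 ≤ a1 := hab.1
    have h2 : b2 ≤ a2 := hab.2
    simp only [mem_coe, mem_erase, ne_eq, Prod.mk.injEq,
      YoungDiagram.mem_cells, YoungDiagram.mem_iff_lt_rowLen] at ha ⊢
    have h3 := l.rowLen_anti b1 a1 h1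
    refine ⟨?_, by omega⟩
    rintro ⟨rfl, rfl⟩
    rcases Nat.lt_or_ge b1 a1 with h4 | h4
    · have := l.rowLen_anti (b1 + 1) a1 (by omega)
      omega
    · have : b1 = a1 := by omega
      subst this
      omega

theorem add_notMem (l : YoungDiagram) (r : ℕ) : (r, l.rowLen r) ∉ l.cells := by
  rw [YoungDiagram.mem_cells, YoungDiagram.mem_iff_lt_rowLen]; omega

theorem rem_cells (l : YoungDiagram) (r : ℕ) (h : l.rowLen (r + 1) < l.rowLen r) :
    (r, l.rowLen r - 1) ∉ (remBox l r h).cells ∧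
    l.cells = insert (r, l.rowLen r - 1) (remBox l r h).cells := by
  constructor
  · simp [remBox]
  · simp only [remBox]
    rw [insert_erase]
    rw [YoungDiagram.mem_cells, YoungDiagram.mem_iff_lt_rowLen]; omega

theorem cell_colLen (l : YoungDiagram) (r : ℕ) : 0 < l.rowLen r ↔ r < l.colLen 0 := by
  rw [← YoungDiagram.mem_iff_lt_rowLen, YoungDiagram.mem_iff_lt_colLen]

theorem sum_up (l : YoungDiagram) (g : ℝ → ℝ) :
    ∑ L ∈ up l, g (cc l L) = ∑ r ∈ (range (l.colLen 0 + 1)).filter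
      (fun r => r = 0 ∨ l.rowLen r < l.rowLen (r - 1)), g ((l.rowLen r : ℝ) - r) := by
  symm
  refine sum_bij (fun r hr => addBox l r (mem_filter.1 hr).2) ?_ ?_ ?_ ?_
  · intro r hr
    rw [mem_up]
    exact cov_of_cell (add_notMem l r) rfl
  · intro r hr r' hr' e
    have e1 := rowLen_cov (L := addBox l r (mem_filter.1 hr).2) (add_notMem l r) rfl r
    have e2 := rowLen_cov (L := addBox l r' (mem_filter.1 hr').2) (add_notMem l r') rfl r
    rw [e, e2] at e1
    simp only [if_pos] at e1
    split_ifs at e1 with h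
    · exact h
    · omega
  · intro L hL
    obtain ⟨c, hc, hL⟩ := cov_cell (mem_up.1 hL)
    have h1 := rowLen_addable hc hL
    have h2 := cell_col hc hL
    refine ⟨c.1, ?_, ?_⟩
    · rw [mem_filter]
      refine ⟨?_, h1⟩
      rw [mem_range]
      rcases h1 with h1 | h1
      · omega
      · have := (cell_colLen l (c.1 - 1)).1 (by omega)
        omega
    · apply yd_ext
      simp only [addBox]
      rw [hL, ← h2]
  · intro r hr
    rw [cc_eq (L := addBox l r (mem_filter.1 hr).2) (add_notMem l r) rfl]

theorem sum_dn (l : YoungDiagram) (g : ℝ → ℝ) :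
    ∑ v ∈ dn l, g (cc v l) = ∑ r ∈ (range (l.colLen 0)).filter
      (fun r => l.rowLen (r + 1) < l.rowLen r), g ((l.rowLen r : ℝ) - 1 - r) := by
  symm
  refine sum_bij (fun r hr => remBox l r (mem_filter.1 hr).2) ?_ ?_ ?_ ?_
  · intro r hr
    rw [mem_dn]
    have := rem_cells l r (mem_filter.1 hr).2
    exact cov_of_cell this.1 this.2
  · intro r hr r' hr' e
    have h1 := rem_cells l r (mem_filter.1 hr).2
    have h2 := rem_cells l r' (mem_filter.1 hr').2
    have e1 := rowLen_cov h1.1 h1.2 r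
    have e2 := rowLen_cov h2.1 h2.2 r
    rw [e, e2] at e1
    simp only [if_pos] at e1
    split_ifs at e1 with h
    · exact h
    · omega
  · intro v hv
    obtain ⟨c, hc, hL⟩ := cov_cell (mem_dn.1 hv)
    have h1 := rowLen_removable hc hL
    have h2 := cell_col hc hL
    have h3 := rowLen_cov hc hL c.1
    rw [if_pos rfl] at h3
    refine ⟨c.1, ?_, ?_⟩
    · rw [mem_filter]
      refine ⟨?_, h1⟩
      rw [mem_range]
      exact (cell_colLen l c.1).1 (by omega)
    · apply yd_ext
      simp only [remBox]
      have : (c.1, l.rowLen c.1 - 1) = c := by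
        apply Prod.ext
        · rfl
        · simp; omega
      rw [this, hL, erase_insert hc]
  · intro r hr
    have hr' := (mem_filter.1 hr).2
    have := rem_cells l r hr'
    rw [cc_eq this.1 this.2]
    congr 2
    push_cast [Nat.cast_sub (show 1 ≤ l.rowLen r by omega)]
    ring

theorem sum_cells (l : YoungDiagram) (f : ℕ → ℕ → ℝ) :
    ∑ c ∈ l.cells, f c.1 c.2 = ∑ r ∈ range (l.colLen 0), ∑ j ∈ range (l.rowLen r), f r j := by
  rw [sum_sigma']
  refine sum_bij' (fun c _ => ⟨c.1, c.2⟩) (fun x _ => (x.1, x.2)) ?_ ?_ ?_ ?_ ?_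
  · rintro ⟨a, b⟩ h
    rw [YoungDiagram.mem_cells, YoungDiagram.mem_iff_lt_rowLen] at h
    simp only [mem_sigma, mem_range]
    exact ⟨(cell_colLen l a).1 (by omega), h⟩
  · rintro ⟨a, b⟩ h
    simp only [mem_sigma, mem_range] at h
    rw [YoungDiagram.mem_cells, YoungDiagram.mem_iff_lt_rowLen]
    exact h.2
  · rintro ⟨a, b⟩ h; rfl
  · rintro ⟨a, b⟩ h; rfl
  · rintro ⟨a, b⟩ h; rfl

theorem diag (l : YoungDiagram) (g : ℝ → ℝ) :
    ∑ L ∈ up l, g (cc l L) - ∑ v ∈ dn l, g (cc v l) =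
    g 0 + ∑ c ∈ l.cells, (g ((c.2 : ℝ) - c.1 + 1) + g ((c.2 : ℝ) - c.1 - 1)
      - 2 * g ((c.2 : ℝ) - c.1)) := by
  rw [sum_up, sum_dn, sum_cells l (fun i j => g ((j : ℝ) - i + 1) + g ((j : ℝ) - i - 1)
      - 2 * g ((j : ℝ) - i))]
  set N := l.colLen 0 with hN
  have hN0 : l.rowLen N = 0 := by
    have := cell_colLen l N
    omega
  have inner : ∀ r m : ℕ, ∑ j ∈ range m, (g ((j : ℝ) - r + 1) + g ((j : ℝ) - r - 1)
      - 2 * g ((j : ℝ) - r)) = (g ((m : ℝ) - r) - g ((m : ℝ) - 1 - r)) + g (-((r + 1 : ℕ) : ℝ))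
        - g (-(r : ℝ)) := by
    intro r m
    induction m with
    | zero => simp; ring_nf
    | succ m ih =>
      rw [sum_range_succ, ih]; push_cast
      ring_nf
  simp_rw [inner]
  have tele : ∑ r ∈ range N, (g (-((r + 1 : ℕ) : ℝ)) - g (-(r : ℝ))) = g (-(N : ℝ)) - g 0 := by
    rw [sum_range_sub (fun r : ℕ => g (-(r : ℝ)))]; simp
  have h3 : ∑ r ∈ range N, ((g ((l.rowLen r : ℝ) - r) - g ((l.rowLen r : ℝ) - 1 - r))
      + g (-((r + 1 : ℕ) : ℝ)) - g (-(r : ℝ))) =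
      ∑ r ∈ range N, g ((l.rowLen r : ℝ) - r) - ∑ r ∈ range N, g ((l.rowLen r : ℝ) - 1 - r)
        + (g (-(N : ℝ)) - g 0) := by
    rw [← tele, ← sum_sub_distrib, ← sum_add_distrib]
    apply sum_congr rfl; intros; ring
  rw [h3, sum_filter, sum_filter, sum_range_succ']
  have e1 : ∀ r, (if r + 1 = 0 ∨ l.rowLen (r + 1) < l.rowLen (r + 1 - 1) then
      g ((l.rowLen (r + 1) : ℝ) - (r + 1 : ℕ)) else 0) =
      g ((l.rowLen (r + 1) : ℝ) - (r + 1 : ℕ)) - g ((l.rowLen r : ℝ) - 1 - r) +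
      (if l.rowLen (r + 1) < l.rowLen r then g ((l.rowLen r : ℝ) - 1 - r) else 0) := by
    intro r
    by_cases h : l.rowLen (r + 1) < l.rowLen r
    · simp [h]
    · have h' : l.rowLen (r + 1) = l.rowLen r :=
        le_antisymm (l.rowLen_anti _ _ (by omega)) (by omega)
      simp only [h', lt_irrefl, Nat.add_sub_cancel, if_false, or_false, Nat.add_eq_zero_iff,
        one_ne_zero, and_false]
      push_cast
      ring_nf
  rw [sum_congr rfl (fun r _ => e1 r), sum_add_distrib, sum_sub_distrib]
  have e2 : ∑ r ∈ range N, g ((l.rowLen (r + 1) : ℝ) - (r + 1 : ℕ)) + g ((l.rowLen 0 : ℝ) - (0 : ℕ))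
      = ∑ r ∈ range N, g ((l.rowLen r : ℝ) - r) + g (-(N : ℝ)) := by
    rw [← sum_range_succ' (fun r : ℕ => g ((l.rowLen r : ℝ) - r)), sum_range_succ, hN0]
    simp
  simp only [true_or, if_true]
  linarith

/-- The `P_j` observable. -/
noncomputable def PP (j : ℕ) (l : YoungDiagram) : ℝ :=
  (0 : ℝ) ^ j + ∑ c ∈ l.cells, (((c.2 : ℝ) - c.1 + 1) ^ j + ((c.2 : ℝ) - c.1 - 1) ^ j
      - 2 * ((c.2 : ℝ) - c.1) ^ j)

theorem comm (l : YoungDiagram) (F : YoungDiagram → ℝ) (j : ℕ) :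
    ∑ L ∈ up l, cc l L ^ j * ∑ v ∈ dn L, F v =
    ∑ v ∈ dn l, ∑ L ∈ up v, cc v L ^ j * F L + PP j l * F l := by
  have h1 := offdiag l F (fun x => x ^ j)
  have h2 := diag l (fun x => x ^ j)
  have e1 : ∑ L ∈ up l, cc l L ^ j * ∑ v ∈ dn L, F v = ∑ L ∈ up l, cc l L ^ j * F l +
      ∑ L ∈ up l, ∑ v ∈ (dn L).erase l, cc l L ^ j * F v := by
    rw [← sum_add_distrib]
    apply sum_congr rfl
    intro L hL
    rw [← add_sum_erase (dn L) F (a := l) (by rw [mem_dn]; exact mem_up.1 hL), mul_add, mul_sum]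
  have e2 : ∑ v ∈ dn l, ∑ L ∈ up v, cc v L ^ j * F L = ∑ v ∈ dn l, cc v l ^ j * F l +
      ∑ v ∈ dn l, ∑ L ∈ (up v).erase l, cc v L ^ j * F L := by
    rw [← sum_add_distrib]
    apply sum_congr rfl
    intro v hv
    rw [← add_sum_erase (up v) _ (a := l) (by rw [mem_up]; exact mem_dn.1 hv)]
  rw [e1, e2, ← sum_mul, ← sum_mul]
  rw [h1]
  unfold PP
  rw [← h2]
  ring

end PG

namespace PG
open Finset

def IsSYT (L : YoungDiagram) (f : ℕ × ℕ → ℕ) : Prop :=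
  (∀ c, c ∉ L.cells → f c = 0) ∧ Set.BijOn f L.cells (Set.Iio L.card) ∧
  ∀ a ∈ L.cells, ∀ b ∈ L.cells, a.1 ≤ b.1 → a.2 ≤ b.2 → a ≠ b → f a < f b

theorem sytCount_eq (L : YoungDiagram) : sytCount L = Nat.card {f // IsSYT L f} := by
  unfold sytCount
  apply Nat.card_congr
  refine ⟨fun T => ⟨fun c => if h : c ∈ L.cells then (T.1 ⟨c, h⟩ : ℕ) else 0, ?_, ?_, ?_⟩,
    fun f => ⟨fun c => ⟨f.1 c, f.2.2.1.mapsTo c.2⟩, ?_, ?_⟩, ?_, ?_⟩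
  · intro c hc; simp only [dif_neg hc]
  · refine ⟨?_, ?_, ?_⟩
    · intro c hc
      have hc' : c ∈ L.cells := hc
      simp only [dif_pos hc', Set.mem_Iio]
      exact (T.1 ⟨c, hc'⟩).2
    · intro a ha b hb e
      have ha' : a ∈ L.cells := ha
      have hb' : b ∈ L.cells := hb
      simp only [dif_pos ha', dif_pos hb'] at e
      have := T.2.1.1 (Fin.ext e)
      exact congrArg Subtype.val this
    · intro i hi
      obtain ⟨c, hc⟩ := T.2.1.2 ⟨i, hi⟩
      refine ⟨c.1, c.2, ?_⟩
      have : (c : ℕ × ℕ) ∈ L.cells := c.2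
      simp only [dif_pos this]
      change (T.1 c : ℕ) = i
      rw [hc]
  · intro a ha b hb h1 h2 h3
    simp only [dif_pos ha, dif_pos hb]
    exact T.2.2 ⟨a, ha⟩ ⟨b, hb⟩ h1 h2 (fun e => h3 (congrArg Subtype.val e))
  · constructor
    · intro a b e
      have e' : f.1 a = f.1 b := congrArg Fin.val e
      exact Subtype.ext (f.2.2.1.injOn a.2 b.2 e')
    · intro i
      obtain ⟨c, hc, e⟩ := f.2.2.1.surjOn (show (i : ℕ) ∈ Set.Iio L.card from i.2)
      exact ⟨⟨c, hc⟩, Fin.ext e⟩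
  · intro a b h1 h2 h3
    exact f.2.2.2 a a.2 b b.2 h1 h2 (fun e => h3 (Subtype.ext e))
  · intro T
    apply Subtype.ext
    funext c
    apply Fin.ext
    have : (c : ℕ × ℕ) ∈ L.cells := c.2
    simp only [dif_pos this]
  · intro f
    apply Subtype.ext
    funext c
    by_cases h : c ∈ L.cells
    · simp only [dif_pos h]
    · simp only [dif_neg h]
      exact (f.2.1 c h).symm

noncomputable def extF (v L : YoungDiagram) (f : ℕ × ℕ → ℕ) (c : ℕ × ℕ) : ℕ :=
  if c ∈ v.cells then f c else if c ∈ L.cells then v.card else 0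

theorem extF_syt {v L : YoungDiagram} (h : Cov v L) {f : ℕ × ℕ → ℕ} (hf : IsSYT v f) :
    IsSYT L (extF v L f) := by
  obtain ⟨c, hc, hL⟩ := cov_cell h
  have hcard : L.card = v.card + 1 := h.2
  have ev : ∀ x ∈ v.cells, extF v L f x = f x := fun x hx => by simp only [extF, if_pos hx]
  have ec : extF v L f c = v.card := by simp only [extF, if_neg hc, hL, mem_insert_self, if_true]
  refine ⟨?_, ?_, ?_⟩
  · intro x hx
    have : x ∉ v.cells := fun h' => hx (by rw [hL]; exact mem_insert_of_mem h')
    simp only [extF, if_neg hx, if_neg this]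
  · refine ⟨?_, ?_, ?_⟩
    · intro x hx
      rw [hL, mem_coe, mem_insert] at hx
      rw [hcard, Set.mem_Iio]
      rcases hx with rfl | hx
      · rw [ec]; omega
      · rw [ev x hx]
        have := hf.2.1.mapsTo hx
        rw [Set.mem_Iio] at this; omega
    · intro x hx y hy e
      rw [hL, mem_coe, mem_insert] at hx hy
      rcases hx with rfl | hx <;> rcases hy with rfl | hy
      · rfl
      · rw [ec, ev y hy] at e
        have := hf.2.1.mapsTo hy
        rw [Set.mem_Iio] at this; omega
      · rw [ec, ev x hx] at e
        have := hf.2.1.mapsTo hx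
        rw [Set.mem_Iio] at this; omega
      · rw [ev x hx, ev y hy] at e
        exact hf.2.1.injOn hx hy e
    · intro i hi
      rw [hcard, Set.mem_Iio] at hi
      rcases Nat.lt_or_ge i v.card with h1 | h1
      · obtain ⟨x, hx, e⟩ := hf.2.1.surjOn (show i ∈ Set.Iio v.card from h1)
        refine ⟨x, ?_, by rw [ev x hx, e]⟩
        rw [hL]; exact mem_insert_of_mem hx
      · refine ⟨c, ?_, by rw [ec]; omega⟩
        rw [hL]; exact mem_insert_self _ _
  · intro a ha b hb h1 h2 h3
    rw [hL, mem_insert] at ha hb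
    rcases ha with rfl | ha <;> rcases hb with rfl | hb
    · exact absurd rfl h3
    · exfalso
      exact hc (v.up_left_mem h1 h2 hb)
    · rw [ec, ev a ha]
      exact hf.2.1.mapsTo ha
    · rw [ev a ha, ev b hb]
      exact hf.2.2 a ha b hb h1 h2 h3

theorem extF_lt {v L : YoungDiagram} (h : Cov v L) {f : ℕ × ℕ → ℕ} (hf : IsSYT v f)
    (x : ℕ × ℕ) : x ∈ v.cells ↔ x ∈ L.cells ∧ extF v L f x < v.card := by
  constructor
  · intro hx
    refine ⟨YoungDiagram.cells_subset_iff.2 h.1 hx, ?_⟩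
    simp only [extF, if_pos hx]
    exact hf.2.1.mapsTo hx
  · rintro ⟨h1, h2⟩
    by_contra h3
    simp only [extF, if_neg h3, if_pos h1] at h2
    omega

theorem syt_rec (L : YoungDiagram) (hL : L ≠ ⊥) : sytCount L = ∑ v ∈ dn L, sytCount v := by
  have hpos : 0 < L.card := by
    rcases Nat.eq_zero_or_pos L.card with h | h
    · exfalso; apply hL; apply yd_ext
      rw [YoungDiagram.cells_bot]; exact card_eq_zero.1 h
    · exact h
  rw [← sum_coe_sort, sytCount_eq]
  simp_rw [sytCount_eq]
  have hfin : ∀ v : YoungDiagram, Finite {f // IsSYT v f} := by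
    intro v
    have : Finite {T : v.cells → Fin v.card //
      Function.Bijective T ∧
      ∀ a b : v.cells, (a : ℕ × ℕ).1 ≤ (b : ℕ × ℕ).1 → (a : ℕ × ℕ).2 ≤ (b : ℕ × ℕ).2 →
        a ≠ b → T a < T b} := inferInstance
    refine Finite.of_injective (β := v.cells → Fin v.card) (fun f c => ⟨f.1 c, f.2.2.1.mapsTo c.2⟩) ?_
    intro f g e
    apply Subtype.ext
    funext c
    by_cases h : c ∈ v.cells
    · exact congrArg Fin.val (congrFun e ⟨c, h⟩)
    · rw [f.2.1 c h, g.2.1 c h]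
  rw [← Nat.card_sigma]
  symm
  refine Nat.card_eq_of_bijective
    (fun x : (Σ v : {x // x ∈ dn L}, {f // IsSYT v.1 f}) =>
      (⟨extF x.1.1 L x.2.1, extF_syt (mem_dn.1 x.1.2) x.2.2⟩ : {f // IsSYT L f})) ⟨?_, ?_⟩
  · rintro ⟨⟨v, hv⟩, f, hf⟩ ⟨⟨w, hw⟩, g, hg⟩ e
    simp only [Subtype.mk.injEq] at e
    have hv' := mem_dn.1 hv
    have hw' := mem_dn.1 hw
    have hcard : v.card = w.card := by have := hv'.2; have := hw'.2; omega
    have hvw : v = w := by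
      apply yd_ext
      ext x
      rw [extF_lt hv' hf, extF_lt hw' hg, e, hcard]
    subst hvw
    have : f = g := by
      funext x
      by_cases hx : x ∈ v.cells
      · have := congrFun e x
        simpa only [extF, if_pos hx] using this
      · rw [hf.1 x hx, hg.1 x hx]
    subst this
    rfl
  · rintro ⟨F, hF⟩
    obtain ⟨c, hc, hcF⟩ := hF.2.1.surjOn (show L.card - 1 ∈ Set.Iio L.card by
      rw [Set.mem_Iio]; omega)
    have hc' : c ∈ L.cells := hc
    have hlow : IsLowerSet ((L.cells.erase c : Finset (ℕ × ℕ)) : Set (ℕ × ℕ)) := by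
      rintro a b hab ha
      rw [mem_coe, mem_erase] at ha ⊢
      have hb : b ∈ L.cells := L.isLowerSet hab ha.2
      refine ⟨?_, hb⟩
      rintro rfl
      have h1 := hF.2.2 b hb a ha.2 hab.1 hab.2 (Ne.symm ha.1)
      have h2 := hF.2.1.mapsTo ha.2
      rw [Set.mem_Iio] at h2
      omega
    set v : YoungDiagram := ⟨L.cells.erase c, hlow⟩ with hvdef
    have hcv : c ∉ v.cells := by simp [v]
    have hLv : L.cells = insert c v.cells := by simp only [v]; rw [insert_erase hc']
    have hcov : Cov v L := cov_of_cell hcv hLv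
    have hcard := hcov.2
    have hsub : ∀ x ∈ v.cells, x ∈ L.cells := fun x hx => by
      rw [hLv]; exact mem_insert_of_mem hx
    have hf : IsSYT v (fun x => if x ∈ v.cells then F x else 0) := by
      refine ⟨fun x hx => if_neg hx, ⟨?_, ?_, ?_⟩, ?_⟩
      · intro x hx
        have hx' : x ∈ v.cells := hx
        simp only [if_pos hx', Set.mem_Iio]
        have h1 := hF.2.1.mapsTo (hsub x hx)
        rw [Set.mem_Iio] at h1
        have h2 : F x ≠ F c := fun e => by
          have := hF.2.1.injOn (hsub x hx) hc e
          rw [this] at hx'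
          exact hcv hx'
        omega
      · intro x hx y hy e
        have hx' : x ∈ v.cells := hx
        have hy' : y ∈ v.cells := hy
        simp only [if_pos hx', if_pos hy'] at e
        exact hF.2.1.injOn (hsub x hx) (hsub y hy) e
      · intro i hi
        rw [Set.mem_Iio] at hi
        obtain ⟨x, hx, e⟩ := hF.2.1.surjOn (show i ∈ Set.Iio L.card by rw [Set.mem_Iio]; omega)
        have hx' : x ∈ v.cells := by
          rw [mem_coe, hLv, mem_insert] at hx
          rcases hx with rfl | hx
          · omega
          · exact hx
        exact ⟨x, hx', by simp only [if_pos hx', e]⟩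
      · intro a ha b hb h1 h2 h3
        simp only [if_pos ha, if_pos hb]
        exact hF.2.2 a (hsub a ha) b (hsub b hb) h1 h2 h3
    refine ⟨⟨⟨v, mem_dn.2 hcov⟩, ⟨_, hf⟩⟩, ?_⟩
    apply Subtype.ext
    funext x
    change extF v L (fun x => if x ∈ v.cells then F x else 0) x = F x
    unfold extF
    by_cases hx : x ∈ v.cells
    · simp only [if_pos hx]
    · by_cases hx' : x ∈ L.cells
      · simp only [if_neg hx, if_pos hx']
        rw [hLv, mem_insert] at hx'
        rcases hx' with rfl | h
        · omega
        · exact absurd h hx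
      · simp only [if_neg hx, if_neg hx']
        exact (hF.1 x hx').symm

theorem syt_bot : sytCount ⊥ = 1 := by
  rw [sytCount_eq, Nat.card_eq_one_iff_unique]
  constructor
  · constructor
    rintro ⟨f, hf⟩ ⟨g, hg⟩
    apply Subtype.ext
    funext c
    change f c = g c
    rw [hf.1 c (by simp), hg.1 c (by simp)]
  · refine ⟨⟨fun _ => 0, fun _ _ => rfl, ?_, ?_⟩⟩
    · have : (⊥ : YoungDiagram).card = 0 := rfl
      rw [this]
      simp
    · intro a ha; simp at ha

/-- Real valued dimension. -/
noncomputable def d (l : YoungDiagram) : ℝ := sytCount l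

theorem card_eq_zero_iff {l : YoungDiagram} : l.card = 0 ↔ l = ⊥ := by
  constructor
  · intro h; apply yd_ext; rw [YoungDiagram.cells_bot]; exact card_eq_zero.1 h
  · rintro rfl; rfl

theorem d_bot : d ⊥ = 1 := by simp [d, syt_bot]

theorem d_rec {L : YoungDiagram} (hL : L ≠ ⊥) : d L = ∑ v ∈ dn L, d v := by
  simp only [d, syt_rec L hL, Nat.cast_sum]

theorem dn_nonempty {L : YoungDiagram} (hL : L ≠ ⊥) : (dn L).Nonempty := by
  have hpos : 0 < L.card := Nat.pos_of_ne_zero (fun h => hL (card_eq_zero_iff.1 h))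
  have h0 : 0 < L.colLen 0 := by
    rw [← YoungDiagram.mem_iff_lt_colLen]
    obtain ⟨c, hc⟩ := card_pos.1 hpos
    exact L.up_left_mem (Nat.zero_le _) (Nat.zero_le _) (show (c.1, c.2) ∈ L from hc)
  set r := L.colLen 0 - 1
  have h1 : 0 < L.rowLen r := (cell_colLen L r).2 (by omega)
  have h2 : ¬ 0 < L.rowLen (r + 1) := fun h => by
    have := (cell_colLen L (r + 1)).1 h; omega
  have h3 : L.rowLen (r + 1) < L.rowLen r := by omega
  exact ⟨remBox L r h3, mem_dn.2 (cov_of_cell (rem_cells L r h3).1 (rem_cells L r h3).2)⟩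

theorem d_pos (l : YoungDiagram) : 0 < d l := by
  induction hn : l.card generalizing l with
  | zero => rw [card_eq_zero_iff.1 hn, d_bot]; exact one_pos
  | succ n ih =>
    have hl : l ≠ ⊥ := fun h => by rw [card_eq_zero_iff.2 h] at hn; omega
    rw [d_rec hl]
    apply sum_pos _ (dn_nonempty hl)
    intro v hv
    have := (mem_dn.1 hv).2
    exact ih v (by omega)

end PG

namespace PG
open Finset

theorem sum_swap (n : ℕ) (G : YoungDiagram → YoungDiagram → ℝ) :
    ∑ l ∈ Y n, ∑ L ∈ up l, G l L = ∑ L ∈ Y (n + 1), ∑ l ∈ dn L, G l L := by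
  apply sum_comm'
  intro l L
  simp only [mem_Y, mem_up, mem_dn]
  constructor
  · rintro ⟨h1, h2⟩; exact ⟨h2, by rw [h2.2, h1]⟩
  · rintro ⟨h1, h2⟩; refine ⟨?_, h1⟩; have := h1.2; omega

theorem ne_bot_of_cov {l L : YoungDiagram} (h : Cov l L) : L ≠ ⊥ := by
  rintro rfl
  have := h.2
  rw [card_eq_zero_iff.2 rfl] at this
  omega

/-- Moments of the transition measure. -/
noncomputable def M (j : ℕ) (l : YoungDiagram) : ℝ :=
  (∑ L ∈ up l, cc l L ^ j * d L) / (((l.card : ℝ) + 1) * d l)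

theorem M_mul (j : ℕ) (l : YoungDiagram) :
    ((l.card : ℝ) + 1) * d l * M j l = ∑ L ∈ up l, cc l L ^ j * d L := by
  have := d_pos l
  have h2 : ((l.card : ℝ) + 1) * d l ≠ 0 := by positivity
  unfold M
  field_simp

theorem M_rec (j : ℕ) (l : YoungDiagram) :
    ((l.card : ℝ) + 1) * d l * M j l =
      ∑ v ∈ dn l, (l.card : ℝ) * (d v * M j v) + PP j l * d l := by
  rw [M_mul]
  have h := comm l d j
  have e1 : ∑ L ∈ up l, cc l L ^ j * ∑ v ∈ dn L, d v = ∑ L ∈ up l, cc l L ^ j * d L := by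
    apply sum_congr rfl
    intro L hL
    rw [← d_rec (ne_bot_of_cov (mem_up.1 hL))]
  rw [e1] at h
  rw [h]
  congr 1
  apply sum_congr rfl
  intro v hv
  rw [← M_mul]
  have := (mem_dn.1 hv).2
  rw [this]; push_cast; ring

theorem PP_zero (l : YoungDiagram) : PP 0 l = 1 := by
  unfold PP
  norm_num

theorem dn_bot : dn ⊥ = ∅ := by
  apply eq_empty_of_forall_notMem
  intro v hv
  exact ne_bot_of_cov (mem_dn.1 hv) rfl

theorem sum_dn_d (l : YoungDiagram) (x : ℝ) :
    ∑ v ∈ dn l, (l.card : ℝ) * (d v * x) = l.card * d l * x := by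
  by_cases h : l = ⊥
  · subst h; rw [dn_bot, card_eq_zero_iff.2 rfl]; simp
  · rw [d_rec h, ← mul_sum, ← sum_mul]; ring

theorem M_zero (l : YoungDiagram) : M 0 l = 1 := by
  induction hn : l.card generalizing l with
  | zero =>
    have := M_rec 0 l
    rw [card_eq_zero_iff.1 hn, dn_bot, PP_zero, d_bot, card_eq_zero_iff.2 rfl] at this
    rw [card_eq_zero_iff.1 hn]
    simpa using this
  | succ n ih =>
    have h := M_rec 0 l
    have e : ∑ v ∈ dn l, (l.card : ℝ) * (d v * M 0 v) = ∑ v ∈ dn l, (l.card : ℝ) * (d v * 1) := by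
      apply sum_congr rfl
      intro v hv
      rw [ih v (by have := (mem_dn.1 hv).2; omega)]
    rw [e, sum_dn_d, PP_zero] at h
    have := d_pos l
    have h2 : ((l.card : ℝ) + 1) * d l ≠ 0 := by positivity
    apply mul_left_cancel₀ h2
    rw [h]; ring

theorem sum_up_d (l : YoungDiagram) : ∑ L ∈ up l, d L = ((l.card : ℝ) + 1) * d l := by
  have := M_mul 0 l
  rw [M_zero] at this
  simpa using this.symm

/-- Plancherel expectation. -/
noncomputable def E (n : ℕ) (f : YoungDiagram → ℝ) : ℝ :=
  ∑ l ∈ Y n, d l ^ 2 / (n.factorial : ℝ) * f l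

/-- Joint expectation for consecutive diagrams. -/
noncomputable def EE (n : ℕ) (G : YoungDiagram → YoungDiagram → ℝ) : ℝ :=
  ∑ l ∈ Y n, ∑ L ∈ up l, d l * d L / ((n + 1).factorial : ℝ) * G l L

theorem EE_cc (n j : ℕ) (f : YoungDiagram → ℝ) :
    EE n (fun l L => cc l L ^ j * f l) = E n (fun l => M j l * f l) := by
  unfold EE E
  apply sum_congr rfl
  intro l hl
  have h := M_mul j l
  rw [mem_Y.1 hl] at h
  have e : ∑ L ∈ up l, d l * d L / ((n + 1).factorial : ℝ) * (cc l L ^ j * f l) =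
      d l / ((n + 1).factorial : ℝ) * f l * ∑ L ∈ up l, cc l L ^ j * d L := by
    rw [mul_sum]; apply sum_congr rfl; intros; ring
  rw [e, ← h, Nat.factorial_succ]
  have : (n.factorial : ℝ) ≠ 0 := by positivity
  push_cast
  field_simp

theorem EE_fst (n : ℕ) (f : YoungDiagram → ℝ) : EE n (fun l _ => f l) = E n f := by
  have := EE_cc n 0 f
  simp only [pow_zero, one_mul, M_zero] at this
  exact this

theorem EE_swap (n : ℕ) (G : YoungDiagram → YoungDiagram → ℝ) :
    EE n G = ∑ L ∈ Y (n + 1), ∑ l ∈ dn L, d l * d L / ((n + 1).factorial : ℝ) * G l L := by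
  unfold EE
  rw [sum_swap]

theorem ne_bot_of_mem {n : ℕ} {L : YoungDiagram} (h : L ∈ Y (n + 1)) : L ≠ ⊥ := by
  rintro rfl
  rw [mem_Y, card_eq_zero_iff.2 rfl] at h; omega

theorem EE_snd (n : ℕ) (f : YoungDiagram → ℝ) : EE n (fun _ L => f L) = E (n + 1) f := by
  rw [EE_swap]
  unfold E
  apply sum_congr rfl
  intro L hL
  rw [sq]
  nth_rewrite 3 [d_rec (ne_bot_of_mem hL)]
  rw [mul_sum, sum_div, sum_mul]
  apply sum_congr rfl
  intros; ring

theorem Y_zero : Y 0 = {⊥} := by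
  ext l; rw [mem_Y, card_eq_zero_iff, mem_singleton]

theorem E_zero (f : YoungDiagram → ℝ) : E 0 f = f ⊥ := by
  simp [E, Y_zero, d_bot]

theorem E_one (n : ℕ) : E n (fun _ => 1) = 1 := by
  induction n with
  | zero => rw [E_zero]
  | succ n ih => rw [← EE_snd, EE_fst, ih]

theorem E_add (n : ℕ) (f g : YoungDiagram → ℝ) : E n (fun l => f l + g l) = E n f + E n g := by
  simp only [E, mul_add, sum_add_distrib]
theorem E_sub (n : ℕ) (f g : YoungDiagram → ℝ) : E n (fun l => f l - g l) = E n f - E n g := by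
  simp only [E, mul_sub, sum_sub_distrib]
theorem E_smul (n : ℕ) (a : ℝ) (f : YoungDiagram → ℝ) : E n (fun l => a * f l) = a * E n f := by
  simp only [E, mul_sum]; apply sum_congr rfl; intros; ring
theorem E_const (n : ℕ) (a : ℝ) : E n (fun _ => a) = a := by
  have := E_smul n a (fun _ => 1)
  rw [E_one] at this; simpa using this
theorem E_sum {ι : Type*} (s : Finset ι) (n : ℕ) (f : ι → YoungDiagram → ℝ) :
    E n (fun l => ∑ i ∈ s, f i l) = ∑ i ∈ s, E n (f i) := by
  simp only [E, mul_sum]; rw [sum_comm]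
theorem E_mono (n : ℕ) {f g : YoungDiagram → ℝ} (h : ∀ l ∈ Y n, f l ≤ g l) : E n f ≤ E n g := by
  apply sum_le_sum
  intro l hl
  exact mul_le_mul_of_nonneg_left (h l hl) (by positivity)
theorem E_congr (n : ℕ) {f g : YoungDiagram → ℝ} (h : ∀ l ∈ Y n, f l = g l) : E n f = E n g := by
  apply sum_congr rfl
  intro l hl
  rw [h l hl]
theorem E_nonneg (n : ℕ) {f : YoungDiagram → ℝ} (h : ∀ l ∈ Y n, 0 ≤ f l) : 0 ≤ E n f :=
  sum_nonneg fun l hl => mul_nonneg (by positivity) (h l hl)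

theorem EE_add (n : ℕ) (f g : YoungDiagram → YoungDiagram → ℝ) :
    EE n (fun l L => f l L + g l L) = EE n f + EE n g := by
  simp only [EE, mul_add, sum_add_distrib]
theorem EE_sub (n : ℕ) (f g : YoungDiagram → YoungDiagram → ℝ) :
    EE n (fun l L => f l L - g l L) = EE n f - EE n g := by
  simp only [EE, mul_sub, sum_sub_distrib]
theorem EE_smul (n : ℕ) (a : ℝ) (f : YoungDiagram → YoungDiagram → ℝ) :
    EE n (fun l L => a * f l L) = a * EE n f := by
  simp only [EE, mul_sum]
  apply sum_congr rfl; intros; apply sum_congr rfl; intros; ring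
theorem EE_mono (n : ℕ) {f g : YoungDiagram → YoungDiagram → ℝ}
    (h : ∀ l ∈ Y n, ∀ L, Cov l L → f l L ≤ g l L) : EE n f ≤ EE n g := by
  apply sum_le_sum
  intro l hl
  apply sum_le_sum
  intro L hL
  have := d_pos l
  have := d_pos L
  exact mul_le_mul_of_nonneg_left (h l hl L (mem_up.1 hL)) (by positivity)
theorem EE_congr (n : ℕ) {f g : YoungDiagram → YoungDiagram → ℝ}
    (h : ∀ l ∈ Y n, ∀ L, Cov l L → f l L = g l L) : EE n f = EE n g :=
  le_antisymm (EE_mono n fun l hl L hL => (h l hl L hL).le)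
    (EE_mono n fun l hl L hL => (h l hl L hL).ge)

theorem mp_rec (j n : ℕ) : E (n + 1) (ps j) = E n (ps j) + E n (M j) := by
  rw [← EE_snd]
  rw [EE_congr n (g := fun l L => ps j l + cc l L ^ j * 1)
    (fun l _ L hL => by rw [ps_cov hL, mul_one])]
  rw [EE_add, EE_fst, EE_cc n j (fun _ => 1)]
  simp

theorem mp_zero (j : ℕ) : E 0 (ps j) = 0 := by
  rw [E_zero]; simp [ps]

theorem mp_sum (j n : ℕ) : E n (ps j) = ∑ t ∈ range n, E t (M j) := by
  induction n with
  | zero => rw [mp_zero]; simp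
  | succ n ih => rw [mp_rec, ih, sum_range_succ]

/-- Backward averaging. -/
theorem E_back (n : ℕ) (f : YoungDiagram → ℝ) :
    E (n + 1) (fun l => ∑ v ∈ dn l, d v / d l * f v) = E n f := by
  rw [← EE_fst n, EE_swap]
  unfold E
  apply sum_congr rfl
  intro l hl
  rw [mul_sum]
  apply sum_congr rfl
  intro v hv
  have := d_pos l
  field_simp

theorem M_rec' (j n : ℕ) {l : YoungDiagram} (hl : l ∈ Y (n + 1)) :
    ((n : ℝ) + 2) * M j l = PP j l + (n + 1) * ∑ v ∈ dn l, d v / d l * M j v := by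
  have h := M_rec j l
  rw [mem_Y.1 hl] at h
  have h0 := d_pos l
  have e : ∑ v ∈ dn l, d v / d l * M j v = (∑ v ∈ dn l, d v * M j v) / d l := by
    rw [sum_div]; apply sum_congr rfl; intros; ring
  rw [e]
  rw [← mul_sum] at h
  push_cast at h
  field_simp
  linarith

theorem M_bot (j : ℕ) : M j ⊥ = PP j ⊥ := by
  have := M_rec j ⊥
  rw [dn_bot, d_bot, card_eq_zero_iff.2 rfl] at this
  simpa using this

theorem m_rec (j n : ℕ) :
    ((n : ℝ) + 2) * E (n + 1) (M j) = E (n + 1) (PP j) + (n + 1) * E n (M j) := by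
  rw [← E_smul, E_congr (n + 1) (fun l hl => M_rec' j n hl), E_add, E_smul, E_back]

theorem m_sum (j n : ℕ) : ((n : ℝ) + 1) * E n (M j) = ∑ i ∈ range (n + 1), E i (PP j) := by
  induction n with
  | zero => simp [E_zero, M_bot]
  | succ n ih =>
    rw [sum_range_succ, ← ih]
    have := m_rec j n
    push_cast
    linarith

noncomputable def bb (j i : ℕ) : ℝ := (j.choose i : ℝ) * (1 + (-1) ^ (j - i))

theorem PP_succ (j : ℕ) (l : YoungDiagram) :
    PP (j + 2) l = ∑ i ∈ range (j + 1), bb (j + 2) i * ps i l := by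
  have key : ∀ x : ℝ, (x + 1) ^ (j + 2) + (x - 1) ^ (j + 2) - 2 * x ^ (j + 2) =
      ∑ i ∈ range (j + 1), bb (j + 2) i * x ^ i := by
    intro x
    rw [sub_eq_add_neg x 1, add_pow, add_pow, ← sum_add_distrib]
    rw [sum_range_succ, sum_range_succ]
    have e : j + 2 - (j + 1) = 1 := by omega
    simp only [Nat.sub_self, e, Nat.choose_self, one_pow, pow_zero]
    have : ∀ i, x ^ i * 1 * ((j + 2).choose i : ℝ) + x ^ i * (-1) ^ (j + 2 - i) * ((j + 2).choose i : ℝ)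
        = bb (j + 2) i * x ^ i := by
      intro i; unfold bb; ring
    simp only [this]
    push_cast
    ring
  unfold PP
  simp only [key]
  rw [zero_pow (by omega), zero_add, sum_comm]
  apply sum_congr rfl
  intro i _
  rw [ps, mul_sum]

theorem PP_one (l : YoungDiagram) : PP 1 l = 0 := by
  unfold PP
  simp only [pow_one, zero_add]
  apply sum_eq_zero
  intros; ring

/-- Variance. -/
noncomputable def V (n : ℕ) (f : YoungDiagram → ℝ) : ℝ := E n (fun l => (f l - E n f) ^ 2)

theorem V_nonneg (n : ℕ) (f : YoungDiagram → ℝ) : 0 ≤ V n f := E_nonneg n fun _ _ => sq_nonneg _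

theorem jensen_sq (s : Finset YoungDiagram) (w x : YoungDiagram → ℝ) (hw : ∀ v ∈ s, 0 ≤ w v)
    (h1 : ∑ v ∈ s, w v = 1) : (∑ v ∈ s, w v * x v) ^ 2 ≤ ∑ v ∈ s, w v * x v ^ 2 := by
  obtain ⟨S, hS⟩ : ∃ S, S = ∑ v ∈ s, w v * x v := ⟨_, rfl⟩
  rw [← hS]
  have h0 : 0 ≤ ∑ v ∈ s, w v * (x v - S) ^ 2 :=
    sum_nonneg fun v hv => mul_nonneg (hw v hv) (sq_nonneg _)
  have e : ∑ v ∈ s, w v * (x v - S) ^ 2 =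
      ∑ v ∈ s, w v * x v ^ 2 - 2 * S * ∑ v ∈ s, w v * x v + S ^ 2 * ∑ v ∈ s, w v := by
    rw [mul_sum, mul_sum, ← sum_sub_distrib, ← sum_add_distrib]
    apply sum_congr rfl
    intros; ring
  rw [e, h1, ← hS] at h0
  nlinarith

theorem V_M_rec (j n : ℕ) :
    ((n : ℝ) + 2) * V (n + 1) (M j) ≤ V (n + 1) (PP j) + (n + 1) * V n (M j) := by
  unfold V
  set a := E (n + 1) (M j)
  set b := E (n + 1) (PP j)
  set c := E n (M j)
  have hm : ((n : ℝ) + 2) * a = b + (n + 1) * c := m_rec j n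
  rw [← E_smul, ← E_back n, ← E_smul, ← E_add]
  apply E_mono
  intro l hl
  have h1 := M_rec' j n hl
  have hd := d_pos l
  have hw : ∑ v ∈ dn l, d v / d l = 1 := by
    rw [← sum_div, ← d_rec (ne_bot_of_mem hl), div_self hd.ne']
  set S := ∑ v ∈ dn l, d v / d l * M j v
  have hS : (S - c) ^ 2 ≤ ∑ v ∈ dn l, d v / d l * (M j v - c) ^ 2 := by
    have e : S - c = ∑ v ∈ dn l, d v / d l * (M j v - c) := by
      simp only [mul_sub, sum_sub_distrib, ← sum_mul, hw, one_mul, S]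
    rw [e]
    exact jensen_sq _ _ _ (fun v _ => by have := d_pos v; positivity) hw
  have hn : (0 : ℝ) < n + 2 := by positivity
  have e2 : ((n : ℝ) + 2) * (M j l - a) = (PP j l - b) + (n + 1) * (S - c) := by linarith
  have e3 : ((n : ℝ) + 2) * (M j l - a) ^ 2 ≤ (PP j l - b) ^ 2 + (n + 1) * (S - c) ^ 2 := by
    set x := PP j l - b
    set y := S - c
    have : M j l - a = (x + (n + 1) * y) / (n + 2) := by field_simp; linarith
    rw [this, div_pow, mul_div_assoc', div_le_iff₀ (by positivity)]
    nlinarith [mul_nonneg (mul_nonneg hn.le (by positivity : (0:ℝ) ≤ n + 1)) (sq_nonneg (x - y))]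
  have hn1 : (0 : ℝ) ≤ n + 1 := by positivity
  nlinarith [mul_le_mul_of_nonneg_left hS hn1]

theorem V_M_sum (j n : ℕ) :
    ((n : ℝ) + 1) * V n (M j) ≤ ∑ i ∈ range (n + 1), V i (PP j) := by
  induction n with
  | zero => simp [V, E_zero]
  | succ n ih =>
    rw [sum_range_succ]
    have := V_M_rec j n
    push_cast
    linarith

theorem V_p_rec (j n : ℕ) :
    V (n + 1) (ps j) ≤ V n (ps j) * ((n + 2) / (n + 1)) + ((n + 1) * V n (M j) + E n (M (2 * j))) := by
  have hm := mp_rec j n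
  unfold V
  rw [hm, ← EE_snd]
  set a := E n (ps j)
  set b := E n (M j) with hb
  rw [EE_congr n (g := fun l L => ((ps j l - a) ^ 2 - 2 * b * (ps j l - a) + b ^ 2) +
    cc l L ^ j * (2 * (ps j l - a) - 2 * b) + cc l L ^ (2 * j) * 1)
    (fun l _ L hL => by rw [ps_cov hL, pow_mul']; ring)]
  rw [EE_add, EE_add, EE_fst, EE_cc, EE_cc n (2 * j) (fun _ => 1), ← E_add]
  have e1 : E n (fun l => (ps j l - a) ^ 2 - 2 * b * (ps j l - a) + b ^ 2 +
      M j l * (2 * (ps j l - a) - 2 * b)) ≤ E n (fun l => (ps j l - a) ^ 2 * ((n + 2) / (n + 1)) +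
      (n + 1) * (M j l - b) ^ 2 + (b ^ 2 - 2 * b * M j l)) := by
    apply E_mono
    intro l _
    have hn : (0 : ℝ) < n + 1 := by positivity
    have : (ps j l - a) ^ 2 * (((n : ℝ) + 2) / (n + 1)) = (ps j l - a) ^ 2 + (n + 1) *
        ((ps j l - a) / (n + 1)) ^ 2 := by field_simp; ring
    rw [this]
    set x := ps j l - a
    have hx : x = (n + 1) * (x / (n + 1)) := by field_simp
    set y := x / (n + 1)
    rw [hx]
    nlinarith [mul_nonneg hn.le (sq_nonneg (y - (M j l - b)))]
  have e2 : E n (fun l => (ps j l - a) ^ 2 * ((n + 2) / (n + 1)) +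
      (n + 1) * (M j l - b) ^ 2 + (b ^ 2 - 2 * b * M j l)) =
      E n (fun l => (ps j l - a) ^ 2) * ((n + 2) / (n + 1)) +
      (n + 1) * E n (fun l => (M j l - b) ^ 2) - b ^ 2 := by
    rw [E_add, E_add, E_smul, E_sub, E_const, E_smul, ← hb]
    have : E n (fun l => (ps j l - a) ^ 2 * (((n : ℝ) + 2) / (n + 1))) =
        E n (fun l => (((n : ℝ) + 2) / (n + 1)) * (ps j l - a) ^ 2) := by
      apply E_congr; intros; ring
    rw [this, E_smul]; ring
  simp only [mul_one]
  nlinarith [sq_nonneg b]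

theorem V_PP (j n : ℕ) :
    V n (PP (j + 2)) ≤ (j + 1) * ∑ i ∈ range (j + 1), bb (j + 2) i ^ 2 * V n (ps i) := by
  unfold V
  simp_rw [← E_smul]
  rw [← E_sum, ← E_smul]
  apply E_mono
  intro l _
  have e : E n (PP (j + 2)) = ∑ i ∈ range (j + 1), bb (j + 2) i * E n (ps i) := by
    rw [E_congr n (fun l _ => PP_succ j l), E_sum]
    simp_rw [E_smul]
  rw [PP_succ, e, ← sum_sub_distrib]
  have := sq_sum_le_card_mul_sum_sq (s := range (j + 1))
    (f := fun i => bb (j + 2) i * ps i l - bb (j + 2) i * E n (ps i))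
  rw [card_range] at this
  push_cast at this
  refine this.trans (le_of_eq ?_)
  congr 1
  apply sum_congr rfl
  intros; ring

end PG

namespace PG
open Finset Filter Topology

theorem tendsto_inv_succ : Tendsto (fun n : ℕ => 1 / ((n : ℝ) + 1)) atTop (𝓝 0) :=
  tendsto_one_div_add_atTop_nhds_zero_nat

theorem pow_diff (q : ℕ) : Tendsto (fun n : ℕ => (((n : ℝ) + 2) ^ (q + 1) - ((n : ℝ) + 1) ^ (q + 1))
    / ((n : ℝ) + 1) ^ q) atTop (𝓝 (q + 1)) := by
  have h1 : Tendsto (fun n : ℕ => ∑ i ∈ range (q + 1), (1 + 1 / ((n : ℝ) + 1)) ^ i) atTop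
      (𝓝 (∑ i ∈ range (q + 1), (1 + 0 : ℝ) ^ i)) := by
    apply tendsto_finsetSum
    intro i _
    exact (tendsto_const_nhds.add tendsto_inv_succ).pow i
  simp only [add_zero, one_pow, sum_const, card_range, nsmul_eq_mul, mul_one] at h1
  push_cast at h1
  refine h1.congr ?_
  intro n
  have hn : (n : ℝ) + 1 ≠ 0 := by positivity
  set x := 1 / ((n : ℝ) + 1) with hx
  have hx0 : x ≠ 0 := by positivity
  have h2 : (n : ℝ) + 2 = (n + 1) * (1 + x) := by rw [hx]; field_simp; ring
  rw [h2, mul_pow, geom_sum_eq (by intro h; apply hx0; linarith)]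
  have : (n : ℝ) + 1 = 1 / x := by rw [hx]; field_simp
  rw [this]
  field_simp
  ring

theorem cesaro {b : ℕ → ℝ} {q : ℕ} {c : ℝ}
    (h : Tendsto (fun n : ℕ => b n / ((n : ℝ) + 1) ^ q) atTop (𝓝 c)) :
    Tendsto (fun n : ℕ => (∑ i ∈ range n, b i) / ((n : ℝ) + 1) ^ (q + 1)) atTop
      (𝓝 (c / (q + 1))) := by
  set c' := c / ((q : ℝ) + 1) with hc'
  have hq : (q : ℝ) + 1 ≠ 0 := by positivity
  have h1 : Tendsto (fun n : ℕ => (b n - c' * (((n : ℝ) + 2) ^ (q + 1) - ((n : ℝ) + 1) ^ (q + 1)))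
      / ((n : ℝ) + 1) ^ q) atTop (𝓝 0) := by
    have := h.sub ((pow_diff q).const_mul c')
    have e : c - c' * (q + 1) = 0 := by rw [hc']; field_simp; ring
    rw [e] at this
    refine this.congr ?_
    intro n; ring
  have h2 : (fun n : ℕ => b n - c' * (((n : ℝ) + 2) ^ (q + 1) - ((n : ℝ) + 1) ^ (q + 1)))
      =o[atTop] (fun n : ℕ => ((n : ℝ) + 1) ^ q) := by
    rw [Asymptotics.isLittleO_iff_tendsto]
    · exact h1
    · intro n hn
      exact absurd hn (by positivity)
  have h3 := h2.sum_range (fun n => by positivity) (by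
    apply tendsto_atTop_mono (f := fun n : ℕ => (n : ℝ)) _ tendsto_natCast_atTop_atTop
    intro n
    calc (n : ℝ) = ∑ i ∈ range n, (1 : ℝ) := by simp
      _ ≤ _ := sum_le_sum fun i _ => one_le_pow₀ (by linarith [Nat.cast_nonneg (α := ℝ) i]))
  have h4 : (fun n : ℕ => ∑ i ∈ range n, ((i : ℝ) + 1) ^ q) =O[atTop]
      (fun n : ℕ => ((n : ℝ) + 1) ^ (q + 1)) := by
    apply Asymptotics.isBigO_of_le
    intro n
    rw [Real.norm_of_nonneg (sum_nonneg fun i _ => by positivity), Real.norm_of_nonneg (by positivity)]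
    calc ∑ i ∈ range n, ((i : ℝ) + 1) ^ q ≤ ∑ i ∈ range n, ((n : ℝ) + 1) ^ q := by
          apply sum_le_sum
          intro i hi
          have : (i : ℝ) ≤ n := by exact_mod_cast (mem_range.1 hi).le
          gcongr
      _ = n * ((n : ℝ) + 1) ^ q := by simp
      _ ≤ (n + 1) * ((n : ℝ) + 1) ^ q := by gcongr; linarith
      _ = _ := by ring
  have h5 := (h3.trans_isBigO h4).tendsto_div_nhds_zero
  have tele : ∀ n : ℕ, ∑ i ∈ range n, (((i : ℝ) + 2) ^ (q + 1) - ((i : ℝ) + 1) ^ (q + 1)) =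
      ((n : ℝ) + 1) ^ (q + 1) - 1 := by
    intro n
    induction n with
    | zero => simp
    | succ n ih => rw [sum_range_succ, ih]; push_cast; ring
  have h6 : Tendsto (fun n : ℕ => (1 / ((n : ℝ) + 1)) ^ (q + 1)) atTop (𝓝 0) := by
    have := tendsto_inv_succ.pow (q + 1)
    rwa [zero_pow (by omega)] at this
  have h7 := (h5.add (tendsto_const_nhds (x := c'))).sub (h6.const_mul c')
  simp only [zero_add, mul_zero, sub_zero] at h7
  refine h7.congr ?_
  intro n
  rw [sum_sub_distrib, ← mul_sum, tele, one_div_pow]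
  have : ((n : ℝ) + 1) ≠ 0 := by positivity
  field_simp
  ring

theorem low {b : ℕ → ℝ} {q q' : ℕ} {c : ℝ} (hq : q < q')
    (h : Tendsto (fun n : ℕ => b n / ((n : ℝ) + 1) ^ q) atTop (𝓝 c)) :
    Tendsto (fun n : ℕ => b n / ((n : ℝ) + 1) ^ q') atTop (𝓝 0) := by
  obtain ⟨k, rfl⟩ : ∃ k, q' = q + (k + 1) := ⟨q' - q - 1, by omega⟩
  have h6 : Tendsto (fun n : ℕ => (1 / ((n : ℝ) + 1)) ^ (k + 1)) atTop (𝓝 0) := by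
    have := tendsto_inv_succ.pow (k + 1)
    rwa [zero_pow (by omega)] at this
  have := h.mul h6
  rw [mul_zero] at this
  refine this.congr ?_
  intro n
  rw [one_div_pow, pow_add]
  have : ((n : ℝ) + 1) ≠ 0 := by positivity
  field_simp
  ring

theorem cesaro' {b : ℕ → ℝ} {q : ℕ} {c : ℝ}
    (h : Tendsto (fun n : ℕ => b n / ((n : ℝ) + 1) ^ q) atTop (𝓝 c)) :
    Tendsto (fun n : ℕ => (∑ i ∈ range (n + 1), b i) / ((n : ℝ) + 1) ^ (q + 1)) atTop
      (𝓝 (c / (q + 1))) := by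
  have := (cesaro h).add (low (Nat.lt_succ_self q) h)
  rw [add_zero] at this
  refine this.congr ?_
  intro n
  rw [sum_range_succ, add_div]

theorem bb_odd {j i : ℕ} (hi : i ≤ j) (h : Odd (j - i)) : bb j i = 0 := by
  unfold bb; rw [h.neg_one_pow]; ring

theorem E_PP (j n : ℕ) : E n (PP (j + 2)) = ∑ i ∈ range (j + 1), bb (j + 2) i * E n (ps i) := by
  rw [E_congr n (fun l _ => PP_succ j l), E_sum]
  simp_rw [E_smul]

theorem mean_odd (j : ℕ) (hj : Odd j) : ∀ n, E n (M j) = 0 := by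
  induction j using Nat.strong_induction_on with
  | _ j ih =>
    intro n
    have hP : ∀ i, E i (PP j) = 0 := by
      intro t
      match j, hj, ih with
      | 0, hj, _ => exact absurd hj (by decide)
      | 1, _, _ => rw [E_congr t (fun l _ => PP_one l), E_const]
      | j + 2, hj, ih =>
        rw [E_PP]
        apply sum_eq_zero
        intro i hi
        rw [mem_range] at hi
        rcases Nat.even_or_odd i with h | h
        · rw [bb_odd (by omega), zero_mul]
          exact Nat.Odd.sub_even (by omega) hj h
        · rw [mp_sum, sum_eq_zero (fun s _ => ih i (by omega) h s), mul_zero]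
    have := m_sum j n
    rw [sum_eq_zero (fun i _ => hP i)] at this
    rcases mul_eq_zero.1 this with h | h
    · exact absurd h (by positivity)
    · exact h

noncomputable def cat : ℕ → ℝ
  | 0 => 1
  | q + 1 => 2 * (2 * q + 1) / (q + 2) * cat q

theorem cat_pos (q : ℕ) : 0 < cat q := by
  induction q with
  | zero => simp [cat]
  | succ q ih => rw [cat]; positivity

theorem mean_even (q : ℕ) :
    Tendsto (fun n : ℕ => E n (M (2 * q)) / ((n : ℝ) + 1) ^ q) atTop (𝓝 (cat q)) := by
  induction q using Nat.strong_induction_on with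
  | _ q ih =>
    match q, ih with
    | 0, _ =>
      have : ∀ n, E n (M (2 * 0)) / ((n : ℝ) + 1) ^ 0 = 1 := by
        intro n
        rw [E_congr n (fun l _ => M_zero l), E_one]; simp
      simp only [this, cat]
      exact tendsto_const_nhds
    | q + 1, ih =>
      have hp : ∀ i ∈ range (2 * q + 1), Tendsto (fun n : ℕ => E n (ps i) / ((n : ℝ) + 1) ^ (q + 1))
          atTop (𝓝 (if i = 2 * q then cat q / (q + 1) else 0)) := by
        intro i hi
        rw [mem_range] at hi
        simp only [mp_sum]
        rcases Nat.even_or_odd' i with ⟨r, rfl | rfl⟩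
        · by_cases hr : r = q
          · subst hr
            rw [if_pos rfl]
            exact cesaro (ih r (by omega))
          · rw [if_neg (by omega)]
            exact low (by omega) (cesaro (ih r (by omega)))
        · rw [if_neg (by omega)]
          simp only [mean_odd (2 * r + 1) ⟨r, rfl⟩, sum_const_zero, zero_div]
          exact tendsto_const_nhds
      have hP : Tendsto (fun n : ℕ => E n (PP (2 * q + 2)) / ((n : ℝ) + 1) ^ (q + 1)) atTop
          (𝓝 (2 * (2 * q + 1) * cat q)) := by
        have := tendsto_finsetSum (range (2 * q + 1)) (fun i hi => (hp i hi).const_mul (bb (2 * q + 2) i))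
        have e : ∑ i ∈ range (2 * q + 1), bb (2 * q + 2) i * (if i = 2 * q then cat q / (q + 1) else 0)
            = 2 * (2 * q + 1) * cat q := by
          rw [sum_eq_single (2 * q)]
          · rw [if_pos rfl]
            unfold bb
            rw [show 2 * q + 2 - 2 * q = 2 by omega, Nat.choose_symm_add, Nat.choose_two_right]
            rw [show (2 * q + 2) * (2 * q + 2 - 1) / 2 = (q + 1) * (2 * q + 1) by
              rw [show 2 * q + 2 - 1 = 2 * q + 1 by omega]
              rw [show (2 * q + 2) * (2 * q + 1) = 2 * ((q + 1) * (2 * q + 1)) by ring]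
              simp]
            push_cast
            field_simp
            ring
          · intro i _ hi; rw [if_neg hi, mul_zero]
          · intro h; simp at h
        rw [e] at this
        refine this.congr ?_
        intro n
        rw [E_PP, sum_div]
        apply sum_congr rfl
        intros; ring
      have h2 := cesaro' hP
      have e : 2 * (2 * q + 1) * cat q / (((q + 1 : ℕ) : ℝ) + 1) = cat (q + 1) := by
        rw [cat]; push_cast; ring
      rw [e] at h2
      refine h2.congr ?_
      intro n
      rw [show 2 * (q + 1) = 2 * q + 2 by ring, ← m_sum]
      have : (n : ℝ) + 1 ≠ 0 := by positivity
      field_simp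
      ring

theorem M_even_nonneg (j : ℕ) (l : YoungDiagram) : 0 ≤ M (2 * j) l := by
  unfold M
  have := d_pos l
  apply div_nonneg
  · apply sum_nonneg
    intro L _
    have := d_pos L
    rw [pow_mul]
    positivity
  · positivity

theorem V_eq_zero (n : ℕ) {f : YoungDiagram → ℝ} {c : ℝ} (h : ∀ l, f l = c) : V n f = 0 := by
  have : f = fun _ => c := funext h
  subst this
  unfold V
  simp [E_const]

theorem var_ps {j : ℕ} (h : Tendsto (fun n : ℕ => V n (M j) / ((n : ℝ) + 1) ^ j) atTop (𝓝 0)) :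
    Tendsto (fun n : ℕ => V n (ps j) / ((n : ℝ) + 1) ^ (j + 2)) atTop (𝓝 0) := by
  set b : ℕ → ℝ := fun n => V n (M j) + E n (M (2 * j)) / (n + 1) with hb
  have hb1 : Tendsto (fun n : ℕ => b n / ((n : ℝ) + 1) ^ j) atTop (𝓝 0) := by
    have := h.add (low (Nat.lt_succ_self j) (mean_even j))
    rw [add_zero] at this
    refine this.congr ?_
    intro n
    rw [hb]
    have : (n : ℝ) + 1 ≠ 0 := by positivity
    simp only
    rw [pow_succ]
    field_simp
  have hb2 := cesaro hb1
  rw [zero_div] at hb2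
  have ht : ∀ n : ℕ, V n (ps j) / (n + 1) ≤ ∑ i ∈ range n, b i := by
    intro n
    induction n with
    | zero =>
      simp [V, E_zero]
    | succ n ih =>
      rw [sum_range_succ]
      refine le_trans ?_ (add_le_add_left ih (b n))
      have h1 := V_p_rec j n
      have h2 := V_nonneg n (M j)
      have h3 : 0 ≤ E n (M (2 * j)) := E_nonneg n (fun l _ => M_even_nonneg j l)
      have h4 := V_nonneg n (ps j)
      push_cast
      rw [div_le_iff₀ (by positivity)]
      refine h1.trans ?_
      rw [hb]
      simp only
      have hn : (0 : ℝ) < n + 1 := by positivity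
      have e : (V n (ps j) / (↑n + 1) + (V n (M j) + E n (M (2 * j)) / (↑n + 1))) * ((n : ℝ) + 1 + 1) =
         V n (ps j) * ((n + 2) / (n + 1)) + ((n + 1) * V n (M j) + E n (M (2 * j)))
           + (V n (M j) + E n (M (2 * j)) / (n + 1)) := by
        field_simp
        ring
      rw [e]
      have : 0 ≤ V n (M j) + E n (M (2 * j)) / (n + 1) := by positivity
      linarith
  refine squeeze_zero (fun n => div_nonneg (V_nonneg _ _) (by positivity)) (fun n => ?_) hb2
  have : V n (ps j) / ((n : ℝ) + 1) ^ (j + 2) = V n (ps j) / (n + 1) / ((n : ℝ) + 1) ^ (j + 1) := by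
    rw [div_div]; ring_nf
  rw [this]
  gcongr
  exact ht n

theorem var_M (j : ℕ) : Tendsto (fun n : ℕ => V n (M j) / ((n : ℝ) + 1) ^ j) atTop (𝓝 0) := by
  induction j using Nat.strong_induction_on with
  | _ j ih =>
    have hP : Tendsto (fun n : ℕ => V n (PP j) / ((n : ℝ) + 1) ^ j) atTop (𝓝 0) := by
      match j, ih with
      | 0, _ => simp only [V_eq_zero _ PP_zero, zero_div]; exact tendsto_const_nhds
      | 1, _ => simp only [V_eq_zero _ PP_one, zero_div]; exact tendsto_const_nhds
      | j + 2, ih =>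
        have hp : ∀ i ∈ range (j + 1), Tendsto (fun n : ℕ => V n (ps i) / ((n : ℝ) + 1) ^ (j + 2))
            atTop (𝓝 0) := by
          intro i hi
          rw [mem_range] at hi
          have h1 := var_ps (ih i (by omega))
          rcases Nat.lt_or_ge i j with h | h
          · exact low (by omega) h1
          · have : i = j := by omega
            subst this; exact h1
        have h2 := (tendsto_finsetSum (range (j + 1))
          (fun i hi => (hp i hi).const_mul (bb (j + 2) i ^ 2))).const_mul ((j : ℝ) + 1)
        simp only [mul_zero, sum_const_zero] at h2
        refine squeeze_zero (fun n => div_nonneg (V_nonneg _ _) (by positivity)) (fun n => ?_) h2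
        rw [div_le_iff₀ (by positivity)]
        refine (V_PP j n).trans (le_of_eq ?_)
        rw [mul_assoc, sum_mul]
        congr 1
        apply sum_congr rfl
        intro i _
        field_simp
    have h2 := cesaro' hP
    rw [zero_div] at h2
    refine squeeze_zero (fun n => div_nonneg (V_nonneg _ _) (by positivity)) (fun n => ?_) h2
    have h1 := V_M_sum j n
    rw [div_le_div_iff₀ (by positivity) (by positivity), pow_succ]
    have : (0 : ℝ) ≤ ((n : ℝ) + 1) ^ j := by positivity
    nlinarith [mul_le_mul_of_nonneg_right h1 this]

end PG

namespace PG
open Finset Filter Topology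

/-- indicator of growth in row `r` -/
noncomputable def ir (r : ℕ) (l L : YoungDiagram) : ℝ := if inRow r l L then 1 else 0

noncomputable def lw (k : ℕ) (l L : YoungDiagram) : ℝ := ∑ r ∈ range (k + 1), ir r l L

noncomputable def ar (r n : ℕ) : ℝ := EE n (ir r)
noncomputable def Ak (k n : ℕ) : ℝ := EE n (lw k)

theorem ir_nonneg (r : ℕ) (l L : YoungDiagram) : 0 ≤ ir r l L := by
  unfold ir; split_ifs <;> norm_num

theorem lw_cell {l L : YoungDiagram} {c : ℕ × ℕ} (hc : c ∉ l.cells)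
    (h : L.cells = insert c l.cells) (k : ℕ) : lw k l L = if c.1 ≤ k then 1 else 0 := by
  unfold lw ir
  simp only [inRow_iff hc h]
  simp [Nat.lt_succ_iff]

theorem EE_sum {ι : Type*} (s : Finset ι) (n : ℕ) (f : ι → YoungDiagram → YoungDiagram → ℝ) :
    EE n (fun l L => ∑ i ∈ s, f i l L) = ∑ i ∈ s, EE n (f i) := by
  classical
  induction s using Finset.induction_on with
  | empty => simp [EE]
  | insert a s ha ih =>
    simp only [sum_insert ha]
    rw [EE_add, ih]

theorem Ak_eq (k n : ℕ) : Ak k n = ∑ r ∈ range (k + 1), ar r n := by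
  unfold Ak lw ar
  exact EE_sum _ n _

theorem ar_nonneg (r n : ℕ) : 0 ≤ ar r n :=
  sum_nonneg fun l _ => sum_nonneg fun L _ => by
    have := d_pos l; have := d_pos L; have := ir_nonneg r l L
    positivity

noncomputable def hr (r : ℕ) (L : YoungDiagram) : ℝ := ∑ l ∈ dn L, ir r l L * d l

theorem hr_nonneg (r : ℕ) (L : YoungDiagram) : 0 ≤ hr r L :=
  sum_nonneg fun l _ => mul_nonneg (ir_nonneg _ _ _) (d_pos l).le

theorem ar_eq (r n : ℕ) : ar r n = ∑ L ∈ Y (n + 1), hr r L * d L / ((n + 1).factorial : ℝ) := by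
  unfold ar hr
  rw [EE_swap]
  apply sum_congr rfl
  intro L _
  rw [sum_mul, sum_div]
  apply sum_congr rfl
  intros; ring

theorem sq_sum_unique {ι : Type*} (s : Finset ι) (p : ι → Prop) [DecidablePred p]
    (h : ∀ a ∈ s, ∀ b ∈ s, p a → p b → a = b) (x : ι → ℝ) :
    (∑ a ∈ s, (if p a then 1 else 0) * x a) ^ 2 = ∑ a ∈ s, (if p a then 1 else 0) * x a ^ 2 := by
  by_cases he : ∃ a ∈ s, p a
  · obtain ⟨a, ha, hp⟩ := he
    rw [sum_eq_single a, sum_eq_single a]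
    · simp [hp]
    · intro b hb hne
      rw [if_neg (fun hpb => hne (h b hb a ha hpb hp)), zero_mul]
    · intro h; exact absurd ha h
    · intro b hb hne
      rw [if_neg (fun hpb => hne (h b hb a ha hpb hp)), zero_mul]
    · intro h; exact absurd ha h
  · push Not at he
    rw [sum_eq_zero (fun a ha => by rw [if_neg (he a ha), zero_mul]),
      sum_eq_zero (fun a ha => by rw [if_neg (he a ha), zero_mul])]
    simp

theorem sum_unique_le {ι : Type*} (s : Finset ι) (p : ι → Prop) [DecidablePred p]
    (h : ∀ a ∈ s, ∀ b ∈ s, p a → p b → a = b) :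
    (∑ a ∈ s, (if p a then 1 else 0 : ℝ)) ≤ 1 := by
  rw [sum_boole]
  have : #{x ∈ s | p x} ≤ 1 := by
    rw [card_le_one]
    intro a ha b hb
    rw [mem_filter] at ha hb
    exact h a ha.1 b hb.1 ha.2 hb.2
  exact_mod_cast this

theorem sum_d_sq (n : ℕ) : ∑ l ∈ Y n, d l ^ 2 = (n.factorial : ℝ) := by
  have h := E_one n
  unfold E at h
  simp only [mul_one] at h
  rw [← sum_div, div_eq_one_iff_eq (by positivity)] at h
  exact h

theorem sum_hr_sq (r n : ℕ) : ∑ L ∈ Y (n + 1), hr r L ^ 2 ≤ (n.factorial : ℝ) := by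
  have h1 : ∀ L ∈ Y (n + 1), hr r L ^ 2 = ∑ l ∈ dn L, ir r l L * d l ^ 2 := by
    intro L _
    unfold hr ir
    exact sq_sum_unique _ _ (fun a ha b hb hpa hpb =>
      dn_row_unique (mem_dn.1 ha) (mem_dn.1 hb) hpa hpb) _
  rw [sum_congr rfl h1, ← sum_swap n (fun l L => ir r l L * d l ^ 2), ← sum_d_sq n]
  apply sum_le_sum
  intro l _
  rw [← sum_mul]
  have : ∑ L ∈ up l, ir r l L ≤ 1 := by
    unfold ir
    exact sum_unique_le _ _ (fun a ha b hb hpa hpb =>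
      up_row_unique (mem_up.1 ha) (mem_up.1 hb) hpa hpb)
  nlinarith [sq_nonneg (d l)]

theorem fact_succ (n : ℕ) : ((n + 1).factorial : ℝ) = ((n : ℝ) + 1) * n.factorial := by
  rw [Nat.factorial_succ]; push_cast; ring

theorem ar_le (r n : ℕ) : ar r n ≤ 1 / Real.sqrt (n + 1) := by
  have hn : (0 : ℝ) < n + 1 := by positivity
  have h0 := ar_nonneg r n
  rw [one_div, ← Real.sqrt_inv]
  apply Real.le_sqrt_of_sq_le
  rw [ar_eq, ← sum_div, div_pow]
  have h1 := sum_mul_sq_le_sq_mul_sq (Y (n + 1)) (hr r) d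
  rw [sum_d_sq] at h1
  have h2 := sum_hr_sq r n
  have hf : (0 : ℝ) < n.factorial := by positivity
  have hf' : (0 : ℝ) < (n + 1).factorial := by positivity
  rw [div_le_iff₀ (by positivity)]
  refine h1.trans ?_
  calc _ ≤ (n.factorial : ℝ) * (n + 1).factorial := by gcongr
    _ = _ := by rw [fact_succ]; field_simp

theorem Ak_le (k n : ℕ) : Ak k n ≤ (k + 1) / Real.sqrt (n + 1) := by
  rw [Ak_eq]
  calc _ ≤ ∑ r ∈ range (k + 1), 1 / Real.sqrt (n + 1) := sum_le_sum fun r _ => ar_le r n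
    _ = _ := by simp; ring

theorem Ak_nonneg (k n : ℕ) : 0 ≤ Ak k n := by
  rw [Ak_eq]; exact sum_nonneg fun r _ => ar_nonneg r n

theorem lw_mid {l M : YoungDiagram} (k : ℕ) :
    ∑ L ∈ up l ∩ dn M, lw k L M ≤ ∑ L ∈ up l ∩ dn M, lw k l L := by
  by_cases hall : ∀ L ∈ up l ∩ dn M, lw k L M ≤ lw k l L
  · exact sum_le_sum hall
  push Not at hall
  obtain ⟨L, hL, hlt⟩ := hall
  rw [mem_inter, mem_up, mem_dn] at hL
  obtain ⟨a, ha, hLa⟩ := cov_cell hL.1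
  obtain ⟨b, hb, hMb⟩ := cov_cell hL.2
  rw [lw_cell ha hLa, lw_cell hb hMb] at hlt
  have hbk : b.1 ≤ k := by
    by_contra h; rw [if_neg h] at hlt; split_ifs at hlt <;> norm_num at hlt
  have hak : ¬ a.1 ≤ k := by
    intro h; rw [if_pos h] at hlt; split_ifs at hlt <;> norm_num at hlt
  have hba : b ≠ a := by rintro rfl; exact hak hbk
  have hbl : b ∉ l.cells := fun h => hb (by rw [hLa]; exact mem_insert_of_mem h)
  let L' : YoungDiagram := ⟨insert b l.cells, by
    intro x y hyx hx
    rw [mem_coe, mem_insert] at hx ⊢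
    rcases hx with rfl | hx
    · by_cases hyx' : y = x
      · exact Or.inl hyx'
      right
      have h1 : y ∈ M.cells := M.isLowerSet hyx (by rw [mem_coe, hMb]; simp)
      rw [hMb, hLa, mem_insert, mem_insert] at h1
      rcases h1 with h1 | h1 | h1
      · exact absurd h1 hyx'
      · exfalso
        have : y.1 ≤ x.1 := hyx.1
        rw [h1] at this
        omega
      · exact h1
    · right
      exact l.isLowerSet hyx hx⟩
  have hL'c : L'.cells = insert b l.cells := rfl
  have hML' : M.cells = insert a L'.cells := by
    rw [hMb, hLa, hL'c, Finset.insert_comm]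
  have haL' : a ∉ L'.cells := by
    rw [hL'c, mem_insert]; push Not; exact ⟨hba.symm, ha⟩
  have hne : L ≠ L' := by
    intro h
    apply hb
    rw [h, hL'c]; simp
  have hD : up l ∩ dn M = {L, L'} := by
    ext X
    rw [mem_inter, mem_up, mem_dn, mem_insert, mem_singleton]
    constructor
    · rintro ⟨h1, h2⟩
      obtain ⟨x, hx, hX⟩ := cov_cell h1
      have : x ∈ M.cells := YoungDiagram.cells_subset_iff.2 h2.1 (by rw [hX]; simp)
      rw [hMb, hLa, mem_insert, mem_insert] at this
      rcases this with h | h | h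
      · right; apply yd_ext; rw [hX, h, hL'c]
      · left; apply yd_ext; rw [hX, h, hLa]
      · exact absurd h hx
    · rintro (rfl | rfl)
      · exact hL
      · exact ⟨cov_of_cell hbl hL'c, cov_of_cell haL' hML'⟩
  rw [hD, sum_pair hne, sum_pair hne, lw_cell ha hLa, lw_cell hb hMb, lw_cell hbl hL'c,
    lw_cell haL' hML', if_pos hbk, if_neg hak]
  norm_num

theorem lw_step (k : ℕ) (l : YoungDiagram) :
    ∑ L ∈ up l, ∑ M ∈ up L, d M * lw k L M ≤ ∑ L ∈ up l, ∑ M ∈ up L, d M * lw k l L := by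
  have key : ∀ G : YoungDiagram → YoungDiagram → ℝ, ∑ L ∈ up l, ∑ M ∈ up L, G L M =
      ∑ M ∈ Y (l.card + 2), ∑ L ∈ up l ∩ dn M, G L M := by
    intro G
    apply sum_comm'
    intro L M
    simp only [mem_up, mem_inter, mem_dn, mem_Y]
    constructor
    · rintro ⟨h1, h2⟩
      refine ⟨⟨h1, h2⟩, ?_⟩
      have := h1.2; have := h2.2; omega
    · rintro ⟨h, _⟩; exact h
  rw [key, key]
  apply sum_le_sum
  intro M _
  rw [← mul_sum, ← mul_sum]
  exact mul_le_mul_of_nonneg_left (lw_mid k) (d_pos M).le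

theorem Ak_succ_le (k n : ℕ) : Ak k (n + 1) ≤ Ak k n := by
  have h1 : Ak k (n + 1) = ∑ l ∈ Y n, d l / ((n + 2).factorial : ℝ) *
      ∑ L ∈ up l, ∑ M ∈ up L, d M * lw k L M := by
    unfold Ak EE
    have : ∀ L ∈ Y (n + 1), ∑ M ∈ up L, d L * d M / ((n + 1 + 1).factorial : ℝ) * lw k L M =
        ∑ l ∈ dn L, d l / ((n + 2).factorial : ℝ) * ∑ M ∈ up L, d M * lw k L M := by
      intro L hL
      rw [← sum_mul, ← sum_div, ← d_rec (ne_bot_of_mem hL), mul_sum]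
      apply sum_congr rfl
      intros; ring
    rw [sum_congr rfl this, ← sum_swap n (fun l L => d l / ((n + 2).factorial : ℝ) *
      ∑ M ∈ up L, d M * lw k L M)]
    apply sum_congr rfl
    intro l _
    rw [mul_sum]
  have h2 : Ak k n = ∑ l ∈ Y n, d l / ((n + 2).factorial : ℝ) *
      ∑ L ∈ up l, ∑ M ∈ up L, d M * lw k l L := by
    unfold Ak EE
    apply sum_congr rfl
    intro l hl
    rw [mul_sum]
    apply sum_congr rfl
    intro L hL
    rw [← sum_mul, sum_up_d, (mem_up.1 hL).2, mem_Y.1 hl, fact_succ (n + 1)]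
    push_cast
    have : ((n : ℝ) + 1 + 1) ≠ 0 := by positivity
    have : ((n + 1).factorial : ℝ) ≠ 0 := by positivity
    field_simp
  rw [h1, h2]
  apply sum_le_sum
  intro l _
  have := d_pos l
  exact mul_le_mul_of_nonneg_left (lw_step k l) (by positivity)

theorem Ak_anti (k : ℕ) : Antitone (Ak k) := antitone_nat_of_succ_le (Ak_succ_le k)

theorem rowLen_step {l L : YoungDiagram} (h : Cov l L) (r : ℕ) :
    (L.rowLen r : ℝ) = l.rowLen r + ir r l L := by
  obtain ⟨c, hc, hL⟩ := cov_cell h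
  unfold ir
  simp only [inRow_iff hc hL]
  rw [rowLen_cov hc hL]
  push_cast
  rfl

theorem sum_ar (r n : ℕ) : ∑ t ∈ range n, ar r t = E n (fun l => (l.rowLen r : ℝ)) := by
  induction n with
  | zero =>
    rw [E_zero]
    simp [YoungDiagram.rowLen_eq_card, YoungDiagram.row]
  | succ n ih =>
    rw [sum_range_succ, ih, ← EE_snd, EE_congr n (fun l _ L hL => rowLen_step hL r),
      EE_add, EE_fst]
    rfl

end PG

namespace PG
open Finset Filter Topology

noncomputable def mu (j : ℕ) : ℝ := if Even j then cat (j / 2) else 0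

theorem sqrt_pow_even (n q : ℕ) : Real.sqrt ((n : ℝ) + 1) ^ (2 * q) = ((n : ℝ) + 1) ^ q := by
  rw [pow_mul, Real.sq_sqrt (by positivity)]

theorem sqrt_succ_pos (n : ℕ) : 0 < Real.sqrt ((n : ℝ) + 1) := Real.sqrt_pos.2 (by positivity)

theorem mean_lim (j : ℕ) :
    Tendsto (fun n : ℕ => E n (M j) / Real.sqrt ((n : ℝ) + 1) ^ j) atTop (𝓝 (mu j)) := by
  unfold mu
  rcases Nat.even_or_odd' j with ⟨r, rfl | rfl⟩
  · rw [if_pos (even_two_mul r), show 2 * r / 2 = r by omega]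
    simp only [sqrt_pow_even]
    exact mean_even r
  · rw [if_neg (by simp)]
    simp only [mean_odd (2 * r + 1) ⟨r, rfl⟩, zero_div]
    exact tendsto_const_nhds

theorem L2_lim (j : ℕ) :
    Tendsto (fun n : ℕ => E n (fun l => (M j l / Real.sqrt ((n : ℝ) + 1) ^ j - mu j) ^ 2))
      atTop (𝓝 0) := by
  have h1 := var_M j
  have h2 := ((mean_lim j).sub_const (mu j)).pow 2
  rw [sub_self] at h2
  have h3 := h1.add h2
  rw [zero_pow two_ne_zero, add_zero] at h3
  refine h3.congr ?_
  intro n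
  have hN := sqrt_succ_pos n
  rw [← sqrt_pow_even n j]
  set N := Real.sqrt ((n : ℝ) + 1)
  set m := E n (M j) with hm
  have e : ∀ l ∈ Y n, (M j l / N ^ j - mu j) ^ 2 =
      (1 / N ^ (2 * j)) * (M j l - m) ^ 2 + ((2 * (m / N ^ j - mu j) / N ^ j) * M j l
       + (-(2 * (m / N ^ j - mu j) / N ^ j) * m + (m / N ^ j - mu j) ^ 2)) := by
    intro l _
    have : N ^ (2 * j) = N ^ j * N ^ j := by ring
    rw [this]
    have : N ^ j ≠ 0 := by positivity
    field_simp
    ring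
  rw [E_congr n e, E_add, E_add, E_smul, E_smul, E_const, ← hm]
  unfold V
  rw [← hm]
  ring

noncomputable def F (c : ℕ → ℝ) (q : ℕ) (x : ℝ) : ℝ := ∑ i ∈ range 4, c i * x ^ (2 * q + i)

noncomputable def Ym (c : ℕ → ℝ) (q n : ℕ) (l : YoungDiagram) : ℝ :=
  ∑ i ∈ range 4, c i * (M (2 * q + i) l / Real.sqrt ((n : ℝ) + 1) ^ (2 * q + i))

theorem EE_F (c : ℕ → ℝ) (q n : ℕ) (β : YoungDiagram → ℝ) :
    EE n (fun l L => F c q (cc l L / Real.sqrt ((n : ℝ) + 1)) * β l) =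
      E n (fun l => Ym c q n l * β l) := by
  unfold F Ym
  simp only [sum_mul]
  rw [EE_sum, E_sum]
  apply sum_congr rfl
  intro i _
  set N := Real.sqrt ((n : ℝ) + 1)
  have h1 := EE_smul n (c i / N ^ (2 * q + i)) (fun l L => cc l L ^ (2 * q + i) * β l)
  have h2 := E_smul n (c i / N ^ (2 * q + i)) (fun l => M (2 * q + i) l * β l)
  rw [EE_cc, ← h2] at h1
  convert h1 using 1
  · congr 1; ext l L; rw [div_pow]; ring
  · congr 1; ext l; ring

theorem Ym_L2 (c : ℕ → ℝ) (q : ℕ) :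
    Tendsto (fun n : ℕ => E n (fun l => (Ym c q n l - ∑ i ∈ range 4, c i * mu (2 * q + i)) ^ 2))
      atTop (𝓝 0) := by
  have h := (tendsto_finsetSum (range 4)
    (fun i _ => (L2_lim (2 * q + i)).const_mul (c i ^ 2))).const_mul 4
  simp only [mul_zero, sum_const_zero] at h
  refine squeeze_zero (fun n => E_nonneg n fun _ _ => sq_nonneg _) (fun n => ?_) h
  simp only [← E_smul]
  rw [← E_sum, ← E_smul]
  apply E_mono
  intro l _
  unfold Ym
  rw [← sum_sub_distrib]
  refine sq_sum_le_card_mul_sum_sq.trans ?_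
  rw [card_range]
  push_cast
  gcongr with i _
  apply le_of_eq; ring

theorem EE_F_sq (c : ℕ → ℝ) (q : ℕ) : ∃ C : ℝ, ∀ᶠ n : ℕ in atTop,
    EE n (fun l L => F c q (cc l L / Real.sqrt ((n : ℝ) + 1)) ^ 2) ≤ C := by
  have h := (tendsto_finsetSum (range 4)
    (fun i _ => (mean_lim (2 * (2 * q + i))).const_mul (c i ^ 2))).const_mul 4
  refine ⟨_, (h.eventually_le_const (lt_add_one _)).mono fun n hn => le_trans ?_ hn⟩
  set N := Real.sqrt ((n : ℝ) + 1)
  have : ∀ i, E n (M (2 * (2 * q + i))) = EE n (fun l L => cc l L ^ (2 * (2 * q + i)) * 1) := by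
    intro i; rw [EE_cc]; simp
  simp only [this]
  have h2 : ∀ i, c i ^ 2 * (EE n (fun l L => cc l L ^ (2 * (2 * q + i)) * 1) / N ^ (2 * (2 * q + i)))
     = EE n (fun l L => (c i ^ 2 / N ^ (2 * (2 * q + i))) * (cc l L ^ (2 * (2 * q + i)) * 1)) := by
    intro i; rw [EE_smul]; ring
  simp only [h2]
  rw [← EE_sum, ← EE_smul]
  apply EE_mono
  intro l _ L _
  unfold F
  refine sq_sum_le_card_mul_sum_sq.trans ?_
  rw [card_range]
  push_cast
  gcongr with i _
  apply le_of_eq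
  rw [div_pow]; ring

noncomputable def cf (a : ℝ) : ℕ → ℝ
  | 0 => -4 * a
  | 1 => 4 - 4 * a
  | 2 => 4 - a
  | _ => 1

theorem F_cf (a : ℝ) (q : ℕ) (x : ℝ) : F (cf a) q x = (x - a) * (x ^ q * (x + 2)) ^ 2 := by
  unfold F
  simp only [sum_range_succ, sum_range_zero, cf]
  ring

theorem bad_prob (k : ℕ) {a : ℝ} (ha0 : 0 < a) (ha : a < 2) :
    Tendsto (fun n : ℕ => E n (fun l => if (l.rowLen k : ℝ) < a * Real.sqrt ((n : ℝ) + 1)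
      then 1 else 0)) atTop (𝓝 0) := by
  obtain ⟨q, hq⟩ := exists_nat_gt (10 * a / (16 - 8 * a))
  rw [div_lt_iff₀ (by linarith)] at hq
  set c := cf a with hc
  obtain ⟨δ, hδ⟩ : ∃ δ, δ = ∑ i ∈ range 4, c i * mu (2 * q + i) := ⟨_, rfl⟩
  have hδ' : δ = (4 - a) * cat (q + 1) - 4 * a * cat q := by
    rw [hδ]
    simp only [sum_range_succ, sum_range_zero, hc, cf, mu]
    rw [if_pos (by simp), if_neg (by simp [Nat.even_add]), if_pos (by simp [Nat.even_add]),
      if_neg (by simp [Nat.even_add]; decide), show (2 * q + 0) / 2 = q by omega,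
      show (2 * q + 2) / 2 = q + 1 by omega]
    ring
  have hδ0 : 0 < δ := by
    rw [hδ', cat]
    have h1 := cat_pos q
    have : (4 - a) * (2 * (2 * (q : ℝ) + 1) / (q + 2) * cat q) - 4 * a * cat q =
      cat q / (q + 2) * ((4 - a) * (2 * (2 * q + 1)) - 4 * a * (q + 2)) := by
      field_simp
    rw [this]
    apply mul_pos (by positivity)
    nlinarith
  obtain ⟨C, hC⟩ := EE_F_sq c q
  have hL2 := Ym_L2 c q
  rw [← hδ] at hL2
  have hN : Tendsto (fun n : ℕ => Real.sqrt ((n : ℝ) + 1)) atTop atTop :=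
    Real.tendsto_sqrt_atTop.comp (tendsto_natCast_atTop_atTop.atTop_add tendsto_const_nhds)
  have ht : Tendsto (fun n : ℕ => Real.sqrt (Real.sqrt ((n : ℝ) + 1))) atTop atTop :=
    Real.tendsto_sqrt_atTop.comp hN
  have hmain : Tendsto (fun n : ℕ => (2 / δ) * ((((k : ℝ) + 1 + C) / 2) /
      Real.sqrt (Real.sqrt ((n : ℝ) + 1)) + (1 / (2 * δ)) * E n (fun l => (Ym c q n l - δ) ^ 2)))
      atTop (𝓝 0) := by
    have := ((ht.const_div_atTop (((k : ℝ) + 1 + C) / 2)).add (hL2.const_mul (1 / (2 * δ)))).const_mul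
      (2 / δ)
    simpa using this
  refine squeeze_zero' (Eventually.of_forall fun n => E_nonneg n fun l _ => by split_ifs <;> norm_num)
    (hC.mono fun n hn => ?_) hmain
  have hNp := sqrt_succ_pos n
  set N := Real.sqrt ((n : ℝ) + 1) with hNdef
  set t := Real.sqrt N with htdef
  have htp : 0 < t := Real.sqrt_pos.2 hNp
  have htt : t * t = N := Real.mul_self_sqrt hNp.le
  set β : YoungDiagram → ℝ := fun l => if (l.rowLen k : ℝ) < a * N then 1 else 0 with hβ
  have hβ01 : ∀ l, β l = 0 ∨ β l = 1 := by
    intro l; rw [hβ]; simp only; split_ifs <;> simp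
  have s1 : (δ / 2) * E n β ≤ E n (fun l => Ym c q n l * β l) +
      (1 / (2 * δ)) * E n (fun l => (Ym c q n l - δ) ^ 2) := by
    rw [← E_smul, ← E_smul, ← E_add]
    apply E_mono
    intro l _
    have hsq := sq_nonneg (Ym c q n l - δ)
    rcases hβ01 l with h | h
    · rw [h]; simp only [mul_zero, zero_add]; positivity
    · rw [h]
      have : δ / 2 * 1 - (Ym c q n l * 1 + 1 / (2 * δ) * (Ym c q n l - δ) ^ 2) =
        - (1 / (2 * δ)) * (Ym c q n l) ^ 2 := by
        field_simp; ring
      have h3 : 0 ≤ 1 / (2 * δ) * (Ym c q n l) ^ 2 := by positivity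
      linarith
  have s2 : E n (fun l => Ym c q n l * β l) ≤ (((k : ℝ) + 1 + C) / 2) / t := by
    rw [← EE_F]
    have h1 : EE n (fun l L => F c q (cc l L / N) * β l) ≤
        EE n (fun l L => (t / 2) * lw k l L + (1 / (2 * t)) * F c q (cc l L / N) ^ 2) := by
      apply EE_mono
      intro l _ L hL
      obtain ⟨x, hx, hLx⟩ := cov_cell hL
      rw [lw_cell hx hLx]
      set f := F c q (cc l L / N) with hf
      have hf2 : 0 ≤ 1 / (2 * t) * f ^ 2 := by positivity
      rcases hβ01 l with h | h
      · rw [h, mul_zero]; split_ifs <;> positivity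
      rw [h]
      by_cases hk : x.1 ≤ k
      · rw [if_pos hk]
        have : t / 2 * 1 + 1 / (2 * t) * f ^ 2 - f * 1 = (f - t) ^ 2 / (2 * t) := by
          field_simp; ring
        have h3 : 0 ≤ (f - t) ^ 2 / (2 * t) := by positivity
        linarith
      · rw [if_neg hk]
        have hlt : (l.rowLen k : ℝ) < a * N := by
          by_contra hh
          rw [hβ] at h; simp only [if_neg hh] at h; norm_num at h
        have h4 : l.rowLen x.1 ≤ l.rowLen k := l.rowLen_anti k x.1 (by omega)
        have h5 : cc l L ≤ l.rowLen k := by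
          rw [cc_eq hx hLx, cell_col hx hLx]
          have : (l.rowLen x.1 : ℝ) ≤ l.rowLen k := by exact_mod_cast h4
          have : (0 : ℝ) ≤ x.1 := by positivity
          linarith
        have h6 : cc l L / N - a ≤ 0 := by
          rw [sub_nonpos, div_le_iff₀ hNp]; linarith
        have : f ≤ 0 := by
          rw [hf, hc, F_cf]
          exact mul_nonpos_of_nonpos_of_nonneg h6 (sq_nonneg _)
        linarith
    refine h1.trans ?_
    rw [EE_add, EE_smul, EE_smul]
    have h2 : EE n (lw k) ≤ ((k : ℝ) + 1) / N := Ak_le k n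
    calc _ ≤ t / 2 * (((k : ℝ) + 1) / N) + 1 / (2 * t) * C := by gcongr
      _ = _ := by rw [← htt]; field_simp; try ring
  have s3 : E n β = (2 / δ) * (δ / 2 * E n β) := by field_simp
  change E n β ≤ _
  rw [s3]
  gcongr
  linarith

theorem row_lower (r : ℕ) {a : ℝ} (ha : a < 2) :
    ∀ᶠ n : ℕ in atTop, a * Real.sqrt ((n : ℝ) + 1) ≤ E n (fun l => (l.rowLen r : ℝ)) := by
  obtain ⟨b, hb1, hb2⟩ : ∃ b, max a 0 < b ∧ b < 2 := exists_between (by simp [ha])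
  rw [max_lt_iff] at hb1
  have h := (bad_prob r hb1.2 hb2).const_mul b
  rw [mul_zero] at h
  refine (h.eventually_lt_const (show (0 : ℝ) < b - a by linarith)).mono fun n hn => ?_
  have hNp := sqrt_succ_pos n
  set N := Real.sqrt ((n : ℝ) + 1)
  have : E n (fun l => b * N + (-(b * N)) * (if (l.rowLen r : ℝ) < b * N then 1 else 0)) ≤
      E n (fun l => (l.rowLen r : ℝ)) := by
    apply E_mono
    intro l _
    split_ifs with h
    · have : (0 : ℝ) ≤ l.rowLen r := by positivity
      linarith
    · linarith
  rw [E_add, E_const, E_smul] at this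
  nlinarith

end PG

namespace PG
open Finset Filter Topology

theorem sum_inv_sqrt (n : ℕ) : ∑ t ∈ range n, 1 / Real.sqrt ((t : ℝ) + 1) ≤ 2 * Real.sqrt n := by
  induction n with
  | zero => simp
  | succ n ih =>
    rw [sum_range_succ]
    push_cast
    have h1 := sqrt_succ_pos n
    have h2 : Real.sqrt n ≤ Real.sqrt ((n : ℝ) + 1) := Real.sqrt_le_sqrt (by linarith)
    have h3 : Real.sqrt ((n : ℝ) + 1) ^ 2 = n + 1 := Real.sq_sqrt (by positivity)
    have h4 : Real.sqrt n ^ 2 = n := Real.sq_sqrt (by positivity)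
    have h5 := Real.sqrt_nonneg n
    have : 1 / Real.sqrt ((n : ℝ) + 1) ≤ 2 * Real.sqrt ((n : ℝ) + 1) - 2 * Real.sqrt n := by
      rw [div_le_iff₀ h1]
      nlinarith [sq_nonneg (Real.sqrt ((n : ℝ) + 1) - Real.sqrt n)]
    linarith

theorem sum_anti {A : ℕ → ℝ} (hA : Antitone A) (n p : ℕ) :
    ∑ t ∈ range (n + p), A t ≤ ∑ t ∈ range n, A t + p * A n := by
  rw [sum_range_add]
  gcongr
  calc ∑ x ∈ range p, A (n + x) ≤ ∑ x ∈ range p, A n := sum_le_sum fun x _ => hA (by omega)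
    _ = _ := by simp

theorem sqrt_lower {θ : ℝ} (h0 : 0 < θ) : 1 + θ / 2 - θ ^ 2 / 2 ≤ Real.sqrt (1 + θ) := by
  by_cases h : 1 + θ / 2 - θ ^ 2 / 2 ≤ 0
  · exact h.trans (Real.sqrt_nonneg _)
  push Not at h
  apply Real.le_sqrt_of_sq_le
  have h2 : θ < 2 := by
    by_contra hh
    push Not at hh
    nlinarith
  nlinarith [mul_pos h0 h0, mul_pos (mul_pos h0 h0) h0, mul_pos (mul_pos h0 h0) (sub_pos.2 h2)]

theorem tauber {A : ℕ → ℝ} {K : ℝ} (hK : 0 < K) (hA : Antitone A)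
    (hup : ∀ n : ℕ, A n ≤ K / Real.sqrt ((n : ℝ) + 1))
    (hlow : ∀ a < (2 : ℝ), ∀ᶠ n : ℕ in atTop, a * K * Real.sqrt ((n : ℝ) + 1) ≤ ∑ t ∈ range n, A t) :
    Tendsto (fun n : ℕ => K - Real.sqrt ((n : ℝ) + 1) * A n) atTop (𝓝 0) := by
  have hnn : ∀ n : ℕ, 0 ≤ K - Real.sqrt ((n : ℝ) + 1) * A n := by
    intro n
    have h1 := sqrt_succ_pos n
    have := hup n
    rw [le_div_iff₀ h1] at this
    linarith
  have key : ∀ θ : ℝ, 0 < θ → θ ≤ 1 / 4 → ∀ᶠ n : ℕ in atTop,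
      K - Real.sqrt ((n : ℝ) + 1) * A n ≤ 4 * θ * K := by
    intro θ h0 h1
    have e1 := hlow (2 - θ ^ 2) (by nlinarith)
    have e2 : ∀ᶠ n : ℕ in atTop, 1 / ((n : ℝ) + 1) < θ ^ 2 :=
      tendsto_inv_succ.eventually_lt_const (by positivity)
    obtain ⟨n0, hn0⟩ := eventually_atTop.1 e1
    filter_upwards [e2, eventually_ge_atTop n0] with n hn hge
    set p := ⌈θ * ((n : ℝ) + 1)⌉₊ with hp
    have hp1 : θ * ((n : ℝ) + 1) ≤ p := Nat.le_ceil _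
    have hp2 : (p : ℝ) < θ * ((n : ℝ) + 1) + 1 := Nat.ceil_lt_add_one (by positivity)
    have hNp := sqrt_succ_pos n
    have hN2 : Real.sqrt ((n : ℝ) + 1) ^ 2 = n + 1 := Real.sq_sqrt (by positivity)
    have hNn : Real.sqrt n ≤ Real.sqrt ((n : ℝ) + 1) := Real.sqrt_le_sqrt (by linarith)
    set N := Real.sqrt ((n : ℝ) + 1) with hN
    have f1 := hn0 (n + p) (by omega)
    have f2 := sum_anti hA n p
    have f3 : ∑ t ∈ range n, A t ≤ 2 * K * N := by
      calc _ ≤ ∑ t ∈ range n, K * (1 / Real.sqrt ((t : ℝ) + 1)) := sum_le_sum fun t _ => by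
            rw [mul_one_div]; exact hup t
        _ ≤ K * (2 * Real.sqrt n) := by
            rw [← mul_sum]; exact mul_le_mul_of_nonneg_left (sum_inv_sqrt n) hK.le
        _ ≤ _ := by nlinarith
    have f4 : (1 + θ / 2 - θ ^ 2 / 2) * N ≤ Real.sqrt (((n + p : ℕ) : ℝ) + 1) := by
      calc _ ≤ Real.sqrt (1 + θ) * N := by
            exact mul_le_mul_of_nonneg_right (sqrt_lower h0) hNp.le
        _ = Real.sqrt ((1 + θ) * (n + 1)) := by rw [hN, Real.sqrt_mul (by linarith)]
        _ ≤ _ := by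
          apply Real.sqrt_le_sqrt
          push_cast
          nlinarith
    have f5 : (θ - 3 * θ ^ 2) * K * N ≤ p * A n := by
      have g1 : (2 - θ ^ 2) * K * ((1 + θ / 2 - θ ^ 2 / 2) * N) ≤
          (2 - θ ^ 2) * K * Real.sqrt (((n + p : ℕ) : ℝ) + 1) := by
        apply mul_le_mul_of_nonneg_left f4
        apply mul_nonneg _ hK.le
        nlinarith
      have g2 : (2 - θ ^ 2) * K * ((1 + θ / 2 - θ ^ 2 / 2) * N) - 2 * K * N - (θ - 3 * θ ^ 2) * K * N
         = (θ ^ 2 * (1 - θ / 2) + θ ^ 4 / 2) * (K * N) := by ring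
      have g3 : 0 ≤ (θ ^ 2 * (1 - θ / 2) + θ ^ 4 / 2) * (K * N) := by
        have : 0 ≤ 1 - θ / 2 := by linarith
        positivity
      linarith
    have hA0 : 0 ≤ A n := by
      by_contra hneg
      push Not at hneg
      have : (0 : ℝ) ≤ p := by positivity
      have h3 : 0 ≤ (θ - 3 * θ ^ 2) * K * N := by
        have : 0 ≤ θ - 3 * θ ^ 2 := by nlinarith
        positivity
      have hp0 : (0 : ℝ) < p := lt_of_lt_of_le (by positivity) hp1
      nlinarith
    have f6 : (p : ℝ) ≤ (θ + θ ^ 2) * N ^ 2 := by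
      rw [hN2]
      rw [div_lt_iff₀ (by positivity)] at hn
      nlinarith
    have f7 : (θ - 3 * θ ^ 2) * K * N ≤ (θ + θ ^ 2) * N ^ 2 * A n :=
      f5.trans (mul_le_mul_of_nonneg_right f6 hA0)
    have f8 : (1 - 3 * θ) * K ≤ (1 + θ) * (N * A n) := by
      have : 0 < θ * N := by positivity
      apply le_of_mul_le_mul_left _ this
      nlinarith
    by_contra hcon
    push Not at hcon
    have : N * A n < (1 - 4 * θ) * K := by linarith
    have h9 : (1 + θ) * (N * A n) < (1 + θ) * ((1 - 4 * θ) * K) :=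
      mul_lt_mul_of_pos_left this (by linarith)
    nlinarith [mul_pos (mul_pos h0 h0) hK]
  rw [Metric.tendsto_atTop']
  intro ε hε
  have hθ : 0 < min (1 / 4) (ε / (8 * K)) := by positivity
  obtain ⟨n0, hn0⟩ := eventually_atTop.1 (key _ hθ (min_le_left _ _))
  refine ⟨n0, fun n hn => ?_⟩
  rw [Real.dist_eq, sub_zero, abs_of_nonneg (hnn n)]
  refine (hn0 n hn.le).trans_lt ?_
  calc 4 * min (1 / 4) (ε / (8 * K)) * K ≤ 4 * (ε / (8 * K)) * K := by gcongr; exact min_le_right _ _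
    _ = ε / 2 := by field_simp; norm_num
    _ < ε := by linarith

theorem ar_lim (r : ℕ) :
    Tendsto (fun n : ℕ => 1 - Real.sqrt ((n : ℝ) + 1) * ar r n) atTop (𝓝 0) := by
  have h := tauber (A := Ak r) (K := (r : ℝ) + 1) (by positivity) (Ak_anti r) (Ak_le r) (by
    intro a ha
    have : ∀ᶠ n : ℕ in atTop, ∀ s ∈ range (r + 1),
        a * Real.sqrt ((n : ℝ) + 1) ≤ E n (fun l => (l.rowLen s : ℝ)) := by
      rw [Filter.eventually_all_finset]
      intro s _; exact row_lower s ha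
    filter_upwards [this] with n hn
    have h1 := sum_le_sum hn
    rw [sum_const, card_range, nsmul_eq_mul] at h1
    simp only [← sum_ar] at h1
    rw [sum_comm] at h1
    simp only [← Ak_eq] at h1
    refine le_trans (le_of_eq ?_) h1
    push_cast; ring)
  have hle : ∀ s n : ℕ, Real.sqrt ((n : ℝ) + 1) * ar s n ≤ 1 := by
    intro s n
    have h1 := ar_le s n
    rw [le_div_iff₀ (sqrt_succ_pos n)] at h1
    linarith
  refine squeeze_zero (fun n => by linarith [hle r n]) (fun n => ?_) h
  rw [Ak_eq, mul_sum]
  have : ((r : ℝ) + 1) = ∑ s ∈ range (r + 1), (1 : ℝ) := by simp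
  rw [this, ← sum_sub_distrib]
  exact single_le_sum (f := fun s => 1 - Real.sqrt ((n : ℝ) + 1) * ar s n)
    (fun s _ => by linarith [hle s n]) (by simp)

end PG

namespace PG
open Finset Filter Topology

theorem rowIdx_some {k : ℕ} {l L : YoungDiagram} (h : Cov l L) (r : Fin (k + 1)) :
    rowIdx k l L = some r ↔ inRow r l L := by
  unfold rowIdx
  obtain ⟨c, hc, hL⟩ := cov_cell h
  constructor
  · intro hh
    split_ifs at hh with h1
    rw [Option.some.injEq] at hh
    rw [← hh]; exact h1.choose_spec
  · intro hh
    have h1 : ∃ r : Fin (k + 1), L.rowLen r = l.rowLen r + 1 := ⟨r, hh⟩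
    rw [dif_pos h1]
    congr 1
    apply Fin.ext
    rw [(inRow_iff hc hL _).1 hh, (inRow_iff hc hL _).1 h1.choose_spec]

noncomputable def wy (k : ℕ) (y : Option (Fin (k + 1))) (l L : YoungDiagram) : ℝ :=
  if rowIdx k l L = y then 1 else 0

theorem wy_nonneg (k : ℕ) (y : Option (Fin (k + 1))) (l L : YoungDiagram) : 0 ≤ wy k y l L := by
  unfold wy; split_ifs <;> norm_num

theorem wy_sum (k : ℕ) (l L : YoungDiagram) : ∑ y, wy k y l L = 1 := by
  unfold wy; simp

theorem wy_some {k : ℕ} {l L : YoungDiagram} (h : Cov l L) (r : Fin (k + 1)) :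
    wy k (some r) l L = ir r l L := by
  unfold wy ir
  simp only [rowIdx_some h]

noncomputable def Hy (k : ℕ) (y : Option (Fin (k + 1))) (L : YoungDiagram) : ℝ :=
  ∑ l ∈ dn L, wy k y l L * d l

theorem Hy_some (k : ℕ) (r : Fin (k + 1)) (L : YoungDiagram) : Hy k (some r) L = hr r L := by
  unfold Hy hr
  apply sum_congr rfl
  intro l hl
  rw [wy_some (mem_dn.1 hl)]

theorem Hy_sum (k : ℕ) {L : YoungDiagram} (hL : L ≠ ⊥) : ∑ y, Hy k y L = d L := by
  unfold Hy
  rw [sum_comm, d_rec hL]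
  apply sum_congr rfl
  intro l _
  rw [← sum_mul, wy_sum, one_mul]

/-- one-step error -/
noncomputable def err (k n m : ℕ) : ℝ :=
  ∑ y, ∑ L ∈ Y (m + 1), |Hy k y L * d L / ((m + 1).factorial : ℝ) -
    barRowProb n k y * (d L ^ 2 / ((m + 1).factorial : ℝ))|

theorem bar_sum (n k : ℕ) : ∑ y, barRowProb n k y = 1 := by
  rw [Fintype.sum_option]
  simp only [barRowProb, sum_const, card_univ, Fintype.card_fin, nsmul_eq_mul]
  push_cast; ring

noncomputable def er (n r m : ℕ) : ℝ :=
  ∑ L ∈ Y (m + 1), |hr r L * d L / ((m + 1).factorial : ℝ) -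
    1 / Real.sqrt n * (d L ^ 2 / ((m + 1).factorial : ℝ))|

theorem err_le (k n m : ℕ) : err k n m ≤ 2 * ∑ r : Fin (k + 1), er n r m := by
  unfold err
  rw [Fintype.sum_option]
  have h1 : ∑ r : Fin (k + 1), ∑ L ∈ Y (m + 1), |Hy k (some r) L * d L / ((m + 1).factorial : ℝ) -
    barRowProb n k (some r) * (d L ^ 2 / ((m + 1).factorial : ℝ))| = ∑ r : Fin (k + 1), er n r m := by
    apply sum_congr rfl
    intro r _
    unfold er
    simp only [Hy_some, barRowProb]
  have h2 : ∑ L ∈ Y (m + 1), |Hy k none L * d L / ((m + 1).factorial : ℝ) -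
    barRowProb n k none * (d L ^ 2 / ((m + 1).factorial : ℝ))| ≤ ∑ r : Fin (k + 1), er n r m := by
    unfold er
    rw [sum_comm]
    apply sum_le_sum
    intro L hL
    refine le_trans (le_of_eq ?_) (abs_sum_le_sum_abs _ _)
    rw [← abs_neg]
    congr 1
    have e1 := Hy_sum k (ne_bot_of_mem hL)
    rw [Fintype.sum_option] at e1
    simp only [Hy_some] at e1
    rw [sum_sub_distrib, ← sum_div, ← sum_mul]
    have e2 : Hy k none L = d L - ∑ r : Fin (k + 1), hr r L := by linarith
    rw [e2]
    simp only [barRowProb, sum_const, card_univ, Fintype.card_fin, nsmul_eq_mul]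
    push_cast
    ring
  rw [h1]
  linarith

noncomputable def gr (r m : ℕ) : ℝ := Real.sqrt (2 * (1 - Real.sqrt ((m : ℝ) + 1) * ar r m))

theorem gr_lim (r : ℕ) : Tendsto (gr r) atTop (𝓝 0) := by
  have h := ((ar_lim r).const_mul 2).sqrt
  rw [mul_zero, Real.sqrt_zero] at h
  exact h

theorem er_diag (r m : ℕ) :
    ∑ L ∈ Y (m + 1), |hr r L * d L / ((m + 1).factorial : ℝ) -
      1 / Real.sqrt ((m : ℝ) + 1) * (d L ^ 2 / ((m + 1).factorial : ℝ))| ≤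
      gr r m / Real.sqrt ((m : ℝ) + 1) := by
  have hNp := sqrt_succ_pos m
  have hN2 : Real.sqrt ((m : ℝ) + 1) ^ 2 = m + 1 := Real.sq_sqrt (by positivity)
  unfold gr
  rw [← Real.sqrt_div']
  swap; · positivity
  apply Real.le_sqrt_of_sq_le
  set N := Real.sqrt ((m : ℝ) + 1) with hN
  have hf' : (0 : ℝ) < (m + 1).factorial := by positivity
  have hf : (0 : ℝ) < m.factorial := by positivity
  have hff := fact_succ m
  set f' := ((m + 1).factorial : ℝ)
  set f := (m.factorial : ℝ)
  have e1 : ∀ L ∈ Y (m + 1), |hr r L * d L / f' - 1 / N * (d L ^ 2 / f')| =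
      (d L * |hr r L - d L / N|) / f' := by
    intro L _
    have hd := d_pos L
    have : hr r L * d L / f' - 1 / N * (d L ^ 2 / f') = (d L / f') * (hr r L - d L / N) := by ring
    rw [this, abs_mul, abs_of_pos (by positivity)]
    ring
  rw [sum_congr rfl e1, ← sum_div, div_pow, div_le_iff₀ (by positivity)]
  have h1 := sum_mul_sq_le_sq_mul_sq (Y (m + 1)) d (fun L => |hr r L - d L / N|)
  refine h1.trans ?_
  rw [sum_d_sq]
  have h2 : ∑ L ∈ Y (m + 1), |hr r L - d L / N| ^ 2 =
      ∑ L ∈ Y (m + 1), hr r L ^ 2 - 2 / N * (f' * ar r m) + f' / N ^ 2 := by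
    have : f' * ar r m = ∑ L ∈ Y (m + 1), hr r L * d L := by
      rw [ar_eq, ← sum_div]
      change f' * (_ / f') = _
      field_simp
    rw [this]
    have h4 : f' = ∑ L ∈ Y (m + 1), d L ^ 2 := (sum_d_sq (m + 1)).symm
    rw [h4, mul_sum, sum_div, ← sum_sub_distrib, ← sum_add_distrib]
    apply sum_congr rfl
    intro L _
    rw [sq_abs]
    ring
  rw [h2]
  have h3 := sum_hr_sq r m
  change f' * _ ≤ _
  have h5 : f' = N ^ 2 * f := by rw [hN2]; exact hff
  have h6 : 2 * (1 - N * ar r m) / ((m : ℝ) + 1) * f' ^ 2 =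
      f' * (f - 2 / N * (f' * ar r m) + f' / N ^ 2) := by
    rw [← hN2, h5]
    field_simp
    ring
  rw [h6]
  gcongr

theorem er_le {n m : ℕ} (hn : 0 < n) (hnm : n ≤ m) (r : ℕ) :
    er n r m ≤ (gr r m + ((m : ℝ) + 1 - n) / n) / Real.sqrt n := by
  have hNp := sqrt_succ_pos m
  have hn' : (0 : ℝ) < n := by exact_mod_cast hn
  have hsn : 0 < Real.sqrt n := Real.sqrt_pos.2 hn'
  have hle : Real.sqrt n ≤ Real.sqrt ((m : ℝ) + 1) := by
    apply Real.sqrt_le_sqrt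
    have : (n : ℝ) ≤ m := by exact_mod_cast hnm
    linarith
  have hN2 : Real.sqrt ((m : ℝ) + 1) ^ 2 = m + 1 := Real.sq_sqrt (by positivity)
  have hn2 : Real.sqrt n ^ 2 = n := Real.sq_sqrt (by positivity)
  have h1 := er_diag r m
  have hg : 0 ≤ gr r m := Real.sqrt_nonneg _
  set N := Real.sqrt ((m : ℝ) + 1)
  set s := Real.sqrt (n : ℝ)
  have h2 : er n r m ≤ gr r m / N + (1 / s - 1 / N) := by
    have e : ∑ L ∈ Y (m + 1), (1 / s - 1 / N) * (d L ^ 2 / ((m + 1).factorial : ℝ)) = 1 / s - 1 / N := by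
      rw [← mul_sum, ← sum_div, sum_d_sq, div_self (by positivity), mul_one]
    rw [← e]
    refine le_trans ?_ (add_le_add_left h1 _)
    rw [← sum_add_distrib]
    unfold er
    apply sum_le_sum
    intro L _
    have hp : 0 ≤ (1 / s - 1 / N) * (d L ^ 2 / ((m + 1).factorial : ℝ)) := by
      apply mul_nonneg _ (by positivity)
      rw [sub_nonneg]
      exact one_div_le_one_div_of_le hsn hle
    have h3 := abs_sub (hr r L * d L / ((m + 1).factorial : ℝ) -
      1 / N * (d L ^ 2 / ((m + 1).factorial : ℝ))) ((1 / s - 1 / N) * (d L ^ 2 / ((m + 1).factorial : ℝ)))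
    rw [abs_of_nonneg hp] at h3
    refine le_trans (le_of_eq ?_) h3
    congr 1
    ring
  refine h2.trans ?_
  rw [add_div]
  apply add_le_add
  · gcongr
  · rw [← hN2]
    have e : 1 / s - 1 / N = ((N - s) / N) / s := by field_simp
    rw [e]
    apply div_le_div_of_nonneg_right _ hsn.le
    rw [← hn2, div_le_div_iff₀ hNp (by positivity)]
    have h7 : 0 ≤ (N - s) * (N * N + s * (N - s)) := by
      have : 0 ≤ N - s := by linarith
      positivity
    nlinarith

theorem err_small (k : ℕ) (ℓ : ℕ → ℕ)
    (hℓ : (fun n : ℕ => (ℓ n : ℝ)) =O[Filter.atTop] fun n : ℕ => Real.sqrt n) {ε : ℝ} (hε : 0 < ε) :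
    ∀ᶠ n : ℕ in atTop, ∀ m, n ≤ m → m < n + ℓ n → err k n m ≤ ε / Real.sqrt n := by
  set η := ε / (4 * (k + 1)) with hη
  have hηp : 0 < η := by positivity
  have h1 : ∀ᶠ n : ℕ in atTop, ∀ m, n ≤ m → ∀ r : Fin (k + 1), gr r m < η := by
    have : ∀ᶠ m : ℕ in atTop, ∀ r : Fin (k + 1), gr r m < η := by
      rw [Filter.eventually_all]
      intro r
      exact (gr_lim r).eventually_lt_const hηp
    obtain ⟨n0, hn0⟩ := eventually_atTop.1 this
    filter_upwards [eventually_ge_atTop n0] with n hn m hm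
    exact hn0 m (hn.trans hm)
  obtain ⟨C, hC⟩ := hℓ.bound
  have h2 : Tendsto (fun n : ℕ => C / Real.sqrt n) atTop (𝓝 0) :=
    (Real.tendsto_sqrt_atTop.comp tendsto_natCast_atTop_atTop).const_div_atTop C
  filter_upwards [h1, hC, h2.eventually_lt_const hηp, eventually_gt_atTop 0] with n g1 g2 g3 g4 m hm1 hm2
  have hn' : (0 : ℝ) < n := by exact_mod_cast g4
  have hsn : 0 < Real.sqrt n := Real.sqrt_pos.2 hn'
  have hn2 : Real.sqrt n ^ 2 = n := Real.sq_sqrt (by positivity)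
  rw [Real.norm_of_nonneg (by positivity), Real.norm_of_nonneg hsn.le] at g2
  have g5 : ((m : ℝ) + 1 - n) / n ≤ η := by
    have : (m : ℝ) + 1 ≤ n + ℓ n := by exact_mod_cast hm2
    calc ((m : ℝ) + 1 - n) / n ≤ (C * Real.sqrt n) / n := by gcongr; linarith
      _ = C / Real.sqrt n := by
        nth_rw 2 [← hn2]
        field_simp
      _ ≤ η := g3.le
  refine (err_le k n m).trans ?_
  have h3 : ∀ r ∈ (univ : Finset (Fin (k + 1))), er n r m ≤ (2 * η) / Real.sqrt n := by
    intro r _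
    refine (er_le g4 hm1 r).trans ?_
    gcongr
    linarith [g1 m hm1 r]
  calc 2 * ∑ r : Fin (k + 1), er n r m ≤ 2 * ∑ r : Fin (k + 1), (2 * η) / Real.sqrt n := by
        gcongr with r hr
        exact h3 r hr
    _ = ε / Real.sqrt n := by
      simp only [sum_const, card_univ, Fintype.card_fin, nsmul_eq_mul]
      rw [hη]; push_cast; field_simp; norm_num

end PG

namespace PG
open Finset Filter Topology MeasureTheory

def pc (l : YoungDiagram) (σ : ℕ → YoungDiagram) : ℕ → YoungDiagram
  | 0 => l
  | i + 1 => σ i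

open Classical in
noncomputable def cnt (C : ℕ → YoungDiagram → YoungDiagram → Prop) : ℕ → YoungDiagram → ℝ
  | 0, L => if L = ⊥ then 1 else 0
  | m + 1, L => ∑ l ∈ dn L, (if C m l L then 1 else 0) * cnt C m l

instance : Countable YoungDiagram :=
  Function.Injective.countable (f := YoungDiagram.cells) (fun _ _ h => yd_ext h)

section
variable {Ω : Type*} [MeasurableSpace Ω] {P : Measure Ω} {lam : ℕ → Ω → YoungDiagram}

theorem meas2 (h : IsPlancherelGrowthProcess P lam) (i j : ℕ)
    (p : YoungDiagram → YoungDiagram → Prop) : MeasurableSet {ω | p (lam i ω) (lam j ω)} := by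
  have : {ω | p (lam i ω) (lam j ω)} = ⋃ x : YoungDiagram, ⋃ y : YoungDiagram,
      ⋃ _ : p x y, ({ω | lam i ω = x} ∩ {ω | lam j ω = y}) := by
    ext ω
    simp only [Set.mem_iUnion, Set.mem_inter_iff, Set.mem_ofPred_eq]
    constructor
    · intro hp; exact ⟨_, _, hp, rfl, rfl⟩
    · rintro ⟨x, y, hp, rfl, rfl⟩; exact hp
  rw [this]
  exact MeasurableSet.iUnion fun x => MeasurableSet.iUnion fun y => MeasurableSet.iUnion fun _ =>
    (h.2.1 i x).inter (h.2.1 j y)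

def cset (lam : ℕ → Ω → YoungDiagram) (C : ℕ → YoungDiagram → YoungDiagram → Prop) (m t : ℕ)
    (σ : ℕ → YoungDiagram) : Set Ω :=
  {ω | lam 0 ω = ⊥ ∧ (∀ i < m, Cov (lam i ω) (lam (i + 1) ω) ∧ C i (lam i ω) (lam (i + 1) ω)) ∧
    ∀ i ≤ t, lam (m + i) ω = σ i}

theorem cset_meas (h : IsPlancherelGrowthProcess P lam) (C : ℕ → YoungDiagram → YoungDiagram → Prop)
    (m t : ℕ) (σ : ℕ → YoungDiagram) : MeasurableSet (cset lam C m t σ) := by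
  have : cset lam C m t σ = {ω | lam 0 ω = ⊥} ∩
      ((⋂ i : ℕ, ⋂ _ : i < m, {ω | Cov (lam i ω) (lam (i + 1) ω) ∧ C i (lam i ω) (lam (i + 1) ω)}) ∩
      ⋂ i : ℕ, ⋂ _ : i ≤ t, {ω | lam (m + i) ω = σ i}) := by
    ext ω
    simp [cset]
  rw [this]
  refine (h.2.1 _ _).inter ((MeasurableSet.iInter fun i => MeasurableSet.iInter fun _ => ?_).inter
    (MeasurableSet.iInter fun i => MeasurableSet.iInter fun _ => h.2.1 _ _))
  exact meas2 h i (i + 1) (fun x y => Cov x y ∧ C i x y)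

theorem cset_prob (h : IsPlancherelGrowthProcess P lam) (C : ℕ → YoungDiagram → YoungDiagram → Prop)
    (m : ℕ) : ∀ (t : ℕ) (σ : ℕ → YoungDiagram), (∀ i < t, Cov (σ i) (σ (i + 1))) →
    P.real (cset lam C m t σ) = cnt C m (σ 0) * d (σ t) / ((m + t).factorial : ℝ) := by
  classical
  have := h.1
  induction m with
  | zero =>
    intro t σ hσ
    rw [cnt]
    by_cases h0 : σ 0 = ⊥
    · have e : cset lam C 0 t σ = {ω | ∀ i ≤ t, lam i ω = σ i} := by
        ext ω
        simp only [cset, Set.mem_ofPred_eq, zero_add]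
        constructor
        · rintro ⟨_, _, h3⟩; exact h3
        · intro h3
          exact ⟨by rw [h3 0 (by omega), h0], fun i hi => absurd hi (by omega), h3⟩
      rw [e, measureReal_def, h.2.2 t σ h0 hσ, if_pos h0, ENNReal.toReal_div]
      simp [d]
    · have e : cset lam C 0 t σ = ∅ := by
        ext ω
        simp only [cset, Set.mem_ofPred_eq, zero_add, Set.mem_empty_iff_false, iff_false]
        rintro ⟨h1, _, h3⟩
        apply h0
        rw [← h3 0 (by omega), h1]
      rw [e, if_neg h0]
      simp
  | succ m ih =>
    intro t σ hσ
    have e : cset lam C (m + 1) t σ = ⋃ l ∈ (dn (σ 0)).filter (fun l => C m l (σ 0)),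
        cset lam C m (t + 1) (pc l σ) := by
      ext ω
      simp only [Set.mem_iUnion, mem_filter, mem_dn, exists_prop]
      constructor
      · rintro ⟨h1, h2, h3⟩
        have h30 := h3 0 (by omega)
        rw [add_zero] at h30
        have h2m := h2 m (by omega)
        rw [h30] at h2m
        refine ⟨lam m ω, h2m, h1, fun i hi => h2 i (by omega), ?_⟩
        intro i hi
        rcases i with _ | i
        · rfl
        · rw [show m + (i + 1) = m + 1 + i by ring]; exact h3 i (by omega)
      · rintro ⟨l, hl, h1, h2, h3⟩
        have h30 : lam m ω = l := h3 0 (by omega)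
        have h31 : lam (m + 1) ω = σ 0 := h3 1 (by omega)
        refine ⟨h1, ?_, ?_⟩
        · intro i hi
          rcases Nat.lt_or_ge i m with h' | h'
          · exact h2 i h'
          · obtain rfl : i = m := by omega
            rw [h30, h31]; exact hl
        · intro i hi
          rw [show m + 1 + i = m + (i + 1) by ring]
          exact h3 (i + 1) (by omega)
    rw [e, measureReal_biUnion_finset]
    · rw [cnt, sum_mul, sum_div, sum_filter]
      apply sum_congr rfl
      intro l hl
      split_ifs with hC
      · rw [ih (t + 1) (pc l σ) (by
          intro i hi
          rcases i with _ | i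
          · exact mem_dn.1 hl
          · exact hσ i (by omega))]
        rw [show m + 1 + t = m + (t + 1) by ring, one_mul]
        rfl
      · simp
    · intro l _ l' _ hne
      rw [Function.onFun, Set.disjoint_left]
      rintro ω ⟨_, _, h3⟩ ⟨_, _, h3'⟩
      apply hne
      have a1 : lam m ω = l := h3 0 (by omega)
      have a2 : lam m ω = l' := h3' 0 (by omega)
      rw [← a1, a2]
    · intro l _; exact cset_meas h C m (t + 1) _

theorem cnt_card (C : ℕ → YoungDiagram → YoungDiagram → Prop) (m : ℕ) :
    ∀ L : YoungDiagram, L.card ≠ m → cnt C m L = 0 := by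
  induction m with
  | zero => intro L hL; rw [cnt, if_neg]; rwa [ne_eq, card_eq_zero_iff] at hL
  | succ m ih =>
    intro L hL
    rw [cnt]
    apply sum_eq_zero
    intro l hl
    rw [ih l, mul_zero]
    have := (mem_dn.1 hl).2
    omega

theorem cnt_true (C : ℕ → YoungDiagram → YoungDiagram → Prop) (n : ℕ)
    (hC : ∀ i < n, ∀ l L, C i l L) :
    ∀ m ≤ n, ∀ L : YoungDiagram, L.card = m → cnt C m L = d L := by
  intro m
  induction m with
  | zero =>
    intro _ L hL
    rw [card_eq_zero_iff] at hL
    subst hL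
    rw [cnt, if_pos rfl, d_bot]
  | succ m ih =>
    intro hm L hL
    rw [cnt, d_rec (ne_bot_of_mem (mem_Y.2 hL))]
    apply sum_congr rfl
    intro l hl
    rw [if_pos (hC m (by omega) l L), one_mul]
    apply ih (by omega)
    have := (mem_dn.1 hl).2
    omega

theorem valid_ae (h : IsPlancherelGrowthProcess P lam) (m : ℕ) :
    P.real {ω | lam 0 ω = ⊥ ∧ ∀ i < m, Cov (lam i ω) (lam (i + 1) ω)} = 1 := by
  have := h.1
  apply le_antisymm measureReal_le_one
  have hsub : (⋃ L ∈ Y m, cset lam (fun _ _ _ => True) m 0 (fun _ => L)) ⊆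
      {ω | lam 0 ω = ⊥ ∧ ∀ i < m, Cov (lam i ω) (lam (i + 1) ω)} := by
    intro ω hω
    simp only [Set.mem_iUnion] at hω
    obtain ⟨L, _, h1, h2, _⟩ := hω
    exact ⟨h1, fun i hi => (h2 i hi).1⟩
  refine le_trans (le_of_eq ?_) (measureReal_mono hsub)
  rw [measureReal_biUnion_finset]
  · rw [sum_congr rfl (g := fun L => d L ^ 2 / (m.factorial : ℝ))]
    · rw [← sum_div, sum_d_sq, div_self (by positivity)]
    · intro L hL
      rw [cset_prob h _ _ _ _ (by intro i hi; omega),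
        cnt_true _ m (fun _ _ _ _ => trivial) m le_rfl L (mem_Y.1 hL)]
      rw [add_zero]; ring
  · intro l _ l' _ hne
    rw [Function.onFun, Set.disjoint_left]
    rintro ω ⟨_, _, h3⟩ ⟨_, _, h3'⟩
    apply hne
    exact (h3 0 le_rfl).symm.trans (h3' 0 le_rfl)
  · intro L _; exact cset_meas h _ _ _ _

/-- path weights -/
noncomputable def NN (k n : ℕ) : (ℓ : ℕ) → (Fin ℓ → Option (Fin (k + 1))) → YoungDiagram → ℝ
  | 0, _, L => if L.card = n then d L else 0
  | ℓ + 1, x, L => ∑ l ∈ dn L, wy k (x (Fin.last ℓ)) l L * NN k n ℓ (fun i => x i.castSucc) l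

theorem cnt_congr {C C' : ℕ → YoungDiagram → YoungDiagram → Prop} (m : ℕ)
    (h : ∀ i < m, ∀ l L, C i l L ↔ C' i l L) (L : YoungDiagram) : cnt C m L = cnt C' m L := by
  classical
  induction m generalizing L with
  | zero => rfl
  | succ m ih =>
    rw [cnt, cnt]
    apply sum_congr rfl
    intro l _
    rw [ih (fun i hi => h i (by omega))]
    simp only [h m (by omega)]

def Cx (k n ℓ : ℕ) (x : Fin ℓ → Option (Fin (k + 1))) (m : ℕ) (l L : YoungDiagram) : Prop :=
  ∀ j : Fin ℓ, m = n + j → rowIdx k l L = x j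

theorem cnt_NN (k n ℓ : ℕ) : ∀ (x : Fin ℓ → Option (Fin (k + 1))) (L : YoungDiagram),
    cnt (Cx k n ℓ x) (n + ℓ) L = NN k n ℓ x L := by
  classical
  induction ℓ with
  | zero =>
    intro x L
    rw [NN, add_zero]
    split_ifs with h
    · exact cnt_true _ n (fun i _ l L j => j.elim0) n le_rfl L h
    · exact cnt_card _ n L h
  | succ ℓ ih =>
    intro x L
    rw [NN, ← add_assoc, cnt]
    apply sum_congr rfl
    intro l _
    congr 1
    · unfold wy
      have : Cx k n (ℓ + 1) x (n + ℓ) l L ↔ rowIdx k l L = x (Fin.last ℓ) := by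
        constructor
        · intro h; exact h (Fin.last ℓ) (by simp)
        · intro h j hj
          have : j = Fin.last ℓ := Fin.ext (by simp; omega)
          rw [this]; exact h
      simp only [this]
    · rw [← ih]
      apply cnt_congr
      intro i hi l L
      constructor
      · intro h j hj; exact h j.castSucc (by simpa using hj)
      · intro h j hj
        have hj' : (j : ℕ) < ℓ := by omega
        exact h ⟨j, hj'⟩ hj

theorem prob_NN (h : IsPlancherelGrowthProcess P lam) (k n ℓ : ℕ)
    (x : Fin ℓ → Option (Fin (k + 1))) (L : YoungDiagram) :
    (P {ω | (∀ i : Fin ℓ, rowIdx k (lam (n + i) ω) (lam (n + i + 1) ω) = x i) ∧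
      lam (n + ℓ) ω = L}).toReal = NN k n ℓ x L * d L / ((n + ℓ).factorial : ℝ) := by
  have := h.1
  have h1 := cset_prob h (Cx k n ℓ x) (n + ℓ) 0 (fun _ => L) (by intro i hi; omega)
  rw [cnt_NN, add_zero] at h1
  rw [← h1, ← measureReal_def]
  set V := {ω | lam 0 ω = ⊥ ∧ ∀ i < n + ℓ, Cov (lam i ω) (lam (i + 1) ω)} with hV
  have hae : ∀ᵐ ω ∂P, ω ∈ V := by
    have hm : MeasurableSet V := by
      have : V = {ω | lam 0 ω = ⊥} ∩ ⋂ i : ℕ, ⋂ _ : i < n + ℓ, {ω | Cov (lam i ω) (lam (i + 1) ω)} := by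
        ext ω; simp [hV]
      rw [this]
      exact (h.2.1 _ _).inter (MeasurableSet.iInter fun i => MeasurableSet.iInter fun _ =>
        meas2 h i (i + 1) Cov)
    have h2 := valid_ae h (n + ℓ)
    rw [← hV] at h2
    change V ∈ ae P
    rw [mem_ae_iff, prob_compl_eq_zero_iff hm]
    rw [measureReal_def] at h2
    rw [← ENNReal.toReal_eq_one_iff]
    exact h2
  apply measureReal_congr
  filter_upwards [hae] with ω hω
  apply propext
  change ((∀ i : Fin ℓ, _) ∧ _) ↔ (_ ∧ _ ∧ _)
  constructor
  · rintro ⟨a1, a2⟩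
    refine ⟨hω.1, fun i hi => ⟨hω.2 i hi, ?_⟩, ?_⟩
    · intro j hj; subst hj; exact a1 j
    · intro i hi
      obtain rfl : i = 0 := by omega
      exact a2
  · rintro ⟨_, a2, a3⟩
    refine ⟨fun i => (a2 (n + i) (by omega)).2 i rfl, a3 0 le_rfl⟩

end
end PG

namespace PG
open Finset Filter Topology MeasureTheory

noncomputable def TV (k n ℓ : ℕ) : ℝ :=
  ∑ x : Fin ℓ → Option (Fin (k + 1)), ∑ L ∈ Y (n + ℓ),
    |NN k n ℓ x L * d L / ((n + ℓ).factorial : ℝ) -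
      (∏ i, barRowProb n k (x i)) * (d L ^ 2 / ((n + ℓ).factorial : ℝ))|

theorem TV_zero (k n : ℕ) : TV k n 0 = 0 := by
  unfold TV
  apply sum_eq_zero
  intro x _
  apply sum_eq_zero
  intro L hL
  rw [NN, if_pos (by simpa using hL)]
  simp only [univ_eq_empty, prod_empty, one_mul, abs_eq_zero]
  ring

theorem prod_bar_sum (k n ℓ : ℕ) :
    ∑ x : Fin ℓ → Option (Fin (k + 1)), ∏ i, barRowProb n k (x i) = 1 := by
  have := Finset.prod_univ_sum (fun _ : Fin ℓ => (univ : Finset (Option (Fin (k + 1)))))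
    (fun _ y => barRowProb n k y)
  simp only [bar_sum, prod_const_one, Fintype.piFinset_univ] at this
  exact this.symm

theorem TV_succ (k n ℓ : ℕ) (hb : ∀ y, 0 ≤ barRowProb n k y) :
    TV k n (ℓ + 1) ≤ TV k n ℓ + err k n (n + ℓ) := by
  have e1 : TV k n (ℓ + 1) = ∑ x : Fin ℓ → Option (Fin (k + 1)), ∑ y : Option (Fin (k + 1)),
      ∑ L ∈ Y (n + ℓ + 1),
      |(∑ l ∈ dn L, wy k y l L * NN k n ℓ x l) * d L / ((n + ℓ + 1).factorial : ℝ) -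
      ((∏ i, barRowProb n k (x i)) * barRowProb n k y) * (d L ^ 2 / ((n + ℓ + 1).factorial : ℝ))| := by
    unfold TV
    rw [← (Fin.snocEquiv (fun _ : Fin (ℓ + 1) => Option (Fin (k + 1)))).sum_comp,
      Fintype.sum_prod_type, sum_comm]
    apply sum_congr rfl
    intro x _
    apply sum_congr rfl
    intro y _
    apply sum_congr rfl
    intro L _
    rw [NN, Fin.prod_univ_castSucc]
    simp [Fin.snocEquiv, add_assoc]
  have e2 : ∀ x : Fin ℓ → Option (Fin (k + 1)), ∑ y : Option (Fin (k + 1)),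
      ∑ L ∈ Y (n + ℓ + 1),
      |(∑ l ∈ dn L, wy k y l L * NN k n ℓ x l) * d L / ((n + ℓ + 1).factorial : ℝ) -
      ((∏ i, barRowProb n k (x i)) * barRowProb n k y) * (d L ^ 2 / ((n + ℓ + 1).factorial : ℝ))| ≤
      ∑ L ∈ Y (n + ℓ), |NN k n ℓ x L * d L / ((n + ℓ).factorial : ℝ) -
      (∏ i, barRowProb n k (x i)) * (d L ^ 2 / ((n + ℓ).factorial : ℝ))| +
      (∏ i, barRowProb n k (x i)) * err k n (n + ℓ) := by
    intro x
    have hπ : 0 ≤ ∏ i, barRowProb n k (x i) := prod_nonneg fun i _ => hb _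
    set π := ∏ i, barRowProb n k (x i)
    set m := n + ℓ with hm
    have hf : (0 : ℝ) < (m + 1).factorial := by positivity
    have t1 : ∀ y, ∀ L ∈ Y (m + 1),
        |(∑ l ∈ dn L, wy k y l L * NN k n ℓ x l) * d L / ((m + 1).factorial : ℝ) -
        (π * barRowProb n k y) * (d L ^ 2 / ((m + 1).factorial : ℝ))| ≤
        ∑ l ∈ dn L, wy k y l L * (|NN k n ℓ x l - π * d l| * (d L / ((m + 1).factorial : ℝ))) +
        π * |Hy k y L * d L / ((m + 1).factorial : ℝ) -
          barRowProb n k y * (d L ^ 2 / ((m + 1).factorial : ℝ))| := by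
      intro y L _
      have hd := d_pos L
      have s1 : (∑ l ∈ dn L, wy k y l L * NN k n ℓ x l) * d L / ((m + 1).factorial : ℝ) -
        (π * barRowProb n k y) * (d L ^ 2 / ((m + 1).factorial : ℝ)) =
        ∑ l ∈ dn L, wy k y l L * ((NN k n ℓ x l - π * d l) * (d L / ((m + 1).factorial : ℝ))) +
        π * (Hy k y L * d L / ((m + 1).factorial : ℝ) -
          barRowProb n k y * (d L ^ 2 / ((m + 1).factorial : ℝ))) := by
        have : ∑ l ∈ dn L, wy k y l L * ((NN k n ℓ x l - π * d l) * (d L / ((m + 1).factorial : ℝ))) =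
          (∑ l ∈ dn L, wy k y l L * NN k n ℓ x l) * (d L / ((m + 1).factorial : ℝ)) -
            π * (Hy k y L * (d L / ((m + 1).factorial : ℝ))) := by
          unfold Hy
          rw [sum_mul, sum_mul, mul_sum, ← sum_sub_distrib]
          apply sum_congr rfl
          intros; ring
        rw [this]; ring
      rw [s1]
      refine (abs_add_le _ _).trans ?_
      rw [abs_mul π, abs_of_nonneg hπ]
      gcongr
      refine (abs_sum_le_sum_abs _ _).trans (le_of_eq ?_)
      apply sum_congr rfl
      intro l _
      rw [abs_mul, abs_mul, abs_of_nonneg (wy_nonneg _ _ _ _), abs_of_nonneg (show 0 ≤ d L / _ by positivity)]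
    refine (sum_le_sum fun y _ => sum_le_sum (t1 y)).trans ?_
    simp only [sum_add_distrib]
    apply add_le_add
    · rw [sum_comm]
      have : ∀ L ∈ Y (m + 1), ∑ y, ∑ l ∈ dn L, wy k y l L *
          (|NN k n ℓ x l - π * d l| * (d L / ((m + 1).factorial : ℝ))) =
          ∑ l ∈ dn L, |NN k n ℓ x l - π * d l| * (d L / ((m + 1).factorial : ℝ)) := by
        intro L _
        rw [sum_comm]
        apply sum_congr rfl
        intro l _
        rw [← sum_mul, wy_sum, one_mul]
      rw [sum_congr rfl this, ← sum_swap m (fun l L => |NN k n ℓ x l - π * d l| *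
        (d L / ((m + 1).factorial : ℝ)))]
      apply sum_le_sum
      intro l hl
      rw [← mul_sum, ← sum_div, sum_up_d, mem_Y.1 hl, fact_succ]
      have hd := d_pos l
      have : NN k n ℓ x l * d l / (m.factorial : ℝ) - π * (d l ^ 2 / (m.factorial : ℝ)) =
        (NN k n ℓ x l - π * d l) * (d l / m.factorial) := by ring
      rw [this, abs_mul, abs_of_nonneg (show 0 ≤ d l / (m.factorial : ℝ) by positivity)]
      apply le_of_eq
      congr 1
      have : (m : ℝ) + 1 ≠ 0 := by positivity
      field_simp
    · unfold err
      rw [mul_sum]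
      simp only [mul_sum]
      exact le_rfl
  rw [e1]
  refine (sum_le_sum fun x _ => e2 x).trans ?_
  rw [sum_add_distrib, ← sum_mul, prod_bar_sum, one_mul]
  exact le_rfl

theorem TV_le (k n ℓ : ℕ) (hb : ∀ y, 0 ≤ barRowProb n k y) {e : ℝ}
    (he : ∀ m, n ≤ m → m < n + ℓ → err k n m ≤ e) : TV k n ℓ ≤ ℓ * e := by
  induction ℓ with
  | zero => rw [TV_zero]; simp
  | succ ℓ ih =>
    have h1 := TV_succ k n ℓ hb
    have h2 := ih (fun m a b => he m a (by omega))
    have h3 := he (n + ℓ) (by omega) (by omega)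
    push_cast
    linarith

theorem NN_card {k n ℓ : ℕ} (x : Fin ℓ → Option (Fin (k + 1))) {L : YoungDiagram}
    (h : L.card ≠ n + ℓ) : NN k n ℓ x L = 0 := by
  rw [← cnt_NN]; exact cnt_card _ _ _ h

end PG

/-- **Asymptotic independence of row growths in the Plancherel growth process.**
Fix `k ≥ 0` and a sequence `ℓ(n) = O(√n)` of nonnegative integers.  The total variation
distance between the random vector
`V⁽ⁿ⁾ = (R⁽ⁿ⁺¹⁾, …, R⁽ⁿ⁺ˡ⁾, λ⁽ⁿ⁺ˡ⁾) ∈ 𝒩^ℓ × 𝕐`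
(where `R⁽ⁿ⁺ⁱ⁺¹⁾ = rowIdx k (lam (n+i)) (lam (n+i+1))`) and the vector `V̄⁽ⁿ⁾` of
independent random variables with `R̄`-coordinates distributed according to `barRowProb n k`
and last coordinate Plancherel-distributed on `𝕐_{n+ℓ}` is `o(ℓ/√n)` as `n → ∞`.  The total
variation distance is written as half of the `ℓ¹` distance of probability mass functions,
the mass function of the independent vector `V̄⁽ⁿ⁾` being the product of its marginals. -/
theorem tv_growth_vector_indep {Ω : Type*} [MeasurableSpace Ω] (P : Measure Ω)
    (lam : ℕ → Ω → YoungDiagram) (hPGP : IsPlancherelGrowthProcess P lam) (k : ℕ)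
    (ℓ : ℕ → ℕ)
    (hℓ : (fun n : ℕ => (ℓ n : ℝ)) =O[Filter.atTop] fun n : ℕ => Real.sqrt n) :
    (fun n : ℕ => (1 / 2) *
        ∑' p : (Fin (ℓ n) → Option (Fin (k + 1))) × YoungDiagram,
          |(P {ω | (∀ i : Fin (ℓ n),
                rowIdx k (lam (n + i) ω) (lam (n + i + 1) ω) = p.1 i) ∧
                lam (n + ℓ n) ω = p.2}).toReal -
            (∏ i : Fin (ℓ n), barRowProb n k (p.1 i)) * plancherelProb (n + ℓ n) p.2|)
      =o[Filter.atTop] fun n : ℕ => (ℓ n : ℝ) / Real.sqrt n := by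
  have htv : ∀ n, ∑' p : (Fin (ℓ n) → Option (Fin (k + 1))) × YoungDiagram,
          |(P {ω | (∀ i : Fin (ℓ n),
                rowIdx k (lam (n + i) ω) (lam (n + i + 1) ω) = p.1 i) ∧
                lam (n + ℓ n) ω = p.2}).toReal -
            (∏ i : Fin (ℓ n), barRowProb n k (p.1 i)) * plancherelProb (n + ℓ n) p.2| =
      PG.TV k n (ℓ n) := by
    intro n
    simp only [PG.prob_NN hPGP]
    rw [tsum_eq_sum (s := Finset.univ ×ˢ PG.Y (n + ℓ n))]
    · rw [Finset.sum_product]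
      unfold PG.TV
      apply Finset.sum_congr rfl
      intro x _
      apply Finset.sum_congr rfl
      intro L hL
      rw [plancherelProb, if_pos (PG.mem_Y.1 hL)]
      rfl
    · rintro ⟨x, L⟩ hp
      have hL : L.card ≠ n + ℓ n := by
        intro h
        apply hp
        rw [Finset.mem_product]
        exact ⟨Finset.mem_univ _, PG.mem_Y.2 h⟩
      simp only
      rw [PG.NN_card x hL, plancherelProb, if_neg hL]
      simp
  simp only [htv]
  rw [Asymptotics.isLittleO_iff]
  intro c hc
  have hs : ∀ᶠ n : ℕ in atTop, (k : ℝ) + 1 < Real.sqrt n :=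
    (Real.tendsto_sqrt_atTop.comp tendsto_natCast_atTop_atTop).eventually_gt_atTop _
  filter_upwards [PG.err_small k ℓ hℓ hc, hs] with n h1 h2
  have hk : (0 : ℝ) < (k : ℝ) + 1 := by positivity
  have hsn : 0 < Real.sqrt n := hk.trans h2
  have hb : ∀ y, 0 ≤ barRowProb n k y := by
    intro y
    cases y with
    | none =>
      simp only [barRowProb]
      rw [sub_nonneg, div_le_one hsn]
      exact h2.le
    | some r => simp only [barRowProb]; positivity
  have h3 := PG.TV_le k n (ℓ n) hb h1
  have h4 : 0 ≤ PG.TV k n (ℓ n) :=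
    Finset.sum_nonneg fun _ _ => Finset.sum_nonneg fun _ _ => abs_nonneg _
  rw [Real.norm_of_nonneg (by positivity), Real.norm_of_nonneg (by positivity)]
  have : (ℓ n : ℝ) * (c / Real.sqrt n) = c * ((ℓ n : ℝ) / Real.sqrt n) := by ring
  linarith
end

section
/- Fix an integer K ≥ 0 and define s_n = Σ_{0 ≤ r ≤ K} ℙ(E_r^{(n)}) for n ≥ 1, where E_r^{(n)} are the row-growth events of the Plancherel growth process. Then the sequence (s_n)_{n ≥ 1} is weakly decreasing. -/
open MeasureTheory Filter

noncomputable section PGPaux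

namespace PGP

def cov (a b : YoungDiagram) : Prop := a ≤ b ∧ b.card = a.card + 1

instance : DecidableRel cov := fun _ _ => Classical.propDecidable _

instance : DecidableEq YoungDiagram := Classical.decEq _

lemma cov_iff {a b : YoungDiagram} :
    cov a b ↔ ∃ c, c ∉ a.cells ∧ insert c a.cells = b.cells := by
  have h := @Finset.exists_eq_insert_iff _ a.cells b.cells
  constructor
  · rintro ⟨h1, h2⟩
    obtain ⟨c, hc, hi⟩ := h.2 ⟨h1, h2.symm⟩
    exact ⟨c, hc, hi⟩
  · rintro ⟨c, hc, hi⟩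
    obtain ⟨h1, h2⟩ := h.1 ⟨c, hc, hi⟩
    exact ⟨h1, h2.symm⟩

lemma finite_card (n : ℕ) : {μ : YoungDiagram | μ.card = n}.Finite := by
  have hinj : Function.Injective (fun μ : YoungDiagram => μ.cells) := by
    intro a b h; exact YoungDiagram.ext h
  apply Set.Finite.of_finite_image (f := fun μ : YoungDiagram => μ.cells) _ hinj.injOn
  apply Set.Finite.subset (Finset.finite_toSet ((Finset.range n ×ˢ Finset.range n).powerset))
  rintro _ ⟨μ, hμ, rfl⟩
  simp only [Finset.coe_powerset, Set.mem_preimage, Set.mem_powerset_iff, Finset.coe_subset]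
  rintro ⟨i, j⟩ hij
  simp only [Set.mem_ofPred_eq] at hμ
  have h1 : ((Finset.range (i+1)) ×ˢ (Finset.range (j+1))) ⊆ μ.cells := by
    rintro ⟨a, b⟩ hab
    simp only [Finset.mem_product, Finset.mem_range] at hab
    exact μ.isLowerSet (show ((a, b) : ℕ × ℕ) ≤ (i, j) from ⟨by simp; omega, by simp; omega⟩) hij
  have h2 := Finset.card_le_card h1
  rw [Finset.card_product, Finset.card_range, Finset.card_range] at h2
  have h3 : (i+1)*(j+1) ≤ n := by rw [← hμ]; exact h2
  simp only [Finset.mem_product, Finset.mem_range]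
  constructor <;> nlinarith

def Y (n : ℕ) : Finset YoungDiagram := (finite_card n).toFinset

lemma mem_Y {n : ℕ} {μ : YoungDiagram} : μ ∈ Y n ↔ μ.card = n := by simp [Y]

def C (a b : YoungDiagram) : ℝ := if cov a b then 1 else 0

/-! removable rows -/
def R (ν : YoungDiagram) : Finset ℕ :=
  (Finset.range (ν.colLen 0)).filter (fun r => ν.rowLen (r+1) < ν.rowLen r)

lemma mem_R {ν : YoungDiagram} {r : ℕ} : r ∈ R ν ↔ ν.rowLen (r+1) < ν.rowLen r := by
  simp only [R, Finset.mem_filter, Finset.mem_range, and_iff_right_iff_imp]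
  intro h
  rw [← YoungDiagram.mem_iff_lt_colLen, YoungDiagram.mem_iff_lt_rowLen]
  omega

def Arows (ν : YoungDiagram) : Finset ℕ := insert 0 ((R ν).image Nat.succ)

lemma mem_A {ν : YoungDiagram} {r : ℕ} : r ∈ Arows ν ↔ (r = 0 ∨ ν.rowLen r < ν.rowLen (r-1)) := by
  simp only [Arows, Finset.mem_insert, Finset.mem_image, mem_R]
  constructor
  · rintro (h | ⟨a, h, rfl⟩)
    · exact Or.inl h
    · right; simpa using h
  · rintro (h | h)
    · exact Or.inl h
    · right
      refine ⟨r-1, ?_, ?_⟩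
      · rcases r with _ | r
        · simp at h
        · simpa using h
      · rcases r with _ | r
        · simp at h
        · simp

lemma card_A (ν : YoungDiagram) : (Arows ν).card = (R ν).card + 1 := by
  rw [Arows, Finset.card_insert_of_notMem (by simp), Finset.card_image_of_injective _ Nat.succ_injective]

lemma lower_add {ν : YoungDiagram} {r : ℕ} (h : r ∈ Arows ν) :
    IsLowerSet ((insert (r, ν.rowLen r) ν.cells : Finset (ℕ × ℕ)) : Set (ℕ × ℕ)) := by
  rintro ⟨a, b⟩ ⟨c, d⟩ ⟨h1, h2⟩ hm
  simp only [Finset.coe_insert, Set.mem_insert_iff, Prod.mk.injEq, Finset.mem_coe,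
    YoungDiagram.mem_cells, YoungDiagram.mem_iff_lt_rowLen] at hm ⊢
  simp only at h1 h2
  rw [mem_A] at h
  rcases hm with ⟨rfl, rfl⟩ | hm
  · by_cases hc : c = a
    · subst hc; omega
    · right
      rcases h with h | h
      · omega
      · have := ν.rowLen_anti c (a-1) (by omega)
        omega
  · right
    have := ν.rowLen_anti c a h1
    omega

lemma lower_rem {ν : YoungDiagram} {r : ℕ} (h : r ∈ R ν) :
    IsLowerSet ((ν.cells.erase (r, ν.rowLen r - 1) : Finset (ℕ × ℕ)) : Set (ℕ × ℕ)) := by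
  rintro ⟨a, b⟩ ⟨c, d⟩ ⟨h1, h2⟩ hm
  simp only [Finset.coe_erase, Set.mem_sdiff, Set.mem_singleton_iff, Prod.mk.injEq, Finset.mem_coe,
    YoungDiagram.mem_cells, YoungDiagram.mem_iff_lt_rowLen] at hm ⊢
  simp only at h1 h2
  rw [mem_R] at h
  obtain ⟨hm, hn⟩ := hm
  have := ν.rowLen_anti c a h1
  refine ⟨by omega, ?_⟩
  rintro ⟨rfl, rfl⟩
  by_cases hc : c = a
  · subst hc; omega
  · have := ν.rowLen_anti (c+1) a (by omega)
    omega

lemma card_up (ν : YoungDiagram) (n : ℕ) (hn : ν.card = n) :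
    ((Y (n+1)).filter (fun l => cov ν l)).card = (Arows ν).card := by
  symm
  refine Finset.card_bij (fun r hr => (⟨_, lower_add hr⟩ : YoungDiagram)) ?_ ?_ ?_
  · intro r hr
    have hc : cov ν (⟨_, lower_add hr⟩ : YoungDiagram) := by
      rw [cov_iff]
      refine ⟨(r, ν.rowLen r), ?_, rfl⟩
      rw [YoungDiagram.mem_cells, YoungDiagram.mem_iff_lt_rowLen]; omega
    rw [Finset.mem_filter, mem_Y]
    exact ⟨by rw [hc.2, hn], hc⟩
  · intro r hr s hs h
    have h' := congrArg YoungDiagram.cells h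
    simp only at h'
    have : (r, ν.rowLen r) ∈ insert (s, ν.rowLen s) ν.cells := by
      rw [← h']; exact Finset.mem_insert_self _ _
    simp only [Finset.mem_insert, Prod.mk.injEq, YoungDiagram.mem_cells,
      YoungDiagram.mem_iff_lt_rowLen] at this
    omega
  · intro l hl
    rw [Finset.mem_filter, cov_iff] at hl
    obtain ⟨_, ⟨r, j⟩, hc, hi⟩ := hl
    have hlow := l.isLowerSet
    rw [← hi] at hlow
    have hrj : ((r, j) : ℕ × ℕ) ∈ ((insert (r, j) ν.cells : Finset _) : Set (ℕ × ℕ)) := by simp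
    rw [YoungDiagram.mem_cells, YoungDiagram.mem_iff_lt_rowLen] at hc
    have hj : j = ν.rowLen r := by
      by_contra hne
      have := hlow (show ((r, ν.rowLen r) : ℕ × ℕ) ≤ (r, j) from ⟨le_rfl, by simp; omega⟩) hrj
      simp only [Finset.coe_insert, Set.mem_insert_iff, Prod.mk.injEq, Finset.mem_coe,
        YoungDiagram.mem_cells, YoungDiagram.mem_iff_lt_rowLen] at this
      omega
    subst hj
    refine ⟨r, ?_, ?_⟩
    · rw [mem_A]
      by_contra hne
      push Not at hne
      have := hlow (show ((r-1, ν.rowLen r) : ℕ × ℕ) ≤ (r, ν.rowLen r) from ⟨by simp, le_rfl⟩) hrj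
      simp only [Finset.coe_insert, Set.mem_insert_iff, Prod.mk.injEq, Finset.mem_coe,
        YoungDiagram.mem_cells, YoungDiagram.mem_iff_lt_rowLen] at this
      omega
    · exact YoungDiagram.ext hi

lemma card_down (ν : YoungDiagram) (n : ℕ) (hn : ν.card = n + 1) :
    ((Y n).filter (fun l => cov l ν)).card = (R ν).card := by
  symm
  have hmem : ∀ r ∈ R ν, (r, ν.rowLen r - 1) ∈ ν.cells := by
    intro r hr
    rw [mem_R] at hr
    rw [YoungDiagram.mem_cells, YoungDiagram.mem_iff_lt_rowLen]; omega
  refine Finset.card_bij (fun r hr => (⟨_, lower_rem hr⟩ : YoungDiagram)) ?_ ?_ ?_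
  · intro r hr
    have hc : cov (⟨_, lower_rem hr⟩ : YoungDiagram) ν := by
      rw [cov_iff]
      refine ⟨(r, ν.rowLen r - 1), by simp, ?_⟩
      exact Finset.insert_erase (hmem r hr)
    rw [Finset.mem_filter, mem_Y]
    refine ⟨?_, hc⟩
    have := hc.2
    omega
  · intro r hr s hs h
    have h' := congrArg YoungDiagram.cells h
    simp only at h'
    have : (r, ν.rowLen r - 1) ∉ ν.cells.erase (s, ν.rowLen s - 1) := by
      rw [← h']; simp
    have h2 := hmem r hr
    rw [Finset.mem_erase] at this
    by_contra hne
    exact this ⟨by simp [hne], h2⟩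
  · intro l hl
    rw [Finset.mem_filter, cov_iff] at hl
    obtain ⟨_, ⟨r, j⟩, hc, hi⟩ := hl
    have hlow := l.isLowerSet
    have hl' : l.cells = ν.cells.erase (r, j) := by rw [← hi, Finset.erase_insert hc]
    have hrj : (r, j) ∈ ν.cells := by rw [← hi]; simp
    rw [hl'] at hlow
    rw [YoungDiagram.mem_cells, YoungDiagram.mem_iff_lt_rowLen] at hrj
    have hj : j = ν.rowLen r - 1 := by
      by_contra hne
      have := hlow (show ((r, j) : ℕ × ℕ) ≤ (r, ν.rowLen r - 1) from ⟨le_rfl, by simp; omega⟩)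
        (by simp only [Finset.coe_erase, Set.mem_sdiff, Set.mem_singleton_iff, Prod.mk.injEq,
              Finset.mem_coe, YoungDiagram.mem_cells, YoungDiagram.mem_iff_lt_rowLen]
            omega)
      simp at this
    subst hj
    refine ⟨r, ?_, ?_⟩
    · rw [mem_R]
      by_contra hne
      have := hlow (show ((r, ν.rowLen r - 1) : ℕ × ℕ) ≤ (r+1, ν.rowLen r - 1) from ⟨by simp, le_rfl⟩)
        (by simp only [Finset.coe_erase, Set.mem_sdiff, Set.mem_singleton_iff, Prod.mk.injEq,
              Finset.mem_coe, YoungDiagram.mem_cells, YoungDiagram.mem_iff_lt_rowLen]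
            omega)
      simp at this
    · exact YoungDiagram.ext hl'.symm

lemma R_bot : R (⊥ : YoungDiagram) = ∅ := by
  rw [Finset.eq_empty_iff_forall_notMem]
  intro r hr
  rw [mem_R] at hr
  have : (r, 0) ∈ (⊥ : YoungDiagram) := by rw [YoungDiagram.mem_iff_lt_rowLen]; omega
  simp at this

lemma card_zero {μ : YoungDiagram} (h : μ.card = 0) : μ = ⊥ := by
  apply YoungDiagram.ext
  rw [YoungDiagram.cells_bot]
  exact Finset.card_eq_zero.1 h

lemma sum_CC (ν : YoungDiagram) (n : ℕ) (hn : ν.card = n) :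
    ∑ l ∈ Y (n+1), C ν l * C ν l = (R ν).card + 1 := by
  have := card_up ν n hn
  rw [card_A] at this
  have h2 : ∑ l ∈ Y (n+1), C ν l * C ν l = (((Y (n+1)).filter (fun l => cov ν l)).card : ℝ) := by
    rw [Finset.card_filter]
    push_cast
    apply Finset.sum_congr rfl
    intro l _
    unfold C; split_ifs <;> simp
  rw [h2, this]; push_cast; rfl

lemma sum_CC' (ν : YoungDiagram) (n : ℕ) (hn : ν.card = n + 1) :
    ∑ l ∈ Y n, C l ν * C l ν = (R ν).card := by
  have := card_down ν n hn
  have h2 : ∑ l ∈ Y n, C l ν * C l ν = (((Y n).filter (fun l => cov l ν)).card : ℝ) := by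
    rw [Finset.card_filter]
    push_cast
    apply Finset.sum_congr rfl
    intro l _
    unfold C; split_ifs <;> simp
  rw [h2, this]

lemma card_inf_sup (a b : YoungDiagram) : (a ⊔ b).card + (a ⊓ b).card = a.card + b.card := by
  simp only [YoungDiagram.card, YoungDiagram.cells_sup, YoungDiagram.cells_inf]
  exact Finset.card_union_add_card_inter _ _

lemma eq_of_le_card {a b : YoungDiagram} (h : a ≤ b) (hc : b.card ≤ a.card) : a = b :=
  YoungDiagram.ext (Finset.eq_of_subset_of_card_le h hc)

lemma card_mono {a b : YoungDiagram} (h : a ≤ b) : a.card ≤ b.card := Finset.card_le_card h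

lemma sup_of_cov {a b l : YoungDiagram} (hne : a ≠ b) (ha : cov a l) (hb : cov b l) :
    l = a ⊔ b := by
  symm
  apply eq_of_le_card (sup_le ha.1 hb.1)
  by_contra h
  have h1 := card_mono (le_sup_left : a ≤ a ⊔ b)
  have e1 := ha.2
  have e2 := hb.2
  have h2 := eq_of_le_card (le_sup_left : a ≤ a ⊔ b) (by omega)
  have h3 := eq_of_le_card (le_sup_right : b ≤ a ⊔ b) (by omega)
  exact hne (h2.trans h3.symm)

lemma inf_of_cov {a b l : YoungDiagram} (hne : a ≠ b) (ha : cov l a) (hb : cov l b) :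
    l = a ⊓ b := by
  apply eq_of_le_card (le_inf ha.1 hb.1)
  by_contra h
  have h1 := card_mono (inf_le_left : a ⊓ b ≤ a)
  have e1 := ha.2
  have e2 := hb.2
  have h2 := eq_of_le_card (inf_le_left : a ⊓ b ≤ a) (by omega)
  have h3 := eq_of_le_card (inf_le_right : a ⊓ b ≤ b) (by omega)
  exact hne (h2.symm.trans h3)

lemma DU_ne (a b : YoungDiagram) (n : ℕ) (ha : a.card = n+1) (hb : b.card = n+1) (hne : a ≠ b) :
    ∑ l ∈ Y (n+2), C a l * C b l = ∑ l ∈ Y n, C l a * C l b := by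
  have key := card_inf_sup a b
  by_cases h : (a ⊔ b).card = n + 2
  · have hi : (a ⊓ b).card = n := by omega
    rw [Finset.sum_eq_single (a ⊔ b), Finset.sum_eq_single (a ⊓ b)]
    · rw [C, C, C, C, if_pos, if_pos, if_pos, if_pos]
      · exact ⟨inf_le_right, by omega⟩
      · exact ⟨inf_le_left, by omega⟩
      · exact ⟨le_sup_right, by omega⟩
      · exact ⟨le_sup_left, by omega⟩
    · intro l _ hl
      unfold C
      split_ifs with h1 h2 <;> simp
      exact hl (inf_of_cov hne h1 h2)
    · intro h; exact absurd (mem_Y.2 hi) h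
    · intro l _ hl
      unfold C
      split_ifs with h1 h2 <;> simp
      exact hl (sup_of_cov hne h1 h2)
    · intro h'; exact absurd (mem_Y.2 h) h'
  · rw [Finset.sum_eq_zero, Finset.sum_eq_zero]
    · intro l hl
      unfold C
      split_ifs with h1 h2 <;> simp
      have := inf_of_cov hne h1 h2
      have := h1.2
      rw [mem_Y] at hl
      subst l
      omega
    · intro l hl
      unfold C
      split_ifs with h1 h2 <;> simp
      have := sup_of_cov hne h1 h2
      rw [mem_Y] at hl
      subst l
      omega

lemma DU (a b : YoungDiagram) (n : ℕ) (ha : a.card = n+1) (hb : b.card = n+1) :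
    ∑ l ∈ Y (n+2), C a l * C b l = ∑ l ∈ Y n, C l a * C l b + if a = b then 1 else 0 := by
  split_ifs with h
  · subst h
    rw [sum_CC a (n+1) ha, sum_CC' a n ha]
  · rw [DU_ne a b n ha hb h, add_zero]

def S (μ : YoungDiagram) : Set (ℕ × ℕ → ℕ) :=
  {T | (∀ c, c ∉ μ.cells → T c = 0) ∧ (∀ c ∈ μ.cells, T c < μ.card) ∧
    (∀ a ∈ μ.cells, ∀ b ∈ μ.cells, T a = T b → a = b) ∧
    (∀ a ∈ μ.cells, ∀ b ∈ μ.cells, a.1 ≤ b.1 → a.2 ≤ b.2 → a ≠ b → T a < T b)}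

def sytEquiv (μ : YoungDiagram) : {T : μ.cells → Fin μ.card //
    Function.Bijective T ∧
      ∀ a b : μ.cells, (a : ℕ × ℕ).1 ≤ (b : ℕ × ℕ).1 → (a : ℕ × ℕ).2 ≤ (b : ℕ × ℕ).2 →
        a ≠ b → T a < T b} ≃ S μ where
  toFun T := ⟨fun c => if h : c ∈ μ.cells then (T.1 ⟨c, h⟩ : ℕ) else 0, by
    refine ⟨?_, ?_, ?_, ?_⟩
    · intro c hc; simp only [dif_neg hc]
    · intro c hc; simp only [dif_pos hc]; exact (T.1 ⟨c, hc⟩).2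
    · intro a ha b hb h
      simp only [dif_pos ha, dif_pos hb] at h
      have := T.2.1.1 (Fin.ext h)
      simpa using this
    · intro a ha b hb h1 h2 hne
      simp only [dif_pos ha, dif_pos hb]
      exact T.2.2 ⟨a, ha⟩ ⟨b, hb⟩ h1 h2 (by simpa using hne)⟩
  invFun T := ⟨fun c => ⟨T.1 c.1, T.2.2.1 c.1 c.2⟩, by
    constructor
    · rw [Fintype.bijective_iff_injective_and_card]
      constructor
      · intro a b h
        have h' : T.1 a.1 = T.1 b.1 := by simpa using h
        exact Subtype.ext (T.2.2.2.1 a.1 a.2 b.1 b.2 h')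
      · simp [YoungDiagram.card]
    · intro a b h1 h2 hne
      exact T.2.2.2.2 a.1 a.2 b.1 b.2 h1 h2 (fun h => hne (Subtype.ext h))⟩
  left_inv T := by
    apply Subtype.ext
    funext c
    apply Fin.ext
    simp
  right_inv T := by
    apply Subtype.ext
    funext c
    by_cases h : c ∈ μ.cells
    · simp only [dif_pos h]
    · simp only [dif_neg h]; exact (T.2.1 c h).symm

lemma S_finite (μ : YoungDiagram) : (S μ).Finite := by
  rw [← Set.finite_coe_iff]
  exact Finite.of_equiv _ (sytEquiv μ)

def Sf (μ : YoungDiagram) : Finset (ℕ × ℕ → ℕ) := (S_finite μ).toFinset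

lemma mem_Sf {μ : YoungDiagram} {T : ℕ × ℕ → ℕ} : T ∈ Sf μ ↔ T ∈ S μ := by simp [Sf]

lemma syt_eq (μ : YoungDiagram) : sytCount μ = (Sf μ).card := by
  unfold sytCount
  rw [Nat.card_congr (sytEquiv μ), Nat.card_coe_set_eq, Sf, Set.ncard_eq_toFinset_card _ (S_finite μ)]

def F (l ν : YoungDiagram) (n : ℕ) (T : ℕ × ℕ → ℕ) : ℕ × ℕ → ℕ :=
  fun x => if x ∈ l.cells ∧ x ∉ ν.cells then n else T x

instance : DecidableEq (ℕ × ℕ → ℕ) := Classical.decEq _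

lemma Sf_eq (l : YoungDiagram) (n : ℕ) (hl : l.card = n + 1) :
    Sf l = ((Y n).filter (fun ν => cov ν l)).biUnion (fun ν => (Sf ν).image (F l ν n)) := by
  ext T
  simp only [Finset.mem_biUnion, Finset.mem_filter, Finset.mem_image, mem_Sf, mem_Y]
  constructor
  · rintro ⟨h0, hlt, hinj, hmono⟩
    have himg : l.cells.image T = Finset.range (n+1) := by
      apply Finset.eq_of_subset_of_card_le
      · intro x hx
        obtain ⟨c, hc, rfl⟩ := Finset.mem_image.1 hx
        rw [Finset.mem_range, ← hl]; exact hlt c hc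
      · rw [Finset.card_image_of_injOn (fun a ha b hb h => hinj a ha b hb h), Finset.card_range]
        exact hl.ge
    obtain ⟨c, hc, hcn⟩ := Finset.mem_image.1 (by rw [himg]; simp : n ∈ l.cells.image T)
    have hlow : IsLowerSet ((l.cells.erase c : Finset (ℕ × ℕ)) : Set (ℕ × ℕ)) := by
      intro a b hba ha
      rw [Finset.mem_coe, Finset.mem_erase] at ha ⊢
      refine ⟨?_, l.isLowerSet hba ha.2⟩
      rintro rfl
      have h1 := hmono b hc a ha.2 hba.1 hba.2 (Ne.symm ha.1)
      have h2 := hlt a ha.2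
      omega
    have hcov : cov ⟨_, hlow⟩ l := cov_iff.2 ⟨c, by simp, Finset.insert_erase hc⟩
    have hcard : (⟨_, hlow⟩ : YoungDiagram).card = n := by have := hcov.2; omega
    refine ⟨⟨_, hlow⟩, ⟨hcard, hcov⟩, fun x => if x = c then 0 else T x, ⟨?_, ?_, ?_, ?_⟩, ?_⟩
    · intro x hx
      simp only [Finset.mem_erase, not_and] at hx
      by_cases hxc : x = c
      · simp [hxc]
      · simp only [if_neg hxc]; exact h0 x (hx hxc)
    · intro x hx
      rw [hcard]
      simp only [Finset.mem_erase] at hx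
      simp only [if_neg hx.1]
      have h1 := hlt x hx.2
      have h2 : T x ≠ n := fun h => hx.1 (hinj x hx.2 c hc (h.trans hcn.symm))
      omega
    · intro a ha b hb
      simp only [Finset.mem_erase] at ha hb
      simp only [if_neg ha.1, if_neg hb.1]
      exact hinj a ha.2 b hb.2
    · intro a ha b hb
      simp only [Finset.mem_erase] at ha hb
      simp only [if_neg ha.1, if_neg hb.1]
      exact hmono a ha.2 b hb.2
    · funext x
      simp only [F, Finset.mem_erase]
      by_cases hxc : x = c
      · subst hxc; simp [hc, hcn]
      · by_cases hx : x ∈ l.cells <;> simp [hxc]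
  · rintro ⟨ν, ⟨hν, hcov⟩, T', ⟨h0, hlt, hinj, hmono⟩, rfl⟩
    obtain ⟨c, hc, hi⟩ := cov_iff.1 hcov
    have hF : ∀ x, F l ν n T' x = if x = c then n else T' x := by
      intro x
      simp only [F, ← hi, Finset.mem_insert]
      by_cases hxc : x = c
      · subst hxc; simp [hc]
      · by_cases hx : x ∈ ν.cells <;> simp [hxc]
    rw [hν] at hlt
    refine ⟨?_, ?_, ?_, ?_⟩
    · intro x hx
      rw [← hi, Finset.mem_insert, not_or] at hx
      rw [hF, if_neg hx.1, h0 x hx.2]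
    · intro x hx
      rw [← hi, Finset.mem_insert] at hx
      rw [hF, hl]
      split_ifs with h
      · omega
      · have := hlt x (hx.resolve_left h); omega
    · intro a ha b hb h
      rw [← hi, Finset.mem_insert] at ha hb
      rw [hF, hF] at h
      split_ifs at h with h1 h2 h2
      · rw [h1, h2]
      · have := hlt b (hb.resolve_left h2); omega
      · have := hlt a (ha.resolve_left h1); omega
      · exact hinj a (ha.resolve_left h1) b (hb.resolve_left h2) h
    · intro a ha b hb h1 h2 hne
      rw [← hi, Finset.mem_insert] at ha hb
      rw [hF, hF]
      split_ifs with ha1 hb1 hb1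
      · exact absurd (ha1.trans hb1.symm) hne
      · exfalso
        subst ha1
        exact hc (ν.isLowerSet (show a ≤ b from ⟨h1, h2⟩) (hb.resolve_left hb1))
      · exact hlt a (ha.resolve_left ha1)
      · exact hmono a (ha.resolve_left ha1) b (hb.resolve_left hb1) h1 h2 hne

lemma F_iff {l ν : YoungDiagram} {n : ℕ} (hν : ν.card = n) {T : ℕ × ℕ → ℕ} (hT : T ∈ S ν)
    (x : ℕ × ℕ) (hx : x ∈ l.cells) : x ∈ ν.cells ↔ F l ν n T x ≠ n := by
  unfold F
  by_cases h : x ∈ ν.cells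
  · have := hT.2.1 x h
    simp [h]; omega
  · simp [h, hx]

lemma syt_rec (l : YoungDiagram) (n : ℕ) (hl : l.card = n + 1) :
    sytCount l = ∑ ν ∈ (Y n).filter (fun ν => cov ν l), sytCount ν := by
  rw [syt_eq, Sf_eq l n hl, Finset.card_biUnion]
  · apply Finset.sum_congr rfl
    intro ν hν
    rw [syt_eq, Finset.card_image_of_injOn]
    intro T hT T' hT' h
    rw [Finset.mem_coe, mem_Sf] at hT hT'
    funext x
    by_cases hx : x ∈ ν.cells
    · have := congrFun h x
      simpa [F, hx] using this
    · rw [hT.1 x hx, hT'.1 x hx]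
  · intro ν hν ν' hν' hne
    rw [Function.onFun, Finset.disjoint_left]
    intro T hT hT'
    obtain ⟨U, hU, rfl⟩ := Finset.mem_image.1 hT
    obtain ⟨U', hU', he⟩ := Finset.mem_image.1 hT'
    rw [mem_Sf] at hU hU'
    rw [Finset.mem_coe, Finset.mem_filter, mem_Y] at hν hν'
    apply hne
    apply YoungDiagram.ext
    ext x
    constructor
    · intro h
      have hx := hν.2.1 h
      rw [F_iff hν'.1 hU' x hx, he]
      exact (F_iff hν.1 hU x hx).1 h
    · intro h
      have hx := hν'.2.1 h
      rw [F_iff hν.1 hU x hx, ← he]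
      exact (F_iff hν'.1 hU' x hx).1 h

def f (μ : YoungDiagram) : ℝ := sytCount μ

lemma f_nonneg (μ : YoungDiagram) : 0 ≤ f μ := Nat.cast_nonneg _

lemma f_rec (l : YoungDiagram) (n : ℕ) (hl : l.card = n + 1) :
    f l = ∑ ν ∈ Y n, C ν l * f ν := by
  unfold f
  rw [syt_rec l n hl, Finset.sum_filter]
  push_cast
  apply Finset.sum_congr rfl
  intro ν _
  unfold C; split_ifs <;> simp

lemma f_bot : sytCount ⊥ = 1 := by
  rw [syt_eq, Finset.card_eq_one]
  refine ⟨fun _ => 0, ?_⟩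
  ext T
  rw [mem_Sf, Finset.mem_singleton]
  constructor
  · intro h; funext c; exact h.1 c (by simp)
  · rintro rfl; refine ⟨?_, ?_, ?_, ?_⟩ <;> simp

lemma up_sum (n : ℕ) : ∀ ν ∈ Y n, ∑ l ∈ Y (n+1), C ν l * f l = (n+1) * f ν := by
  induction n with
  | zero =>
    intro ν hν
    rw [mem_Y] at hν
    have hb := card_zero hν
    subst hb
    have hY : Y 0 = {⊥} := by
      ext μ; rw [mem_Y, Finset.mem_singleton]
      exact ⟨card_zero, fun h => by rw [h]; exact hν⟩
    have h := sum_CC ⊥ 0 hν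
    rw [R_bot] at h
    have : ∑ l ∈ Y (0+1), C ⊥ l * f l = (∑ l ∈ Y (0+1), C ⊥ l * C ⊥ l) * f ⊥ := by
      rw [Finset.sum_mul]
      apply Finset.sum_congr rfl
      intro l hl
      rw [f_rec l 0 (mem_Y.1 hl), hY, Finset.sum_singleton]; ring
    rw [this, h]; simp
  | succ n ih =>
    intro ν hν
    have h1 : ∑ l ∈ Y (n+1+1), C ν l * f l
        = ∑ κ ∈ Y (n+1), (∑ l ∈ Y (n+2), C ν l * C κ l) * f κ := by
      have : ∀ l ∈ Y (n+1+1), C ν l * f l = ∑ κ ∈ Y (n+1), C ν l * C κ l * f κ := by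
        intro l hl
        rw [f_rec l (n+1) (mem_Y.1 hl), Finset.mul_sum]
        apply Finset.sum_congr rfl
        intros; ring
      rw [Finset.sum_congr rfl this, Finset.sum_comm]
      apply Finset.sum_congr rfl
      intros; rw [Finset.sum_mul]
    have h2 : ∀ κ ∈ Y (n+1), (∑ l ∈ Y (n+2), C ν l * C κ l) * f κ
        = ∑ m ∈ Y n, C m ν * (C m κ * f κ) + (if ν = κ then f κ else 0) := by
      intro κ hκ
      rw [DU ν κ n (mem_Y.1 hν) (mem_Y.1 hκ), add_mul, Finset.sum_mul]
      congr 1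
      · apply Finset.sum_congr rfl; intros; ring
      · split_ifs <;> simp
    rw [h1, Finset.sum_congr rfl h2, Finset.sum_add_distrib, Finset.sum_comm,
      Finset.sum_ite_eq, if_pos hν]
    have h3 : ∀ m ∈ Y n, ∑ κ ∈ Y (n+1), C m ν * (C m κ * f κ) = (n+1) * (C m ν * f m) := by
      intro m hm
      rw [← Finset.mul_sum, ih m hm]; ring
    rw [Finset.sum_congr rfl h3, ← Finset.mul_sum, ← f_rec ν n (mem_Y.1 hν)]
    push_cast; ring

lemma sum_sq (n : ℕ) : ∑ ν ∈ Y n, f ν * f ν = (n.factorial : ℝ) := by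
  induction n with
  | zero =>
    have hb : (⊥ : YoungDiagram).card = 0 := by simp [YoungDiagram.card]
    have hY : Y 0 = {⊥} := by
      ext μ; rw [mem_Y, Finset.mem_singleton]
      exact ⟨card_zero, fun h => by rw [h]; exact hb⟩
    rw [hY, Finset.sum_singleton]; simp [f, f_bot]
  | succ n ih =>
    have : ∀ l ∈ Y (n+1), f l * f l = ∑ ν ∈ Y n, f ν * (C ν l * f l) := by
      intro l hl
      nth_rw 1 [f_rec l n (mem_Y.1 hl)]
      rw [Finset.sum_mul]
      apply Finset.sum_congr rfl; intros; ring
    rw [Finset.sum_congr rfl this, Finset.sum_comm]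
    have h3 : ∀ ν ∈ Y n, ∑ l ∈ Y (n+1), f ν * (C ν l * f l) = (n+1) * (f ν * f ν) := by
      intro m hm
      rw [← Finset.mul_sum, up_sum n m hm]; ring
    rw [Finset.sum_congr rfl h3, ← Finset.mul_sum, ih, Nat.factorial_succ]
    push_cast; ring

def rho (K : ℕ) (l : YoungDiagram) : ℝ := ((l.cells.filter (fun c => c.1 ≤ K)).card : ℝ)

lemma rho_insert {K : ℕ} {ν l : YoungDiagram} {c : ℕ × ℕ} (hc : c ∉ ν.cells)
    (hi : insert c ν.cells = l.cells) : rho K l = rho K ν + if c.1 ≤ K then 1 else 0 := by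
  unfold rho
  rw [← hi, Finset.filter_insert]
  split_ifs with h
  · rw [Finset.card_insert_of_notMem (by simp [hc])]; push_cast; ring
  · simp

lemma rowLen_insert {r : ℕ} {ν l : YoungDiagram} {c : ℕ × ℕ} (hc : c ∉ ν.cells)
    (hi : insert c ν.cells = l.cells) : l.rowLen r = ν.rowLen r + if c.1 = r then 1 else 0 := by
  rw [YoungDiagram.rowLen_eq_card, YoungDiagram.rowLen_eq_card, YoungDiagram.row,
    YoungDiagram.row, ← hi, Finset.filter_insert]
  split_ifs with h
  · rw [Finset.card_insert_of_notMem (by simp [hc])]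
  · simp

lemma sum_ind {K : ℕ} {ν l : YoungDiagram} (h : cov ν l) :
    ∑ r ∈ Finset.range (K+1), (if l.rowLen r = ν.rowLen r + 1 then (1:ℝ) else 0)
      = rho K l - rho K ν := by
  obtain ⟨c, hc, hi⟩ := cov_iff.1 h
  rw [rho_insert hc hi]
  have : ∀ r ∈ Finset.range (K+1), (if l.rowLen r = ν.rowLen r + 1 then (1:ℝ) else 0)
      = if c.1 = r then 1 else 0 := by
    intro r _
    rw [rowLen_insert hc hi]
    by_cases h : c.1 = r <;> simp [h]
  rw [Finset.sum_congr rfl this, Finset.sum_ite_eq]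
  simp [Nat.lt_succ_iff]

lemma key (K n : ℕ) (κ l : YoungDiagram) (hκ : κ.card = n) :
    ∑ ν ∈ Y (n+1), C κ ν * C ν l * (rho K l + rho K κ - 2 * rho K ν) ≤ 0 := by
  by_cases hbad : ∃ ν, cov κ ν ∧ cov ν l ∧ 0 < rho K l + rho K κ - 2 * rho K ν
  · obtain ⟨ν, h1, h2, h3⟩ := hbad
    obtain ⟨c, hc, hci⟩ := cov_iff.1 h1
    obtain ⟨d, hd, hdi⟩ := cov_iff.1 h2
    have e1 := rho_insert (K := K) hc hci
    have e2 := rho_insert (K := K) hd hdi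
    have hdK : d.1 ≤ K := by
      by_contra h
      rw [if_neg h] at e2
      split_ifs at e1 <;> linarith
    have hcK : ¬ c.1 ≤ K := by
      intro h
      rw [if_pos h] at e1
      rw [if_pos hdK] at e2
      linarith
    rw [if_pos hdK] at e2
    rw [if_neg hcK] at e1
    rw [← hci, Finset.mem_insert, not_or] at hd
    have hlow : IsLowerSet ((insert d κ.cells : Finset (ℕ × ℕ)) : Set (ℕ × ℕ)) := by
      intro a b hba ha
      rw [Finset.mem_coe, Finset.mem_insert] at ha ⊢
      rcases ha with rfl | ha
      · have hl : b ∈ l.cells := l.isLowerSet hba (by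
          rw [Finset.mem_coe, ← hdi]; simp)
        rw [← hdi, Finset.mem_insert, ← hci, Finset.mem_insert] at hl
        rcases hl with h | rfl | h
        · exact Or.inl h
        · exact absurd (hba.1.trans hdK) hcK
        · exact Or.inr h
      · exact Or.inr (κ.isLowerSet hba ha)
    set ν' : YoungDiagram := ⟨_, hlow⟩ with hν'
    have g1 : cov κ ν' := cov_iff.2 ⟨d, hd.2, rfl⟩
    have g2 : cov ν' l := by
      refine cov_iff.2 ⟨c, ?_, ?_⟩
      · simp only [hν', Finset.mem_insert, not_or]
        exact ⟨Ne.symm hd.1, hc⟩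
      · rw [← hdi, ← hci, hν']; exact Finset.insert_comm _ _ _
    have e3 := rho_insert (K := K) (l := ν') hd.2 rfl
    rw [if_pos hdK] at e3
    have hne : ν ≠ ν' := by
      rintro h
      rw [← h] at e3
      linarith
    have hsub : ({ν, ν'} : Finset YoungDiagram) ⊆ Y (n+1) := by
      intro x hx
      rw [Finset.mem_insert, Finset.mem_singleton] at hx
      rw [mem_Y]
      rcases hx with rfl | rfl
      · rw [h1.2, hκ]
      · rw [g1.2, hκ]
    rw [← Finset.sum_subset hsub, Finset.sum_pair hne]
    · simp only [C, if_pos h1, if_pos h2, if_pos g1, if_pos g2]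
      linarith
    · intro x _ hx
      rw [Finset.mem_insert, Finset.mem_singleton, not_or] at hx
      unfold C
      split_ifs with k1 k2 <;> simp
      exfalso
      obtain ⟨e, he, hei⟩ := cov_iff.1 k1
      have hel : e ∈ l.cells := k2.1 (show e ∈ x.cells by rw [← hei]; simp)
      rw [← hdi, Finset.mem_insert, ← hci, Finset.mem_insert] at hel
      rcases hel with rfl | rfl | h
      · exact hx.2 (YoungDiagram.ext hei.symm)
      · exact hx.1 (YoungDiagram.ext (hei.symm.trans hci))
      · exact he h
  · push Not at hbad
    apply Finset.sum_nonpos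
    intro ν _
    unfold C
    split_ifs with h1 h2 <;> simp
    have := hbad ν h1 h2
    linarith

def s (K n : ℕ) : ℝ :=
  (∑ ν ∈ Y n, ∑ l ∈ Y (n+1), C ν l * (rho K l - rho K ν) * (f ν * f l)) / ((n+1).factorial : ℝ)

lemma key2 (K n : ℕ) (l : YoungDiagram) :
    ∑ ν ∈ Y (n+1), C ν l * (rho K l - rho K ν) * f ν ≤
    ∑ ν ∈ Y (n+1), C ν l * ∑ κ ∈ Y n, C κ ν * (rho K ν - rho K κ) * f κ := by
  rw [← sub_nonpos, ← Finset.sum_sub_distrib]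
  have : ∀ ν ∈ Y (n+1), C ν l * (rho K l - rho K ν) * f ν
      - C ν l * ∑ κ ∈ Y n, C κ ν * (rho K ν - rho K κ) * f κ
      = ∑ κ ∈ Y n, C κ ν * C ν l * (rho K l + rho K κ - 2 * rho K ν) * f κ := by
    intro ν hν
    rw [f_rec ν n (mem_Y.1 hν), Finset.mul_sum, Finset.mul_sum, ← Finset.sum_sub_distrib]
    apply Finset.sum_congr rfl; intros; ring
  rw [Finset.sum_congr rfl this, Finset.sum_comm]
  apply Finset.sum_nonpos
  intro κ hκ
  rw [← Finset.sum_mul]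
  exact mul_nonpos_of_nonpos_of_nonneg (key K n κ l (mem_Y.1 hκ)) (f_nonneg _)

lemma s_anti (K n : ℕ) : s K (n+1) ≤ s K n := by
  have h1 : ∑ ν ∈ Y (n+1), ∑ l ∈ Y (n+1+1), C ν l * (rho K l - rho K ν) * (f ν * f l)
      ≤ (n+2) * ∑ ν ∈ Y n, ∑ l ∈ Y (n+1), C ν l * (rho K l - rho K ν) * (f ν * f l) := by
    calc _ = ∑ l ∈ Y (n+1+1), f l * ∑ ν ∈ Y (n+1), C ν l * (rho K l - rho K ν) * f ν := by
          rw [Finset.sum_comm]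
          apply Finset.sum_congr rfl; intros
          rw [Finset.mul_sum]
          apply Finset.sum_congr rfl; intros; ring
      _ ≤ ∑ l ∈ Y (n+1+1), f l * ∑ ν ∈ Y (n+1), C ν l * ∑ κ ∈ Y n, C κ ν * (rho K ν - rho K κ) * f κ := by
          apply Finset.sum_le_sum
          intro l _
          exact mul_le_mul_of_nonneg_left (key2 K n l) (f_nonneg _)
      _ = ∑ ν ∈ Y (n+1), (∑ l ∈ Y (n+1+1), C ν l * f l) * ∑ κ ∈ Y n, C κ ν * (rho K ν - rho K κ) * f κ := by
          simp_rw [Finset.mul_sum (Y (n+1))]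
          rw [Finset.sum_comm]
          apply Finset.sum_congr rfl; intros
          rw [Finset.sum_mul]
          apply Finset.sum_congr rfl; intros; ring
      _ = ∑ ν ∈ Y (n+1), (n+2) * ∑ κ ∈ Y n, C κ ν * (rho K ν - rho K κ) * (f κ * f ν) := by
          apply Finset.sum_congr rfl
          intro ν hν
          rw [up_sum (n+1) ν hν, Finset.mul_sum, Finset.mul_sum]
          apply Finset.sum_congr rfl; intros; push_cast; ring
      _ = _ := by rw [← Finset.mul_sum, Finset.sum_comm]
  unfold s
  rw [Nat.factorial_succ (n+1)]
  have hpos : (0:ℝ) < ((n+1).factorial : ℝ) := by exact_mod_cast Nat.factorial_pos _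
  rw [div_le_div_iff₀ (by positivity) hpos]
  push_cast
  have := mul_le_mul_of_nonneg_right h1 hpos.le
  refine this.trans (le_of_eq ?_)
  push_cast
  ring

section meas
variable {Ω : Type*} [MeasurableSpace Ω] {P : Measure Ω} {lam : ℕ → Ω → YoungDiagram}

def Ev (lam : ℕ → Ω → YoungDiagram) (k m : ℕ) (path : ℕ → YoungDiagram) : Set Ω :=
  {ω | lam 0 ω = ⊥ ∧ (∀ i, i < k → cov (lam i ω) (lam (i+1) ω)) ∧
    ∀ i, k ≤ i → i ≤ m → lam i ω = path i}

lemma Ev_succ (k m : ℕ) (hkm : k + 1 ≤ m) (path : ℕ → YoungDiagram) :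
    Ev lam (k+1) m path = ⋃ ν ∈ (Y k).filter (fun ν => cov ν (path (k+1))),
      Ev lam k m (Function.update path k ν) := by
  ext ω
  simp only [Set.mem_iUnion, Finset.mem_filter, mem_Y, exists_prop]
  constructor
  · rintro ⟨h0, hc, hp⟩
    have hcard : ∀ i, i ≤ k → (lam i ω).card = i := by
      intro i
      induction i with
      | zero => intro _; rw [h0]; simp [YoungDiagram.card]
      | succ i ih =>
        intro hi
        rw [(hc i (by omega)).2, ih (by omega)]
    refine ⟨lam k ω, ⟨hcard k le_rfl, ?_⟩, h0, fun i hi => hc i (by omega), ?_⟩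
    · rw [← hp (k+1) le_rfl hkm]; exact hc k (by omega)
    · intro i h1 h2
      by_cases h : i = k
      · subst h; simp
      · rw [Function.update_of_ne h]; exact hp i (by omega) h2
  · rintro ⟨ν, ⟨hν, hcov⟩, h0, hc, hp⟩
    have hp' : ∀ i, k+1 ≤ i → i ≤ m → lam i ω = path i := by
      intro i h1 h2
      rw [hp i (by omega) h2, Function.update_of_ne (by omega)]
    refine ⟨h0, ?_, hp'⟩
    intro i hi
    by_cases h : i = k
    · subst h
      rw [hp i le_rfl (by omega), hp' (i+1) le_rfl hkm, Function.update_self]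
      exact hcov
    · exact hc i (by omega)

lemma Ev_prob (hP : IsPlancherelGrowthProcess P lam) (m : ℕ) (k : ℕ) : ∀ (path : ℕ → YoungDiagram),
    k ≤ m → (path k).card = k → (∀ i, k ≤ i → i < m → cov (path i) (path (i+1))) →
    MeasurableSet (Ev lam k m path) ∧
      P.real (Ev lam k m path) = f (path k) * f (path m) / (m.factorial : ℝ) := by
  obtain ⟨hprob, hmeas, hpath⟩ := hP
  induction k with
  | zero =>
    intro path _ h0 hcov
    have hb := card_zero h0
    have hE : Ev lam 0 m path = {ω | ∀ i ≤ m, lam i ω = path i} := by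
      ext ω
      constructor
      · rintro ⟨_, _, h⟩ i hi; exact h i (Nat.zero_le _) hi
      · intro h
        refine ⟨by rw [h 0 (Nat.zero_le _), hb], fun i hi => absurd hi (by omega), fun i _ hi => h i hi⟩
    rw [hE]
    constructor
    · have : {ω | ∀ i ≤ m, lam i ω = path i} = ⋂ i ∈ Finset.range (m+1), {ω | lam i ω = path i} := by
        ext ω; simp [Nat.lt_succ_iff]
      rw [this]
      exact Finset.measurableSet_biInter _ (fun i _ => hmeas i _)
    · rw [Measure.real, hpath m path hb (fun i hi => hcov i (Nat.zero_le _) hi), hb]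
      simp [f, f_bot]
  | succ k ih =>
    intro path hkm hc hcov
    rw [Ev_succ k m hkm path]
    have hih : ∀ ν ∈ (Y k).filter (fun ν => cov ν (path (k+1))),
        MeasurableSet (Ev lam k m (Function.update path k ν)) ∧
        P.real (Ev lam k m (Function.update path k ν)) = f ν * f (path m) / (m.factorial : ℝ) := by
      intro ν hν
      rw [Finset.mem_filter, mem_Y] at hν
      have := ih (Function.update path k ν) (by omega) (by simpa using hν.1) (by
        intro i h1 h2
        rw [Function.update_of_ne (by omega : i + 1 ≠ k)]
        by_cases h : i = k
        · subst h; simpa using hν.2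
        · rw [Function.update_of_ne h]; exact hcov i (by omega) h2)
      rwa [Function.update_self, Function.update_of_ne (by omega : m ≠ k)] at this
    refine ⟨Finset.measurableSet_biUnion _ (fun ν hν => (hih ν hν).1), ?_⟩
    rw [measureReal_biUnion_finset _ (fun ν hν => (hih ν hν).1)]
    · rw [Finset.sum_congr rfl (fun ν hν => (hih ν hν).2), f_rec (path (k+1)) k hc,
        Finset.sum_filter, Finset.sum_mul, Finset.sum_div]
      apply Finset.sum_congr rfl
      intro ν _
      unfold C; split_ifs <;> simp
    · intro ν _ ν' _ hne
      rw [Function.onFun, Set.disjoint_left]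
      rintro ω ⟨_, _, h⟩ ⟨_, _, h'⟩
      have e1 := h k le_rfl (by omega)
      have e2 := h' k le_rfl (by omega)
      rw [Function.update_self] at e1 e2
      exact hne (e1.symm.trans e2)

def Bv (lam : ℕ → Ω → YoungDiagram) (n : ℕ) (p : YoungDiagram × YoungDiagram) : Set Ω :=
  Ev lam n (n+1) (fun i => if i = n then p.1 else p.2)

def Pairs (n : ℕ) : Finset (YoungDiagram × YoungDiagram) :=
  (Y n ×ˢ Y (n+1)).filter (fun p => cov p.1 p.2)

lemma Bv_mem {n : ℕ} {p : YoungDiagram × YoungDiagram} {ω : Ω} (h : ω ∈ Bv lam n p) :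
    lam n ω = p.1 ∧ lam (n+1) ω = p.2 := by
  obtain ⟨_, _, h⟩ := h
  have h1 := h n le_rfl (by omega)
  have h2 := h (n+1) (by omega) le_rfl
  simp at h1 h2
  exact ⟨h1, h2⟩

lemma Bv_prob (hP : IsPlancherelGrowthProcess P lam) (n : ℕ) :
    ∀ p ∈ Pairs n, MeasurableSet (Bv lam n p) ∧
      P.real (Bv lam n p) = f p.1 * f p.2 / ((n+1).factorial : ℝ) := by
  intro p hp
  rw [Pairs, Finset.mem_filter, Finset.mem_product, mem_Y] at hp
  have := Ev_prob hP (n+1) n (fun i => if i = n then p.1 else p.2) (by omega)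
    (by simpa using hp.1.1) (by
      intro i h1 h2
      have : i = n := by omega
      subst this
      simpa using hp.2)
  simpa [Bv] using this

lemma Bv_disj (n : ℕ) (A : Set (YoungDiagram × YoungDiagram)) : A.PairwiseDisjoint (Bv lam n) := by
  intro p _ q _ hne
  rw [Function.onFun, Set.disjoint_left]
  intro ω h h'
  have e1 := Bv_mem h
  have e2 := Bv_mem h'
  exact hne (Prod.ext (e1.1.symm.trans e2.1) (e1.2.symm.trans e2.2))

lemma sum_pairs (n : ℕ) (g : YoungDiagram → YoungDiagram → ℝ) :
    ∑ p ∈ Pairs n, g p.1 p.2 = ∑ ν ∈ Y n, ∑ l ∈ Y (n+1), C ν l * g ν l := by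
  rw [Pairs, Finset.sum_filter, Finset.sum_product]
  apply Finset.sum_congr rfl; intros
  apply Finset.sum_congr rfl; intros
  unfold C; split_ifs <;> simp

lemma total (hP : IsPlancherelGrowthProcess P lam) (n : ℕ) :
    P.real (⋃ p ∈ Pairs n, Bv lam n p) = 1 := by
  have := hP.1
  rw [measureReal_biUnion_finset (Bv_disj n _) (fun p hp => (Bv_prob hP n p hp).1),
    Finset.sum_congr rfl (fun p hp => (Bv_prob hP n p hp).2),
    sum_pairs n (fun ν l => f ν * f l / ((n+1).factorial : ℝ))]
  have h : ∀ ν ∈ Y n, ∑ l ∈ Y (n+1), C ν l * (f ν * f l / ((n+1).factorial : ℝ))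
      = (f ν * f ν) / (n.factorial : ℝ) := by
    intro ν hν
    have h1 : ∑ l ∈ Y (n+1), C ν l * (f ν * f l / ((n+1).factorial : ℝ))
      = f ν * (∑ l ∈ Y (n+1), C ν l * f l) / ((n+1).factorial : ℝ) := by
      rw [Finset.mul_sum, Finset.sum_div]
      apply Finset.sum_congr rfl; intros; ring
    rw [h1, up_sum n ν hν, Nat.factorial_succ]
    have : (n.factorial : ℝ) ≠ 0 := by exact_mod_cast Nat.factorial_ne_zero n
    push_cast
    field_simp
  rw [Finset.sum_congr rfl h, ← Finset.sum_div, sum_sq]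
  have : (n.factorial : ℝ) ≠ 0 := by exact_mod_cast Nat.factorial_ne_zero n
  exact div_self this

lemma growth_prob (hP : IsPlancherelGrowthProcess P lam) (n r : ℕ) :
    P.real (growthEvent lam n r) = ∑ p ∈ Pairs n,
      (if p.2.rowLen r = p.1.rowLen r + 1 then (1:ℝ) else 0) * (f p.1 * f p.2 / ((n+1).factorial : ℝ)) := by
  have := hP.1
  have hU : MeasurableSet (⋃ p ∈ Pairs n, Bv lam n p) :=
    Finset.measurableSet_biUnion _ (fun p hp => (Bv_prob hP n p hp).1)
  have hae : ∀ᵐ ω ∂P, ω ∈ ⋃ p ∈ Pairs n, Bv lam n p := by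
    have h1 := total hP n
    rw [Measure.real] at h1
    exact (mem_ae_iff_prob_eq_one hU).2 ((ENNReal.toReal_eq_one_iff _).1 h1)
  have hE : growthEvent lam n r =ᵐ[P] ⋃ p ∈ (Pairs n).filter
      (fun p => p.2.rowLen r = p.1.rowLen r + 1), Bv lam n p := by
    rw [Filter.eventuallyEq_set]
    filter_upwards [hae] with ω hω
    simp only [Set.mem_iUnion, exists_prop] at hω
    obtain ⟨p, hp, hω⟩ := hω
    have e := Bv_mem hω
    simp only [Set.mem_iUnion, exists_prop, Finset.mem_filter]
    constructor
    · intro h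
      refine ⟨p, ⟨hp, ?_⟩, hω⟩
      rw [← e.1, ← e.2]; exact h
    · rintro ⟨q, ⟨_, hq⟩, hω'⟩
      have e' := Bv_mem hω'
      rw [← e'.1, ← e'.2] at hq
      exact hq
  rw [measureReal_congr hE, measureReal_biUnion_finset (Bv_disj n _)
    (fun p hp => (Bv_prob hP n p (Finset.mem_filter.1 hp).1).1),
    Finset.sum_congr rfl (fun p hp => (Bv_prob hP n p (Finset.mem_filter.1 hp).1).2),
    Finset.sum_filter]
  apply Finset.sum_congr rfl
  intros
  split_ifs <;> simp

lemma sum_growth (hP : IsPlancherelGrowthProcess P lam) (K n : ℕ) :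
    ∑ r ∈ Finset.range (K + 1), (P (growthEvent lam n r)).toReal = s K n := by
  have h : ∀ r ∈ Finset.range (K+1), (P (growthEvent lam n r)).toReal = _ :=
    fun r _ => growth_prob hP n r
  rw [Finset.sum_congr rfl h, Finset.sum_comm]
  have h2 : ∀ p ∈ Pairs n, ∑ r ∈ Finset.range (K+1),
      (if p.2.rowLen r = p.1.rowLen r + 1 then (1:ℝ) else 0) * (f p.1 * f p.2 / ((n+1).factorial : ℝ))
      = (rho K p.2 - rho K p.1) * (f p.1 * f p.2 / ((n+1).factorial : ℝ)) := by
    intro p hp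
    rw [← Finset.sum_mul, sum_ind (Finset.mem_filter.1 hp).2]
  rw [Finset.sum_congr rfl h2,
    sum_pairs n (fun ν l => (rho K l - rho K ν) * (f ν * f l / ((n+1).factorial : ℝ))), s,
    Finset.sum_div]
  apply Finset.sum_congr rfl; intros
  rw [Finset.sum_div]
  apply Finset.sum_congr rfl; intros; ring

end meas

end PGP

end PGPaux

/-- Fix `K ≥ 0` and let `s_n = ∑_{0 ≤ r ≤ K} ℙ(E_r⁽ⁿ⁾)` for `n ≥ 1`, where `E_r⁽ⁿ⁾` are the
row-growth events of the Plancherel growth process.  Then `(s_n)_{n ≥ 1}` is weakly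
decreasing.  (With our indexing, `s_{n+1} = ∑_{r ≤ K} ℙ(growthEvent lam n r)`, so the
statement is `s_{n+2} ≤ s_{n+1}` for all `n ≥ 0`.) -/
theorem sum_growth_prob_antitone {Ω : Type*} [MeasurableSpace Ω] (P : Measure Ω)
    (lam : ℕ → Ω → YoungDiagram) (hPGP : IsPlancherelGrowthProcess P lam) (K : ℕ) :
    ∀ n : ℕ,
      ∑ r ∈ Finset.range (K + 1), (P (growthEvent lam (n + 1) r)).toReal ≤
        ∑ r ∈ Finset.range (K + 1), (P (growthEvent lam n r)).toReal := by
  intro n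
  rw [PGP.sum_growth hPGP K (n + 1), PGP.sum_growth hPGP K n]
  exact PGP.s_anti K n
end
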